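/- Let F be a number field with odd class number h(F) and unit group E_F, and let k/F be a quadratic extension in which exactly two primary prime ideals 𝔭₁ and 𝔭₂ of odd norm ramify (and which is unramified at all primes above 2 and at all infinite places). Write 𝔭_j^{h(F)} = (π_j) with π_j primary, set k_j = F(√π_j) with unit group E_j, and let 𝔓₂ (resp. 𝔓₁) be a prime of k₁ above 𝔭₂ (resp. of k₂ above 𝔭₁). For ε ∈ E_F define X₁(ε) = [η₁/𝔓₂] and X₂(ε) = [η₂/𝔓₁], where η_j ∈ E_j is any unit with N_{k_j/F}(η_j) = ε (such η_j exist, and the values are independent of the choices). Then X₁ and X₂ are well-defined characters on E_F, X₁ = X₂, and X₁(ε) = +1 for every unit ε ∈ E_F that is the relative norm of a unit of k. -/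

import Mathlib

open NumberField
open scoped Classical

/-- The quadratic residue symbol `[α/𝔭] ∈ {±1}`, determined by Euler's congruence
`[α/𝔭] ≡ α^((N𝔭 - 1)/2) (mod 𝔭)`. -/
noncomputable def quadResSym (F : Type*) [Field F] [NumberField F]
    (𝔭 : Ideal (𝓞 F)) (α : 𝓞 F) : ℤ :=
  if α ^ ((Ideal.absNorm 𝔭 - 1) / 2) - 1 ∈ 𝔭 then 1 else -1

/-- An ideal `𝔭` is primary if `[ε/𝔭] = 1` for every unit `ε`, i.e. `(E_F/𝔭) = +1`. -/
def IsPrimaryIdeal (F : Type*) [Field F] [NumberField F] (𝔭 : Ideal (𝓞 F)) : Prop :=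
  ∀ ε : (𝓞 F)ˣ, quadResSym F 𝔭 (ε : 𝓞 F) = 1

/-- An element of the ring of integers is primary if it is totally positive and
congruent to a square modulo 4. -/
def IsPrimaryElem (F : Type*) [Field F] [NumberField F] (α : 𝓞 F) : Prop :=
  (∀ φ : F →+* ℝ, 0 < φ (algebraMap (𝓞 F) F α)) ∧ ∃ ξ : 𝓞 F, (4 : 𝓞 F) ∣ α - ξ ^ 2

/-- A prime ideal `𝔭` of `F` is ramified in `K` if some prime of `K` appears at least
twice in the factorization of `𝔭 O_K`. -/
def IsRamifiedIn (F K : Type*) [Field F] [NumberField F] [Field K] [NumberField K]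
    [Algebra F K] (𝔭 : Ideal (𝓞 F)) : Prop :=
  ∃ 𝔓 : Ideal (𝓞 K), 𝔓.IsPrime ∧ 𝔓 ^ 2 ∣ Ideal.map (algebraMap (𝓞 F) (𝓞 K)) 𝔭

/-- `K/F` is unramified at all infinite places: every real embedding of `F`
extends to a real embedding of `K`. -/
def UnramifiedAtInfinitePlaces (F K : Type*) [Field F] [Field K] [Algebra F K] : Prop :=
  ∀ φ : F →+* ℝ, ∃ ψ : K →+* ℝ, ψ.comp (algebraMap F K) = φ

set_option linter.all false

/-- conjugation data of a quadratic extension of number fields -/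
structure QC (F K : Type*) [Field F] [NumberField F] [Field K] [NumberField K] [Algebra F K] where
  σ : 𝓞 K ≃+* 𝓞 K
  inv : ∀ x, σ (σ x) = x
  fix : ∀ a : 𝓞 F, σ (algebraMap (𝓞 F) (𝓞 K) a) = algebraMap (𝓞 F) (𝓞 K) a
  desc : ∀ x, σ x = x → ∃ a : 𝓞 F, algebraMap (𝓞 F) (𝓞 K) a = x
  norm : ∀ x, algebraMap (𝓞 F) (𝓞 K) (RingOfIntegers.norm F x) = x * σ x
  nontriv : ∃ x, σ x ≠ x

theorem QC.exists {F K : Type*} [Field F] [NumberField F] [Field K] [NumberField K] [Algebra F K]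
    (h : Module.finrank F K = 2) : ∃ (D : QC F K) (s : K ≃ₐ[F] K), (∀ x : 𝓞 K, ((D.σ x : 𝓞 K) : K) = s (x : K)) ∧ s ≠ 1 := by
  haveI : Algebra.IsQuadraticExtension F K := { finrank_eq_two' := h }
  have hc : Nat.card (K ≃ₐ[F] K) = 2 := by rw [IsGalois.card_aut_eq_finrank, h]
  obtain ⟨s, hs, hs1, hall⟩ : ∃ s : K ≃ₐ[F] K, s ≠ 1 ∧ s * s = 1 ∧ ∀ t : K ≃ₐ[F] K, t = 1 ∨ t = s := by
    obtain ⟨s, hs, hu⟩ := (Nat.card_eq_two_iff' (1 : K ≃ₐ[F] K)).1 hc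
    have hs' : s ≠ 1 := hs
    refine ⟨s, hs, ?_, fun t => ?_⟩
    · by_contra hss
      have := hu _ hss
      exact hs' (mul_left_cancel (a := s) (by simpa using this))
    · by_cases ht : t = 1
      · exact Or.inl ht
      · exact Or.inr (hu _ ht)
  have hss : ∀ x, s (s x) = x := fun x => by
    have := congrArg (fun f : K ≃ₐ[F] K => f x) hs1
    simpa using this
  have hfix : ∀ x : K, s x = x → ∃ a : F, algebraMap F K a = x := fun x hx => by
    have := (IsGalois.mem_range_algebraMap_iff_fixed (F := F) (E := K) x).2 (fun t => by
      rcases hall t with rfl | rfl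
      · simp
      · exact hx)
    exact this
  refine ⟨⟨RingOfIntegers.mapRingEquiv s.toRingEquiv, ?_, ?_, ?_, ?_, ?_⟩, s, fun x => rfl, hs⟩
  · intro x
    apply RingOfIntegers.ext
    exact hss x
  · intro a
    apply RingOfIntegers.ext
    exact s.commutes (a : F)
  · intro x hx
    obtain ⟨a, ha⟩ := hfix x (congrArg (fun z : 𝓞 K => (z : K)) hx)
    have hai : IsIntegral ℤ a := by
      have : IsIntegral ℤ (algebraMap F K a) := by rw [ha]; exact x.2
      exact (isIntegral_algebraMap_iff (algebraMap F K).injective).1 this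
    exact ⟨⟨a, hai⟩, RingOfIntegers.ext ha⟩
  · intro x
    apply RingOfIntegers.ext
    rw [RingOfIntegers.coe_algebraMap_norm, Algebra.norm_eq_prod_automorphisms]
    have : (Finset.univ : Finset (K ≃ₐ[F] K)) = {1, s} := by
      ext t; simp [hall t]
    rw [this, Finset.prod_pair (Ne.symm hs)]
    rfl
  · by_contra hcon
    push Not at hcon
    apply hs
    ext x
    obtain ⟨n, y, hy, rfl⟩ := IsFractionRing.div_surjective (A := 𝓞 K) x
    have h1 : ∀ z : 𝓞 K, s (z : K) = z := fun z => congrArg (fun z : 𝓞 K => (z : K)) (hcon z)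
    simp only [map_div₀]
    rw [h1, h1]; rfl

section S01
variable {F K : Type*} [Field F] [NumberField F] [Field K] [NumberField K] [Algebra F K]

theorem alg_inj : Function.Injective (algebraMap (𝓞 F) (𝓞 K)) :=
  FaithfulSMul.algebraMap_injective _ _

namespace QC
variable (D : QC F K)

/-- an anti-invariant element -/
theorem anti : ∃ s : 𝓞 K, s ≠ 0 ∧ D.σ s = -s := by
  obtain ⟨x, hx⟩ := D.nontriv
  exact ⟨x - D.σ x, sub_ne_zero.2 (Ne.symm hx), by rw [map_sub, D.inv]; ring⟩

theorem trace (x : 𝓞 K) : ∃ a : 𝓞 F, algebraMap (𝓞 F) (𝓞 K) a = x + D.σ x :=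
  D.desc _ (by rw [map_add, D.inv, add_comm])

theorem norm_alg (D : QC F K) (a : 𝓞 F) : RingOfIntegers.norm F (algebraMap (𝓞 F) (𝓞 K) a) = a ^ 2 := by
  apply alg_inj (K := K)
  rw [D.norm, D.fix, map_pow, sq]

theorem norm_σ (x : 𝓞 K) : RingOfIntegers.norm F (D.σ x) = RingOfIntegers.norm F x := by
  apply alg_inj (K := K)
  rw [D.norm, D.norm, D.inv, mul_comm]

theorem norm_eq_iff (x : 𝓞 K) (a : 𝓞 F) : RingOfIntegers.norm F x = a ↔ x * D.σ x = algebraMap (𝓞 F) (𝓞 K) a := by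
  rw [← D.norm]; exact alg_inj.eq_iff.symm

/-- Hilbert 90 -/
theorem h90 {a b : 𝓞 K} (hb : b ≠ 0) (h : a * D.σ a = b * D.σ b) :
    ∃ γ : 𝓞 K, γ ≠ 0 ∧ a * D.σ γ = b * γ := by
  by_cases hab : a + b = 0
  · obtain ⟨s, hs, hσ⟩ := D.anti
    refine ⟨s, hs, ?_⟩
    rw [hσ, eq_neg_of_add_eq_zero_left hab]; ring
  · refine ⟨D.σ b * (a + b), mul_ne_zero ((map_ne_zero_iff _ D.σ.injective).2 hb) hab, ?_⟩
    rw [map_mul, D.inv, map_add, mul_add, mul_add]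
    linear_combination b * h
end QC

/-- existence of quadratic extension -/
theorem exists_sqrt_ext.{u} (F : Type u) [Field F] [NumberField F] (z : F) (hz : ¬ IsSquare z) :
    ∃ (M : Type u) (_ : Field M) (_ : NumberField M) (_ : Algebra F M),
      Module.finrank F M = 2 ∧ ∃ θ : M, θ ^ 2 = algebraMap F M z := by
  have hirr : Irreducible (Polynomial.X ^ 2 - Polynomial.C z) := by
    refine (X_pow_sub_C_irreducible_iff_of_prime (p := 2) Nat.prime_two).2 ?_
    intro b hb
    exact hz ⟨b, by rw [← hb, sq]⟩
  haveI : Fact (Irreducible (Polynomial.X ^ 2 - Polynomial.C z)) := ⟨hirr⟩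
  have hm : (Polynomial.X ^ 2 - Polynomial.C z).Monic := Polynomial.monic_X_pow_sub_C z (by norm_num)
  have hfr : Module.finrank F (AdjoinRoot (Polynomial.X ^ 2 - Polynomial.C z)) = 2 := by
    rw [(AdjoinRoot.powerBasis' hm).finrank]; simp
  haveI : FiniteDimensional F (AdjoinRoot (Polynomial.X ^ 2 - Polynomial.C z)) :=
    Module.finite_of_finrank_pos (by rw [hfr]; norm_num)
  haveI : CharZero (AdjoinRoot (Polynomial.X ^ 2 - Polynomial.C z)) :=
    charZero_of_injective_algebraMap (algebraMap F _).injective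
  haveI : IsScalarTower ℚ F (AdjoinRoot (Polynomial.X ^ 2 - Polynomial.C z)) := inferInstance
  haveI : FiniteDimensional ℚ (AdjoinRoot (Polynomial.X ^ 2 - Polynomial.C z)) :=
    FiniteDimensional.trans ℚ F _
  refine ⟨AdjoinRoot (Polynomial.X ^ 2 - Polynomial.C z), inferInstance, ⟨⟩, inferInstance, hfr,
    AdjoinRoot.root _, ?_⟩
  have := AdjoinRoot.eval₂_root (Polynomial.X ^ 2 - Polynomial.C z)
  simp only [Polynomial.eval₂_sub, Polynomial.eval₂_pow, Polynomial.eval₂_X, Polynomial.eval₂_C] at this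
  exact sub_eq_zero.1 this

end S01

section S02
variable {F K : Type*} [Field F] [NumberField F] [Field K] [NumberField K] [Algebra F K]

theorem ideal_pow_inj {n : ℕ} (hn : n ≠ 0) {I J : Ideal (𝓞 K)} (h : I ^ n = J ^ n) : I = J := by
  by_cases hI : I = 0
  · subst hI
    rw [zero_pow hn] at h
    exact (pow_eq_zero_iff hn).1 h.symm |>.symm
  by_cases hJ : J = 0
  · subst hJ
    rw [zero_pow hn] at h
    exact (pow_eq_zero_iff hn).1 h
  have h1 := congrArg UniqueFactorizationMonoid.normalizedFactors h
  rw [UniqueFactorizationMonoid.normalizedFactors_pow, UniqueFactorizationMonoid.normalizedFactors_pow] at h1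
  have h2 : UniqueFactorizationMonoid.normalizedFactors I = UniqueFactorizationMonoid.normalizedFactors J := by
    ext a
    have := congrArg (Multiset.count a) h1
    rw [Multiset.count_nsmul, Multiset.count_nsmul] at this
    exact Nat.eq_of_mul_eq_mul_left (Nat.pos_of_ne_zero hn) this
  exact associated_iff_eq.1 ((UniqueFactorizationMonoid.associated_iff_normalizedFactors_eq_normalizedFactors hI hJ).2 h2)

/-- extension of ideals -/
noncomputable abbrev ext (K : Type*) [Field K] [NumberField K] [Algebra F K] (p : Ideal (𝓞 F)) : Ideal (𝓞 K) :=
  Ideal.map (algebraMap (𝓞 F) (𝓞 K)) p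

theorem ext_mul (p q : Ideal (𝓞 F)) : ext K (p * q) = ext K p * ext K q := Ideal.map_mul _ _ _
theorem ext_pow (p : Ideal (𝓞 F)) (n : ℕ) : ext K (p ^ n) = ext K p ^ n := Ideal.map_pow _ _ _
theorem ext_top : ext K (1 : Ideal (𝓞 F)) = 1 := by
  rw [Ideal.one_eq_top, Ideal.one_eq_top]; exact Ideal.map_top _
theorem ext_span (a : 𝓞 F) : ext K (Ideal.span {a}) = Ideal.span {algebraMap (𝓞 F) (𝓞 K) a} := by
  rw [ext, Ideal.map_span, Set.image_singleton]
theorem ext_ne_bot {p : Ideal (𝓞 F)} (hp : p ≠ ⊥) : ext K p ≠ ⊥ := fun h =>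
  hp ((Ideal.map_eq_bot_iff_of_injective (alg_inj (F := F) (K := K))).1 h)

/-- every ideal has a power principal -/
theorem pow_class_principal (K : Type*) [Field K] [NumberField K] {I : Ideal (𝓞 K)} (hI : I ≠ ⊥) :
    ∃ a : 𝓞 K, a ≠ 0 ∧ I ^ classNumber K = Ideal.span {a} := by
  have hI' : I ∈ nonZeroDivisors (Ideal (𝓞 K)) := mem_nonZeroDivisors_of_ne_zero hI
  have h1 : ClassGroup.mk0 (⟨I, hI'⟩ ^ classNumber K : nonZeroDivisors (Ideal (𝓞 K))) = 1 := by
    rw [map_pow]; unfold classNumber; exact pow_card_eq_one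
  have h2 : (I ^ classNumber K).IsPrincipal := by
    refine (ClassGroup.mk0_eq_one_iff (mem_nonZeroDivisors_of_ne_zero (pow_ne_zero _ hI))).1 ?_
    convert h1
    rfl
  obtain ⟨a, ha⟩ := h2
  refine ⟨a, ?_, ha⟩
  rintro rfl
  have : I ^ classNumber K = 0 := by rw [ha]; simp
  exact pow_ne_zero _ hI this

theorem classNumber_ne_zero' (K : Type*) [Field K] [NumberField K] : classNumber K ≠ 0 :=
  (classNumber_pos K).ne'

namespace QC
variable (D : QC F K)

/-- conjugation of ideals -/
noncomputable def s (I : Ideal (𝓞 K)) : Ideal (𝓞 K) := Ideal.map (D.σ : 𝓞 K →+* 𝓞 K) I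

theorem mem_s {I : Ideal (𝓞 K)} {x : 𝓞 K} : x ∈ D.s I ↔ D.σ x ∈ I := by
  unfold s
  constructor
  · intro h
    have : ∃ y ∈ I, (D.σ : 𝓞 K →+* 𝓞 K) y = x :=
      (Ideal.mem_map_iff_of_surjective (D.σ : 𝓞 K →+* 𝓞 K) D.σ.surjective).1 h
    obtain ⟨y, hy, rfl⟩ := this
    have : D.σ ((D.σ : 𝓞 K →+* 𝓞 K) y) = y := D.inv y
    rw [this]; exact hy
  · intro h
    have := Ideal.mem_map_of_mem (D.σ : 𝓞 K →+* 𝓞 K) h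
    have h2 : (D.σ : 𝓞 K →+* 𝓞 K) (D.σ x) = x := D.inv x
    rwa [h2] at this

theorem s_s (I : Ideal (𝓞 K)) : D.s (D.s I) = I := by
  ext x; rw [mem_s, mem_s, D.inv]
theorem s_mul (I J : Ideal (𝓞 K)) : D.s (I * J) = D.s I * D.s J := Ideal.map_mul _ _ _
theorem s_pow (I : Ideal (𝓞 K)) (n : ℕ) : D.s (I ^ n) = D.s I ^ n := Ideal.map_pow _ _ _
theorem s_span (a : 𝓞 K) : D.s (Ideal.span {a}) = Ideal.span {D.σ a} := by
  unfold s; rw [Ideal.map_span, Set.image_singleton]; rfl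
theorem s_ext (p : Ideal (𝓞 F)) : D.s (ext K p) = ext K p := by
  unfold s; rw [ext, Ideal.map_map]; congr 1
  ext1 a; exact D.fix a
theorem s_top : D.s 1 = 1 := by rw [Ideal.one_eq_top]; exact Ideal.map_top _
theorem s_ne_bot {I : Ideal (𝓞 K)} (h : I ≠ ⊥) : D.s I ≠ ⊥ := fun h' => h (by
  rw [← D.s_s I, h']; exact Ideal.map_bot)
theorem s_prime {P : Ideal (𝓞 K)} (h : P.IsPrime) : (D.s P).IsPrime := by
  have : D.s P = Ideal.comap (D.σ : 𝓞 K →+* 𝓞 K) P := by ext x; exact D.mem_s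
  rw [this]; exact Ideal.comap_isPrime _ _
theorem s_comap (P : Ideal (𝓞 K)) : (D.s P).comap (algebraMap (𝓞 F) (𝓞 K)) = P.comap (algebraMap (𝓞 F) (𝓞 K)) := by
  ext x; rw [Ideal.mem_comap, Ideal.mem_comap, mem_s, D.fix]

theorem intNorm_eq (x : 𝓞 K) : Algebra.intNorm (𝓞 F) (𝓞 K) x = RingOfIntegers.norm F x := by
  apply RingOfIntegers.ext
  exact Algebra.algebraMap_intNorm (K := F) (L := K) x

theorem ext_relNorm_span (D : QC F K) (a : 𝓞 K) :
    ext K (Ideal.relNorm (𝓞 F) (Ideal.span {a})) = Ideal.span {a} * D.s (Ideal.span {a}) := by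
  rw [Ideal.relNorm_singleton, ext_span, intNorm_eq, D.norm, s_span, Ideal.span_singleton_mul_span_singleton]

theorem ext_relNorm (D : QC F K) {I : Ideal (𝓞 K)} (hI : I ≠ ⊥) : ext K (Ideal.relNorm (𝓞 F) I) = I * D.s I := by
  obtain ⟨a, ha, h⟩ := pow_class_principal K hI
  apply ideal_pow_inj (classNumber_ne_zero' K)
  rw [← ext_pow, ← map_pow, h, D.ext_relNorm_span, mul_pow, ← D.s_pow, h]

theorem ne_bot_comap {P : Ideal (𝓞 K)} (h : P ≠ ⊥) : P.comap (algebraMap (𝓞 F) (𝓞 K)) ≠ ⊥ :=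
  fun h' => h (Ideal.eq_bot_of_comap_eq_bot h')

theorem dvd_ext_comap (P : Ideal (𝓞 K)) : P ∣ ext K (P.comap (algebraMap (𝓞 F) (𝓞 K))) :=
  Ideal.dvd_iff_le.2 Ideal.map_comap_le

theorem dich {P : Ideal (𝓞 K)} (hP : P.IsPrime) (h0 : P ≠ ⊥) :
    (ext K (P.comap (algebraMap (𝓞 F) (𝓞 K))) = P ∧ D.s P = P) ∨
    (ext K (P.comap (algebraMap (𝓞 F) (𝓞 K))) = P * D.s P ∧
      Ideal.absNorm P = Ideal.absNorm (P.comap (algebraMap (𝓞 F) (𝓞 K)))) := by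
  set p := P.comap (algebraMap (𝓞 F) (𝓞 K)) with hp
  haveI : p.IsPrime := Ideal.comap_isPrime _ _
  haveI : P.LiesOver p := ⟨rfl⟩
  obtain ⟨f, hf⟩ := Ideal.exists_relNorm_eq_pow_of_isPrime (R := 𝓞 F) P p
  have h1 := D.ext_relNorm h0
  rw [hf, ext_pow] at h1
  have hirr : Prime (D.s P) := Ideal.prime_of_isPrime (D.s_ne_bot h0) (D.s_prime hP)
  have hPp : Prime P := Ideal.prime_of_isPrime h0 hP
  obtain ⟨J, hJ⟩ := dvd_ext_comap (F := F) P
  rw [← hp] at hJ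
  match f, h1, hf with
  | 0, h1, _ =>
    exfalso
    rw [pow_zero] at h1
    exact hPp.not_unit (IsUnit.of_mul_eq_one _ h1.symm)
  | 1, h1, hf =>
    right
    rw [pow_one] at h1 hf
    exact ⟨h1, by rw [← hf, Ideal.absNorm_relNorm]⟩
  | (n+2), h1, _ =>
    left
    have h2 : P * (J * (P * J) ^ (n+1)) = P * D.s P := by
      rw [← h1, hJ]; ring
    have h3 := mul_left_cancel₀ hPp.ne_zero h2
    have h4 : P ∣ D.s P := by rw [← h3]; exact ⟨J * J * (P*J)^n, by ring⟩
    have h5 : D.s P = P := (associated_iff_eq.1 (hPp.associated_of_dvd hirr h4)).symm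
    rw [h5] at h3
    have h6 : P * (J * J * (P * J) ^ n) = P * 1 := by
      rw [mul_one]; conv_rhs => rw [← h3]
      ring
    have h7 := mul_left_cancel₀ hPp.ne_zero h6
    have h8 : J = 1 := by
      rw [Ideal.one_eq_top]
      exact Ideal.isUnit_iff.1 (IsUnit.of_mul_eq_one (J * (P*J)^n) (by rw [← h7]; ring))
    exact ⟨by rw [hJ, h8, mul_one], h5⟩
end QC

/-- ramified prime upstairs -/
def Ram (F : Type*) {K : Type*} [Field F] [NumberField F] [Field K] [NumberField K] [Algebra F K] (P : Ideal (𝓞 K)) : Prop :=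
  P.IsPrime ∧ P ≠ ⊥ ∧ ext K (P.comap (algebraMap (𝓞 F) (𝓞 K))) = P ^ 2

theorem Ram.prime {P : Ideal (𝓞 K)} (h : Ram F P) : Prime P := Ideal.prime_of_isPrime h.2.1 h.1

theorem Ram.norm {P : Ideal (𝓞 K)} (D : QC F K) (h : Ram F P) : D.s P = P ∧
    Ideal.absNorm P = Ideal.absNorm (P.comap (algebraMap (𝓞 F) (𝓞 K))) := by
  rcases D.dich h.1 h.2.1 with h1 | h1
  · exfalso
    have : P * P = P * 1 := by rw [mul_one, ← sq, ← h.2.2, h1.1]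
    have := mul_left_cancel₀ h.prime.ne_zero this
    exact h.prime.not_unit (by rw [this]; exact isUnit_one)
  · refine ⟨?_, h1.2⟩
    have : P * P = P * D.s P := by rw [← sq, ← h.2.2, h1.1]
    exact (mul_left_cancel₀ h.prime.ne_zero this).symm

theorem comap_eq_of_le {p : Ideal (𝓞 F)} (hp : p.IsPrime) (hp0 : p ≠ ⊥) {P : Ideal (𝓞 K)} (hP : P.IsPrime)
    (h : ext K p ≤ P) : P.comap (algebraMap (𝓞 F) (𝓞 K)) = p := by
  have hm : p.IsMaximal := hp.isMaximal hp0
  exact (hm.eq_of_le (Ideal.comap_isPrime _ P).ne_top (Ideal.map_le_iff_le_comap.1 h)).symm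

theorem isRamifiedIn_iff (D : QC F K) {p : Ideal (𝓞 F)} (hp : p.IsPrime) (hp0 : p ≠ ⊥) :
    IsRamifiedIn F K p ↔ ∃ P : Ideal (𝓞 K), Ram F P ∧ P.comap (algebraMap (𝓞 F) (𝓞 K)) = p := by
  constructor
  · rintro ⟨P, hP, hd⟩
    have h0 : P ≠ ⊥ := by
      rintro rfl
      rw [Ideal.dvd_iff_le] at hd
      apply ext_ne_bot (K := K) hp0
      rw [eq_bot_iff]; refine hd.trans ?_
      rw [← Ideal.zero_eq_bot, zero_pow two_ne_zero]
    have hle : ext K p ≤ P := Ideal.dvd_iff_le.1 ((dvd_pow_self P two_ne_zero).trans hd)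
    have hc := comap_eq_of_le hp hp0 hP hle
    have hPp : Prime P := Ideal.prime_of_isPrime h0 hP
    refine ⟨P, ⟨hP, h0, ?_⟩, hc⟩
    change P ^ 2 ∣ ext K p at hd
    rcases D.dich hP h0 with h1 | h1
    · exfalso
      rw [hc] at h1
      rw [h1.1] at hd
      obtain ⟨J, hJ⟩ := hd
      have : P * 1 = P * (P * J) := by rw [mul_one]; conv_lhs => rw [hJ]
                                       ring
      have := mul_left_cancel₀ hPp.ne_zero this
      exact hPp.not_unit (IsUnit.of_mul_eq_one _ this.symm)
    · rw [h1.1]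
      rw [hc] at h1
      rw [h1.1, sq] at hd
      have h2 : P ∣ D.s P := (mul_dvd_mul_iff_left hPp.ne_zero).1 hd
      have h5 := associated_iff_eq.1 (hPp.associated_of_dvd
        (Ideal.prime_of_isPrime (D.s_ne_bot h0) (D.s_prime hP)) h2)
      rw [← h5, sq]
  · rintro ⟨P, hP, rfl⟩
    exact ⟨P, hP.1, by rw [← hP.2.2]⟩

theorem exists_prime_dvd {J : Ideal (𝓞 K)} (hJ1 : J ≠ 1) : ∃ P : Ideal (𝓞 K), P.IsPrime ∧ P ∣ J := by
  obtain ⟨P, hP, h⟩ := Ideal.exists_le_maximal J (by rwa [← Ideal.one_eq_top])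
  exact ⟨P, hP.isPrime, Ideal.dvd_iff_le.2 h⟩

/-- ambiguous ideals -/
theorem G4 (D : QC F K) (J : Ideal (𝓞 K)) (hJ : J ≠ ⊥) (hs : D.s J = J) :
    ∃ (a : Ideal (𝓞 F)) (A : Finset (Ideal (𝓞 K))), a ≠ ⊥ ∧ (∀ P ∈ A, Ram F P) ∧
      J = ext K a * ∏ P ∈ A, P := by
  induction' hn : Ideal.absNorm J using Nat.strong_induction_on with n ih generalizing J
  by_cases hJ1 : J = 1
  · exact ⟨1, ∅, one_ne_zero, by simp, by rw [hJ1, ext_top]; simp⟩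
  obtain ⟨P, hP, J', rfl⟩ := exists_prime_dvd hJ1
  have hP0 : P ≠ ⊥ := by rintro rfl; exact hJ (by rw [Ideal.bot_mul])
  have hPp : Prime P := Ideal.prime_of_isPrime hP0 hP
  have hsPp : Prime (D.s P) := Ideal.prime_of_isPrime (D.s_ne_bot hP0) (D.s_prime hP)
  have small : ∀ (I J'' : Ideal (𝓞 K)), I ≠ 1 → I * J'' ≠ ⊥ → Ideal.absNorm J'' < Ideal.absNorm (I * J'') := by
    intro I J'' hI h0
    rw [map_mul]
    have h1 : Ideal.absNorm I ≠ 1 := fun h => hI (by rw [Ideal.one_eq_top]; exact Ideal.absNorm_eq_one_iff.1 h)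
    have h2 : Ideal.absNorm (I * J'') ≠ 0 := fun h => h0 (Ideal.absNorm_eq_zero_iff.1 h)
    rw [map_mul] at h2
    have h3 := left_ne_zero_of_mul h2
    have h4 := right_ne_zero_of_mul h2
    have : 2 ≤ Ideal.absNorm I := by omega
    nlinarith [Nat.pos_of_ne_zero h4]
  -- generic step with an extended prime
  have step : ∀ (p : Ideal (𝓞 F)) (J'' : Ideal (𝓞 K)), p ≠ ⊥ → ext K p ≠ 1 → P * J' = ext K p * J'' → 
      ∃ (a : Ideal (𝓞 F)) (A : Finset (Ideal (𝓞 K))), a ≠ ⊥ ∧ (∀ P ∈ A, Ram F P) ∧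
      P * J' = ext K a * ∏ P ∈ A, P := by
    intro p J'' hp0 hp1 he
    have hJ'' : J'' ≠ ⊥ := by rintro rfl; exact hJ (by rw [he, Ideal.mul_bot])
    have hs'' : D.s J'' = J'' := by
      apply mul_left_cancel₀ (a := ext K p) (ext_ne_bot hp0)
      conv_lhs => rw [← D.s_ext p, ← D.s_mul, ← he, hs, he]
    obtain ⟨a, A, ha, hA, hJA⟩ := ih _ (by rw [← hn, he]; exact small _ _ hp1 (by rw [← he]; exact hJ)) J'' hJ'' hs'' rfl
    exact ⟨p * a, A, mul_ne_zero hp0 ha, hA, by rw [he, hJA, ext_mul, mul_assoc]⟩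
  have hpc0 := QC.ne_bot_comap (F := F) hP0
  have hpc1 : ext K (P.comap (algebraMap (𝓞 F) (𝓞 K))) ≠ 1 := fun h => by
    have := QC.dvd_ext_comap (F := F) P
    rw [h] at this
    exact hPp.not_unit (isUnit_of_dvd_one this)
  rcases D.dich hP hP0 with h1 | h1
  · exact step _ J' hpc0 hpc1 (by rw [h1.1])
  · by_cases hsP : D.s P = P
    · have hR : Ram F P := ⟨hP, hP0, by rw [h1.1, hsP, sq]⟩
      have hJ'0 : J' ≠ ⊥ := by rintro rfl; exact hJ (by rw [Ideal.mul_bot])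
      have hs' : D.s J' = J' := by
        apply mul_left_cancel₀ hPp.ne_zero
        conv_lhs => rw [← hsP, ← D.s_mul, hs]
      obtain ⟨a, A, ha, hA, hJA⟩ := ih _ (by rw [← hn]; exact small _ _ (fun h => hPp.not_unit (by rw [h]; exact isUnit_one)) hJ) J' hJ'0 hs' rfl
      by_cases hPA : P ∈ A
      · refine ⟨a * P.comap (algebraMap (𝓞 F) (𝓞 K)), A.erase P, mul_ne_zero ha hpc0, fun Q hQ => hA Q (Finset.mem_of_mem_erase hQ), ?_⟩
        rw [hJA, ext_mul, h1.1, hsP, ← Finset.mul_prod_erase A _ hPA]; ring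
      · refine ⟨a, insert P A, ha, fun Q hQ => ?_, ?_⟩
        · rcases Finset.mem_insert.1 hQ with rfl | h
          · exact hR
          · exact hA Q h
        · rw [Finset.prod_insert hPA, hJA]; ring
    · have h2 : D.s P ∣ P * J' := by rw [← hs, D.s_mul]; exact dvd_mul_right _ _
      rcases hsPp.dvd_or_dvd h2 with h3 | ⟨J'', rfl⟩
      · exact absurd (associated_iff_eq.1 (hsPp.associated_of_dvd hPp h3)) hsP
      · exact step _ J'' hpc0 hpc1 (by rw [h1.1, mul_assoc])

/-- ramified primes have trivial action on residue field -/
theorem surj_of_absNorm {P : Ideal (𝓞 K)} (h0 : P ≠ ⊥) 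
    (h : Ideal.absNorm P = Ideal.absNorm (P.comap (algebraMap (𝓞 F) (𝓞 K)))) (y : 𝓞 K) :
    ∃ a : 𝓞 F, y - algebraMap (𝓞 F) (𝓞 K) a ∈ P := by
  set p := P.comap (algebraMap (𝓞 F) (𝓞 K)) with hp
  let f : 𝓞 F ⧸ p →+* 𝓞 K ⧸ P := Ideal.quotientMap P (algebraMap (𝓞 F) (𝓞 K)) le_rfl
  have hinj : Function.Injective f := Ideal.quotientMap_injective
  haveI : Finite (𝓞 K ⧸ P) := Ideal.finiteQuotientOfFreeOfNeBot P h0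
  haveI : Finite (𝓞 F ⧸ p) := Finite.of_injective f hinj
  have hcard : Nat.card (𝓞 F ⧸ p) = Nat.card (𝓞 K ⧸ P) := by
    rw [Ideal.absNorm_apply, Ideal.absNorm_apply, Submodule.cardQuot_apply, Submodule.cardQuot_apply] at h
    exact h.symm
  have hb := (Nat.bijective_iff_injective_and_card f).2 ⟨hinj, hcard⟩
  obtain ⟨a, ha⟩ := hb.2 (Ideal.Quotient.mk P y)
  obtain ⟨a, rfl⟩ := Ideal.Quotient.mk_surjective a
  refine ⟨a, ?_⟩
  rw [Ideal.quotientMap_mk, Eq.comm, Ideal.Quotient.eq] at ha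
  exact ha

theorem Ram.act {P : Ideal (𝓞 K)} (D : QC F K) (h : Ram F P) (y : 𝓞 K) : D.σ y - y ∈ P := by
  obtain ⟨a, ha⟩ := surj_of_absNorm h.2.1 (h.norm D).2 y
  have h1 : D.σ (y - algebraMap (𝓞 F) (𝓞 K) a) ∈ P := by rw [← D.mem_s, (h.norm D).1]; exact ha
  rw [map_sub, D.fix] at h1
  have := P.sub_mem h1 ha
  convert this using 1; ring

end S02

section S03
theorem herbrand {G : Type*} [CommGroup G] (n d : G →* G) (A B : Subgroup G) (m : G)
    (hA : ∀ x ∈ A, n x = x ^ 2) (hB : B = n.ker) (hA' : A = d.ker) (hBd : ∀ x ∈ B, d x = x ^ 2)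
    (hn : n.range ≤ A) (hd : d.range ≤ B) (hnd : ∀ x, n x * d x = x ^ 2)
    (hm1 : m ≠ 1) (hmA : m ∈ A) (hmB : m ∈ B) (hm : ∀ x : G, x ^ 2 = 1 → x = 1 ∨ x = m)
    (hidx : (powMonoidHom 2 : G →* G).range.index ≠ 0)
    (he : ((A.map (powMonoidHom 2)).relIndex A) ^ 2 ≤ (powMonoidHom 2 : G →* G).range.index)
    (hy : d.range.relIndex B ≠ 0) : 2 * n.range.relIndex A ≤ d.range.relIndex B := by
  set q : G →* G := powMonoidHom 2 with hq
  have hqa : ∀ x, q x = x ^ 2 := fun x => rfl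
  set C := A ⊔ B with hC
  have mm : m ^ 2 = 1 := by rw [← hA m hmA]; rw [hB] at hmB; exact hmB
  have c1 : (A.map q).comap n = C := by
    ext x
    constructor
    · rintro ⟨a, ha, hax⟩
      rw [hqa] at hax
      have : a⁻¹ * x ∈ B := by
        rw [hB, MonoidHom.mem_ker, map_mul, map_inv, hA a ha, hax]; simp
      have := C.mul_mem (Subgroup.mem_sup_left ha : a ∈ C) (Subgroup.mem_sup_right this : a⁻¹ * x ∈ C)
      simpa using this
    · intro hx
      obtain ⟨a, ha, b, hb, rfl⟩ := Subgroup.mem_sup.1 hx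
      rw [hB] at hb
      refine ⟨a, ha, ?_⟩
      rw [map_mul, hA a ha, MonoidHom.mem_ker.1 hb, mul_one]; rfl
  have c2 : (B.map q).comap d = C := by
    ext x
    constructor
    · rintro ⟨a, ha, hax⟩
      rw [hqa] at hax
      have : a⁻¹ * x ∈ A := by
        rw [hA', MonoidHom.mem_ker, map_mul, map_inv, hBd a ha, hax]; simp
      have := C.mul_mem (Subgroup.mem_sup_right ha : a ∈ C) (Subgroup.mem_sup_left this : a⁻¹ * x ∈ C)
      simpa using this
    · intro hx
      obtain ⟨a, ha, b, hb, rfl⟩ := Subgroup.mem_sup.1 hx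
      rw [hA'] at ha
      refine ⟨b, hb, ?_⟩
      rw [map_mul, hBd b hb, MonoidHom.mem_ker.1 ha, one_mul]; rfl
  have i1 : C.index = (A.map q).relIndex n.range := by rw [← c1, Subgroup.index_comap]
  have i2 : C.index = (B.map q).relIndex d.range := by rw [← c2, Subgroup.index_comap]
  have l1 : A.map q ≤ n.range := by
    rintro _ ⟨a, ha, rfl⟩; exact ⟨a, hA a ha⟩
  have l2 : B.map q ≤ d.range := by
    rintro _ ⟨a, ha, rfl⟩; exact ⟨a, hBd a ha⟩
  have j1 : C.index * n.range.relIndex A = (A.map q).relIndex A := by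
    rw [i1, Subgroup.relIndex_mul_relIndex _ _ _ l1 hn]
  have j2 : C.index * d.range.relIndex B = (B.map q).relIndex B := by
    rw [i2, Subgroup.relIndex_mul_relIndex _ _ _ l2 hd]
  have hqC : q.range ≤ C := by
    rintro _ ⟨x, rfl⟩
    rw [hqa, ← hnd]
    exact C.mul_mem (Subgroup.mem_sup_left (hn ⟨x, rfl⟩)) (Subgroup.mem_sup_right (hd ⟨x, rfl⟩))
  have hCi : C.index ≠ 0 := fun h => hidx (by
    rw [← Subgroup.relIndex_mul_index hqC, h, mul_zero])
  -- [C:C²] = [G:G²]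
  have c3 : (C.map q).comap q = C := by
    ext x
    constructor
    · rintro ⟨c, hc, hcx⟩
      rw [hqa, hqa] at hcx
      rcases hm (c⁻¹ * x) (by rw [mul_pow, ← hcx, ← mul_pow]; simp) with h | h
      · have : x = c := by rw [inv_mul_eq_one] at h; exact h.symm
        rw [this]; exact hc
      · have : x = c * m := by rw [← h]; simp
        rw [this]; exact C.mul_mem hc (Subgroup.mem_sup_left hmA)
    · intro hx; exact ⟨x, hx, rfl⟩
  have i3 : C.index = (C.map q).relIndex q.range := by 
    conv_lhs => rw [← c3]
    rw [Subgroup.index_comap]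
  have hCq : C.map q ≤ q.range := by rintro _ ⟨x, _, rfl⟩; exact ⟨x, rfl⟩
  have j3 : (C.map q).relIndex C = q.range.index := by
    have e1 := Subgroup.relIndex_mul_index (hCq.trans hqC)
    have e2 := Subgroup.relIndex_mul_index hCq
    rw [← i3, ← e1, mul_comm] at e2
    exact (Nat.eq_of_mul_eq_mul_right (Nat.pos_of_ne_zero hCi) e2).symm
  -- product
  let φ : A × B →* G := (A.subtype.coprod B.subtype)
  have hφ : ∀ x : A × B, φ x = x.1 * x.2 := fun x => rfl
  have hφr : φ.range = C := by
    ext x; constructor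
    · rintro ⟨⟨a, b⟩, rfl⟩
      exact C.mul_mem (Subgroup.mem_sup_left a.2) (Subgroup.mem_sup_right b.2)
    · intro hx
      obtain ⟨a, ha, b, hb, rfl⟩ := Subgroup.mem_sup.1 hx
      exact ⟨⟨⟨a, ha⟩, ⟨b, hb⟩⟩, rfl⟩
  have i4 : ((C.map q).comap φ).index = (C.map q).relIndex C := by
    rw [Subgroup.index_comap, hφr]
  let S : Subgroup (A × B) := ((A.map q).subgroupOf A).prod ((B.map q).subgroupOf B)
  have hS : S ≤ (C.map q).comap φ := by
    rintro ⟨a, b⟩ ⟨⟨a', ha', h1⟩, ⟨b', hb', h2⟩⟩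
    refine ⟨a' * b', C.mul_mem (Subgroup.mem_sup_left ha') (Subgroup.mem_sup_right hb'), ?_⟩
    rw [map_mul, h1, h2]; rfl
  have hSi : S.index = (A.map q).relIndex A * (B.map q).relIndex B := by
    rw [Subgroup.index_prod]; rfl
  have e5 := Subgroup.relIndex_mul_index hS
  rw [i4, hSi, j3] at e5
  have hA0 : n.range.relIndex A ≠ 0 ∨ n.range.relIndex A = 0 := (em _).symm
  have hne1 : S.relIndex ((C.map q).comap φ) ≠ 1 := by
    rw [Ne, Subgroup.relIndex_eq_one]
    intro hle
    have : ((⟨m, hmA⟩, ⟨m, hmB⟩) : A × B) ∈ S := hle (by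
      refine ⟨1, C.one_mem, ?_⟩
      rw [map_one, hφ]; change 1 = m * m; rw [← sq, mm])
    obtain ⟨⟨a, ha, h1⟩, ⟨b, hb, h2⟩⟩ := this
    change q a = m at h1
    change q b = m at h2
    rw [hqa] at h1 h2
    have hbA : b ∈ A := by
      rcases hm (a⁻¹ * b) (by rw [mul_pow, inv_pow, h1, h2]; simp) with h | h
      · rw [inv_mul_eq_one] at h; rw [← h]; exact ha
      · have : b = a * m := by rw [← h]; simp
        rw [this]; exact A.mul_mem ha hmA
    apply hm1
    rw [← h2, ← hA b hbA]
    rw [hB] at hb; exact hb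
  rcases hA0 with hA0 | hA0
  swap
  · rw [hA0]; simp
  set x := n.range.relIndex A
  set y := d.range.relIndex B
  set c := C.index
  rw [← j1, ← j2] at e5
  rw [← j1] at he
  have h2 : 2 ≤ S.relIndex ((C.map q).comap φ) := by
    have : S.relIndex ((C.map q).comap φ) ≠ 0 := by
      intro h; rw [h, zero_mul] at e5
      have : c * x * (c * y) ≠ 0 := by positivity
      exact this e5.symm
    omega
  have : 2 * (c * x) ^ 2 ≤ c * x * (c * y) := by
    rw [← e5]; exact Nat.mul_le_mul h2 he
  have hp : 0 < c * x * c := by positivity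
  have h3 : (c * x * c) * (2 * x) ≤ (c * x * c) * y := by nlinarith
  exact Nat.le_of_mul_le_mul_left h3 hp

/-- index of squares in the unit group -/
theorem index_sq_units (K : Type*) [Field K] [NumberField K] :
    (powMonoidHom 2 : (𝓞 K)ˣ →* (𝓞 K)ˣ).range.index = 2 ^ Fintype.card (InfinitePlace K) := by
  set T := Units.torsion K
  set r := Units.rank K with hr
  let g : T × Multiplicative (Fin r → ℤ) →* (𝓞 K)ˣ :=
    { toFun := fun p => (p.1 : (𝓞 K)ˣ) * ∏ i, (Units.fundSystem K i) ^ ((Multiplicative.toAdd p.2) i)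
      map_one' := by simp
      map_mul' := by
        rintro ⟨a, f⟩ ⟨b, f'⟩
        simp only [Prod.mk_mul_mk, Subgroup.coe_mul, toAdd_mul, Pi.add_apply, zpow_add, Finset.prod_mul_distrib]
        exact mul_mul_mul_comm _ _ _ _ }
  have hg : Function.Bijective g := by
    constructor
    · rintro ⟨a, f⟩ ⟨b, f'⟩ h
      obtain ⟨z, hz, hu⟩ := Units.exist_unique_eq_mul_prod K (g (a, f))
      have h1 := hu (a, Multiplicative.toAdd f) rfl
      have h2 := hu (b, Multiplicative.toAdd f') h
      have := h1.trans h2.symm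
      exact this
    · intro x
      obtain ⟨z, hz, hu⟩ := Units.exist_unique_eq_mul_prod K x
      exact ⟨(z.1, Multiplicative.ofAdd z.2), hz.symm⟩
  let ψ2 : (Fin r → ℤ) →+ (Fin r → ZMod 2) := 
    { toFun := fun f i => (f i : ZMod 2)
      map_zero' := by ext; simp
      map_add' := by intros; ext; simp }
  let ψ : T × Multiplicative (Fin r → ℤ) →* (T ⧸ (powMonoidHom 2 : T →* T).range) × Multiplicative (Fin r → ZMod 2) :=
    (QuotientGroup.mk' _).prodMap (AddMonoidHom.toMultiplicative ψ2)
  have hψs : Function.Surjective ψ := by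
    rintro ⟨a, f⟩
    obtain ⟨a, rfl⟩ := QuotientGroup.mk'_surjective _ a
    refine ⟨(a, Multiplicative.ofAdd (fun i => ((Multiplicative.toAdd f i : ZMod 2).val : ℤ))), ?_⟩
    refine Prod.ext rfl ?_
    apply Multiplicative.toAdd.injective
    funext i
    change (((Multiplicative.toAdd f i : ZMod 2).val : ℤ) : ZMod 2) = _
    simp
  have hψk : ψ.ker = (powMonoidHom 2).range := by
    ext ⟨a, f⟩
    rw [MonoidHom.mem_ker]
    constructor
    · intro h
      have h1 : (QuotientGroup.mk' (powMonoidHom 2 : T →* T).range) a = 1 := congrArg Prod.fst h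
      have h2 : ψ2 (Multiplicative.toAdd f) = 0 := congrArg Prod.snd h
      obtain ⟨b, hb⟩ := (QuotientGroup.eq_one_iff a).1 h1
      have h3 : ∀ i, ∃ c : ℤ, Multiplicative.toAdd f i = 2 * c := fun i => by
        have := congrFun h2 i
        exact (ZMod.intCast_zmod_eq_zero_iff_dvd _ 2).1 this
      choose c hc using h3
      refine ⟨(b, Multiplicative.ofAdd c), Prod.ext hb ?_⟩
      change (Multiplicative.ofAdd c) ^ 2 = f
      rw [← ofAdd_nsmul, ← ofAdd_toAdd f]; congr 1
      funext i; simp [hc]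
    · rintro ⟨⟨b, c⟩, h⟩
      rw [← h]
      refine Prod.ext ?_ ?_
      · exact (QuotientGroup.eq_one_iff _).2 ⟨b, rfl⟩
      · change Multiplicative.ofAdd (ψ2 (2 • Multiplicative.toAdd c)) = Multiplicative.ofAdd 0
        congr 1
        funext i
        change (((2 • Multiplicative.toAdd c) i : ℤ) : ZMod 2) = 0
        simp only [Pi.smul_apply, nsmul_eq_mul, Int.cast_mul]
        have : ((2:ℕ):ℤ) = 2 := rfl
        rw [this]
        have : ((2:ℤ) : ZMod 2) = 0 := by decide
        rw [this, zero_mul]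
  have hidx : (powMonoidHom 2 : T × Multiplicative (Fin r → ℤ) →* _).range.index = 2 * 2 ^ r := by
    rw [← hψk, Subgroup.index_ker, MonoidHom.range_eq_top.2 hψs, Subgroup.card_top, Nat.card_prod]
    congr 1
    · rw [← Subgroup.index_eq_card, IsCyclic.index_powMonoidHom_range]
      rw [Nat.gcd_eq_right_iff_dvd]
      exact Units.even_torsionOrder K |>.two_dvd
    · change Nat.card (Fin r → ZMod 2) = _
      simp
  have : (powMonoidHom 2 : (𝓞 K)ˣ →* (𝓞 K)ˣ).range.index = 2 * 2 ^ r := by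
    rw [← hidx, ← Subgroup.index_comap_of_surjective _ hg.2]
    congr 1
    ext x
    constructor
    · rintro ⟨y, hy⟩
      obtain ⟨y, rfl⟩ := hg.2 y
      refine ⟨y, hg.1 ?_⟩
      rw [← hy]; simp
    · rintro ⟨y, rfl⟩
      exact ⟨g y, by simp⟩
  rw [this, hr, Units.rank, ← pow_succ']
  congr 1
  have := Fintype.card_pos (α := InfinitePlace K)
  omega

end S03

section S04
variable {F K : Type*} [Field F] [NumberField F] [Field K] [NumberField K] [Algebra F K]

theorem card_inf (h2 : Module.finrank F K = 2) (hinf : UnramifiedAtInfinitePlaces F K) :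
    Fintype.card (InfinitePlace K) = Fintype.card (InfinitePlace F) * 2 := by
  haveI : Algebra.IsQuadraticExtension F K := { finrank_eq_two' := h2 }
  haveI : IsUnramifiedAtInfinitePlaces F K := ⟨fun w => by
    rw [InfinitePlace.isUnramified_iff]
    by_cases hv : InfinitePlace.IsReal (w.comap (algebraMap F K))
    · left
      obtain ⟨ψ, hψ⟩ := hinf (InfinitePlace.embedding_of_isReal hv)
      let w' : InfinitePlace K := InfinitePlace.mk (Complex.ofRealHom.comp ψ)
      have hw' : w'.IsReal := by
        rw [InfinitePlace.isReal_mk_iff, ComplexEmbedding.isReal_iff]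
        ext x; simp [ComplexEmbedding.conjugate]
      have hc : w'.comap (algebraMap F K) = w.comap (algebraMap F K) := by
        rw [InfinitePlace.comap_mk, ← InfinitePlace.mk_embedding (w.comap (algebraMap F K))]
        congr 1
        ext x
        rw [← InfinitePlace.embedding_of_isReal_apply hv, ← hψ]
        rfl
      obtain ⟨g, hg⟩ := InfinitePlace.exists_smul_eq_of_comap_eq hc
      rw [← hg]; exact InfinitePlace.isReal_smul_iff.2 hw'
    · right; exact InfinitePlace.not_isReal_iff_isComplex.1 hv⟩
  rw [IsUnramifiedAtInfinitePlaces.card_infinitePlace F K, h2]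

/-- norms of units -/
noncomputable def NU (F K : Type*) [Field F] [NumberField F] [Field K] [NumberField K] [Algebra F K] :
    Subgroup (𝓞 F)ˣ := (Units.map (RingOfIntegers.norm F : 𝓞 K →* 𝓞 F)).range

theorem mem_NU {ε : (𝓞 F)ˣ} : ε ∈ NU F K ↔ ∃ u : (𝓞 K)ˣ, RingOfIntegers.norm F (u : 𝓞 K) = (ε : 𝓞 F) := by
  constructor
  · rintro ⟨u, rfl⟩; exact ⟨u, rfl⟩
  · rintro ⟨u, h⟩; exact ⟨u, Units.ext h⟩

namespace QC
variable (D : QC F K)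
/-- conjugation on units -/
noncomputable def u : (𝓞 K)ˣ →* (𝓞 K)ˣ := Units.map (D.σ : 𝓞 K →* 𝓞 K)
theorem u_val (x : (𝓞 K)ˣ) : (D.u x : 𝓞 K) = D.σ x := rfl
theorem u_u (x : (𝓞 K)ˣ) : D.u (D.u x) = x := Units.ext (D.inv x)
noncomputable def nn : (𝓞 K)ˣ →* (𝓞 K)ˣ := MonoidHom.id _ * D.u
noncomputable def dd : (𝓞 K)ˣ →* (𝓞 K)ˣ := MonoidHom.id _ / D.u
theorem nn_ap (x) : D.nn x = x * D.u x := rfl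
theorem dd_ap (x) : D.dd x = x / D.u x := rfl

theorem herb (h2 : Module.finrank F K = 2) (hinf : UnramifiedAtInfinitePlaces F K)
    (hy : D.dd.range.relIndex D.nn.ker ≠ 0) : 2 * (NU F K).index ≤ D.dd.range.relIndex D.nn.ker := by
  let ι : (𝓞 F)ˣ →* (𝓞 K)ˣ := Units.map (algebraMap (𝓞 F) (𝓞 K) : 𝓞 F →* 𝓞 K)
  have hι : Function.Injective ι := fun a b h => Units.ext (alg_inj (K := K) (congrArg Units.val h))
  have hA : D.dd.ker = ι.range := by
    ext x
    rw [MonoidHom.mem_ker, dd_ap, div_eq_one]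
    constructor
    · intro h
      obtain ⟨a, ha⟩ := D.desc x (congrArg Units.val h.symm)
      obtain ⟨b, hb⟩ := D.desc (x⁻¹ : (𝓞 K)ˣ) (by
        have := congrArg (fun z : (𝓞 K)ˣ => ((z⁻¹ : (𝓞 K)ˣ) : 𝓞 K)) h.symm
        simp only [← map_inv] at this; exact this)
      refine ⟨⟨a, b, alg_inj (K := K) ?_, alg_inj (K := K) ?_⟩, Units.ext ha⟩ <;> simp [ha, hb]
    · rintro ⟨a, rfl⟩
      exact Units.ext (D.fix a).symm
  have hnι : ∀ x, D.nn x = ι (Units.map (RingOfIntegers.norm F : 𝓞 K →* 𝓞 F) x) := fun x =>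
    Units.ext (D.norm x).symm
  have e1 : (NU F K).index = D.nn.range.relIndex D.dd.ker := by
    rw [hA, ← Subgroup.index_comap]; congr 1
    ext x; constructor
    · rintro ⟨y, rfl⟩; exact ⟨y, hnι y⟩
    · rintro ⟨y, hy⟩; exact ⟨y, hι (by rw [← hy, hnι])⟩
  have e2 : (D.dd.ker.map (powMonoidHom 2)).relIndex D.dd.ker = 2 ^ Fintype.card (InfinitePlace F) := by
    rw [← index_sq_units F]
    conv_lhs => rw [hA, ← Subgroup.index_comap]
    congr 1
    ext x; constructor
    · rintro ⟨_, ⟨y, rfl⟩, hy⟩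
      exact ⟨y, hι (by rw [← hy]; simp)⟩
    · rintro ⟨y, rfl⟩
      exact ⟨ι y, ⟨y, rfl⟩, by simp⟩
  have fixA : ∀ x ∈ D.dd.ker, D.u x = x := fun x hx => by
    rw [MonoidHom.mem_ker, dd_ap, div_eq_one] at hx; exact hx.symm
  have fixB : ∀ x ∈ D.nn.ker, D.u x = x⁻¹ := fun x hx => by
    rw [MonoidHom.mem_ker, nn_ap] at hx; exact (inv_eq_of_mul_eq_one_right hx).symm
  rw [e1]
  refine herbrand D.nn D.dd _ _ (-1) ?_ rfl rfl ?_ ?_ ?_ ?_ ?_ ?_ ?_ ?_ ?_ ?_ hy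
  · intro x hx; rw [nn_ap, fixA x hx, sq]
  · intro x hx; rw [dd_ap, fixB x hx, div_inv_eq_mul, sq]
  · rintro _ ⟨x, rfl⟩
    rw [MonoidHom.mem_ker, dd_ap, nn_ap, map_mul, u_u, mul_comm (D.u x), div_self']
  · rintro _ ⟨x, rfl⟩
    rw [MonoidHom.mem_ker, nn_ap, dd_ap, map_div, u_u, div_mul_div_cancel, div_self']
  · intro x; rw [nn_ap, dd_ap, mul_mul_div_cancel, sq]
  · intro h
    have := congrArg Units.val h
    simp only [Units.val_neg, Units.val_one] at this
    exact (neg_one_eq_one_iff.not.2 (by simp [ringChar.eq_zero])) this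
  · rw [MonoidHom.mem_ker, dd_ap, div_eq_one]; exact Units.ext (by rw [u_val]; simp)
  · rw [MonoidHom.mem_ker, nn_ap]; exact Units.ext (by rw [Units.val_mul, u_val]; simp)
  · intro x hx
    have : (x : 𝓞 K) ^ 2 = 1 := by rw [← Units.val_pow_eq_pow_val, hx, Units.val_one]
    rw [sq] at this; rcases mul_self_eq_one_iff.1 this with h | h
    · left; exact Units.ext h
    · right; exact Units.ext (by rw [h]; simp)
  · rw [index_sq_units]; positivity
  · rw [e2, index_sq_units, card_inf h2 hinf, pow_mul]
end QC

end S04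

section S05
variable {F K : Type*} [Field F] [NumberField F] [Field K] [NumberField K] [Algebra F K]

theorem span_eq_span {a b : 𝓞 K} (h : Ideal.span {a} = Ideal.span {b}) : ∃ v : (𝓞 K)ˣ, a * v = b :=
  Ideal.span_singleton_eq_span_singleton.1 h

theorem ext_pow_principal {a : Ideal (𝓞 F)} (ha : a ≠ ⊥) : ∃ x : 𝓞 F, x ≠ 0 ∧
    (ext K a) ^ classNumber F = Ideal.span {algebraMap (𝓞 F) (𝓞 K) x} := by
  obtain ⟨x, hx, h⟩ := pow_class_principal F ha
  exact ⟨x, hx, by rw [← ext_pow, h, ext_span]⟩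

theorem alg_ne_zero {x : 𝓞 F} (hx : x ≠ 0) : algebraMap (𝓞 F) (𝓞 K) x ≠ 0 :=
  (map_ne_zero_iff _ alg_inj).2 hx

theorem inj_H1 (D : QC F K) (hodd : Odd (classNumber F)) {u u' : (𝓞 K)ˣ} (hu : u ∈ D.nn.ker) (hu' : u' ∈ D.nn.ker)
    {γ γ' : 𝓞 K} (hγ : γ ≠ 0) (hγ' : γ' ≠ 0) (h : u * D.σ γ = γ) (h' : u' * D.σ γ' = γ')
    {a a' : Ideal (𝓞 F)} (ha : a ≠ ⊥) (ha' : a' ≠ ⊥) (I : Ideal (𝓞 K))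
    (hI : Ideal.span {γ} = ext K a * I) (hI' : Ideal.span {γ'} = ext K a' * I) : u / u' ∈ D.dd.range := by
  set n := classNumber F
  obtain ⟨x, hx, hx'⟩ := ext_pow_principal (K := K) ha
  obtain ⟨y, hy, hy'⟩ := ext_pow_principal (K := K) ha'
  have e : Ideal.span {γ' ^ n * algebraMap (𝓞 F) (𝓞 K) x} = Ideal.span {γ ^ n * algebraMap (𝓞 F) (𝓞 K) y} := by
    rw [← Ideal.span_singleton_mul_span_singleton, ← Ideal.span_singleton_mul_span_singleton,
      ← Ideal.span_singleton_pow, ← Ideal.span_singleton_pow, hI, hI', ← hx', ← hy']; ring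
  obtain ⟨v, hv⟩ := span_eq_span e
  have hv' := congrArg D.σ hv
  simp only [map_mul, map_pow, D.fix] at hv'
  have hsγ : D.σ γ' ≠ 0 := (map_ne_zero_iff _ D.σ.injective).2 hγ'
  have hx0 := alg_ne_zero (K := K) hx
  have key : (u' : 𝓞 K) ^ n * v = (u : 𝓞 K) ^ n * D.σ v := by
    apply mul_left_cancel₀ (mul_ne_zero (pow_ne_zero n hsγ) hx0)
    have h1 : γ' ^ n = (u' : 𝓞 K) ^ n * D.σ γ' ^ n := by rw [← mul_pow, h']
    have h2 : γ ^ n = (u : 𝓞 K) ^ n * D.σ γ ^ n := by rw [← mul_pow, h]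
    rw [h1, h2] at hv
    linear_combination hv - (u : 𝓞 K) ^ n * hv'
  have key' : (u / u') ^ n = D.dd v := by
    rw [QC.dd_ap, div_pow, div_eq_div_iff_mul_eq_mul]
    refine Units.ext ?_
    push_cast
    rw [D.u_val, ← key]; ring
  have hw : u / u' ∈ D.nn.ker := D.nn.ker.div_mem hu hu'
  have hw2 : (u / u') ^ 2 = D.dd (u / u') := by
    rw [MonoidHom.mem_ker, QC.nn_ap] at hw
    rw [QC.dd_ap, ← inv_eq_of_mul_eq_one_right hw, div_inv_eq_mul, sq]
  obtain ⟨m, hm⟩ := hodd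
  have : u / u' = D.dd v / (D.dd (u / u')) ^ m := by
    rw [← key', ← hw2, ← pow_mul, show n = 2 * m + 1 from hm, pow_succ]; simp
  rw [this]
  exact D.dd.range.div_mem ⟨_, rfl⟩ (D.dd.range.pow_mem ⟨_, rfl⟩ _)

theorem H1_data (D : QC F K) {u : (𝓞 K)ˣ} (hu : u ∈ D.nn.ker) :
    ∃ (A : Finset (Ideal (𝓞 K))) (γ : 𝓞 K) (a : Ideal (𝓞 F)), γ ≠ 0 ∧ u * D.σ γ = γ ∧ a ≠ ⊥ ∧ (∀ P ∈ A, Ram F P) ∧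
      Ideal.span {γ} = ext K a * ∏ P ∈ A, P := by
  have hu' : (u : 𝓞 K) * D.σ u = 1 * D.σ 1 := by
    rw [map_one, mul_one]; exact congrArg Units.val hu
  obtain ⟨γ, hγ, h⟩ := D.h90 one_ne_zero hu'
  rw [one_mul] at h
  have hs : D.s (Ideal.span {γ}) = Ideal.span {γ} := by
    rw [D.s_span, Ideal.span_singleton_eq_span_singleton]
    exact ⟨u, by rw [mul_comm]; exact h⟩
  obtain ⟨a, A, ha, hA, he⟩ := G4 D (Ideal.span {γ}) (by simpa using hγ) hs
  exact ⟨A, γ, a, hγ, h, ha, hA, he⟩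

theorem G_core (D : QC F K) (hodd : Odd (classNumber F)) (h2 : Module.finrank F K = 2)
    (hinf : UnramifiedAtInfinitePlaces F K) (R : Finset (Ideal (𝓞 K))) (hR : ∀ P, Ram F P → P ∈ R) :
    2 * (NU F K).index ≤ 2 ^ R.card ∧ (2 ^ R.card ≤ 2 * (NU F K).index → ∀ A ⊆ R, ∃ (γ : 𝓞 K) (a : Ideal (𝓞 F)), γ ≠ 0 ∧ a ≠ ⊥ ∧
      Ideal.span {γ} = ext K a * ∏ P ∈ A, P) := by
  let B := D.nn.ker
  let Q := B ⧸ (D.dd.range.subgroupOf B)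
  choose A γ a hγ hu ha hA he using fun q : Q => H1_data D (q.out).2
  let f : Q → R.powerset := fun q => ⟨A q, Finset.mem_powerset.2 fun P hP => hR P (hA q P hP)⟩
  have hf : Function.Injective f := by
    intro q q' h
    have h1 : A q = A q' := congrArg Subtype.val h
    have := inj_H1 D hodd q.out.2 q'.out.2 (hγ q) (hγ q') (hu q) (hu q') (ha q) (ha q') _ (he q) (by rw [he q', h1])
    rw [← q.out_eq', ← q'.out_eq']
    refine QuotientGroup.eq.2 ?_
    rw [Subgroup.mem_subgroupOf]
    have := D.dd.range.inv_mem this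
    rw [inv_div] at this
    push_cast
    rw [mul_comm, ← div_eq_mul_inv]; exact this
  haveI : Finite Q := Finite.of_injective f hf
  have hc : D.dd.range.relIndex D.nn.ker = Nat.card Q := rfl
  have hp : Nat.card R.powerset = 2 ^ R.card := by
    rw [Nat.card_eq_fintype_card, Fintype.card_coe, Finset.card_powerset]
  have h1 := D.herb h2 hinf (by rw [hc]; exact Nat.card_pos.ne')
  have h3 : Nat.card Q ≤ 2 ^ R.card := by rw [← hp]; exact Nat.card_le_card_of_injective f hf
  rw [hc] at h1
  refine ⟨h1.trans h3, fun h4 A' hA' => ?_⟩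
  have hb := (Nat.bijective_iff_injective_and_card f).2 ⟨hf, by rw [hp]; omega⟩
  obtain ⟨q, hq⟩ := hb.2 ⟨A', Finset.mem_powerset.2 hA'⟩
  have : A q = A' := congrArg Subtype.val hq
  exact ⟨γ q, a q, hγ q, ha q, by rw [he q, this]⟩

/-- principal ideals -/
def Pr (I : Ideal (𝓞 K)) : Prop := ∃ x : 𝓞 K, x ≠ 0 ∧ I = Ideal.span {x}

theorem Pr.of_mul {I : Ideal (𝓞 K)} {x y : 𝓞 K} (hx : x ≠ 0) (hy : y ≠ 0) (h : Ideal.span {x} * I = Ideal.span {y}) : Pr I := by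
  have : y ∈ (Ideal.span {x} : Ideal (𝓞 K)) := by
    have : (Ideal.span {y} : Ideal (𝓞 K)) ≤ Ideal.span {x} := by rw [← h, mul_comm]; exact Ideal.mul_le_right (I := I) (J := Ideal.span {x})
    exact this (Ideal.mem_span_singleton_self y)
  obtain ⟨z, rfl⟩ := Ideal.mem_span_singleton.1 this
  refine ⟨z, right_ne_zero_of_mul hy, ?_⟩
  rw [← Ideal.span_singleton_mul_span_singleton] at h
  exact mul_left_cancel₀ (by simpa using hx) h

/-- all ambiguous ideals have principal h-th power -/
def AmbPr (D : QC F K) : Prop := ∀ J : Ideal (𝓞 K), J ≠ ⊥ → D.s J = J → Pr (J ^ classNumber F)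

theorem G_B (D : QC F K) (hodd : Odd (classNumber F)) (h2 : Module.finrank F K = 2)
    (hinf : UnramifiedAtInfinitePlaces F K) (R : Finset (Ideal (𝓞 K))) (hR : ∀ P, Ram F P → P ∈ R)
    (h : 2 ^ R.card ≤ 2 * (NU F K).index) : AmbPr D := by
  intro J hJ hs
  obtain ⟨b, A, hb, hA, hJA⟩ := G4 D J hJ hs
  obtain ⟨γ, a, hγ, ha, he⟩ := (G_core D hodd h2 hinf R hR).2 h A (fun P hP => hR P (hA P hP))
  obtain ⟨x, hx, hx'⟩ := ext_pow_principal (K := K) ha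
  obtain ⟨y, hy, hy'⟩ := ext_pow_principal (K := K) hb
  refine Pr.of_mul (alg_ne_zero hx) (mul_ne_zero (alg_ne_zero hy) (pow_ne_zero (classNumber F) hγ)) ?_
  rw [← Ideal.span_singleton_mul_span_singleton, ← Ideal.span_singleton_pow, he, ← hx', ← hy', hJA]; ring

theorem AMB (D : QC F K) (hA : AmbPr D) {e : Ideal (𝓞 K)} (he : e ≠ ⊥) {β : 𝓞 K} (h1 : e ^ 2 = Ideal.span {β})
    {n : 𝓞 F} (h2 : e * D.s e = Ideal.span {algebraMap (𝓞 F) (𝓞 K) n}) (η : (𝓞 K)ˣ)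
    (h3 : β * D.σ β = (algebraMap (𝓞 F) (𝓞 K) n) ^ 2 * (η * D.σ η)) : Pr (e ^ classNumber F) := by
  have hn : algebraMap (𝓞 F) (𝓞 K) n ≠ 0 := by
    intro h; rw [h] at h2
    have : e * D.s e = 0 := by rw [h2]; simp
    rcases mul_eq_zero.1 this with h | h
    · exact he h
    · exact D.s_ne_bot he h
  obtain ⟨γ, hγ, h4⟩ := D.h90 (a := β) (b := algebraMap (𝓞 F) (𝓞 K) n * η) (mul_ne_zero hn η.ne_zero) (by
    rw [h3, map_mul, D.fix]; ring)
  -- β σγ = n η γ ; e² (σγ) = e s(e) (γ)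
  have h5 : e * Ideal.span {D.σ γ} = D.s e * Ideal.span {γ} := by
    apply mul_left_cancel₀ (a := e) he
    rw [← mul_assoc, ← sq, h1, ← mul_assoc, h2, Ideal.span_singleton_mul_span_singleton, h4,
      Ideal.span_singleton_mul_span_singleton, Ideal.span_singleton_eq_span_singleton]
    exact ⟨η⁻¹, by linear_combination (algebraMap (𝓞 F) (𝓞 K) n * γ) * η.mul_inv⟩
  obtain ⟨z, hz, hz'⟩ := hA (e * Ideal.span {D.σ γ}) (mul_ne_zero he (by simpa using hγ)) (by
    rw [D.s_mul, D.s_span, D.inv, ← h5])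
  refine Pr.of_mul (x := D.σ γ ^ classNumber F) (pow_ne_zero _ ((map_ne_zero_iff _ D.σ.injective).2 hγ)) hz ?_
  rw [← hz', mul_pow, ← Ideal.span_singleton_pow, mul_comm]

end S05

section S06
variable {F K : Type*} [Field F] [NumberField F] [Field K] [NumberField K] [Algebra F K]

theorem NU_index_ne (D : QC F K) : (NU F K).index ≠ 0 := by
  have h : (powMonoidHom 2 : (𝓞 F)ˣ →* (𝓞 F)ˣ).range ≤ NU F K := by
    rintro _ ⟨x, rfl⟩
    rw [mem_NU]
    refine ⟨Units.map (algebraMap (𝓞 F) (𝓞 K) : 𝓞 F →* 𝓞 K) x, ?_⟩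
    simpa using D.norm_alg (x : 𝓞 F)
  have := Subgroup.index_dvd_of_le h
  rw [index_sq_units] at this
  intro h0
  rw [h0, zero_dvd_iff] at this
  exact absurd this (by positivity)

theorem Pr.pow {I : Ideal (𝓞 K)} (h : Pr I) (n : ℕ) : Pr (I ^ n) := by
  obtain ⟨x, hx, rfl⟩ := h
  exact ⟨x ^ n, pow_ne_zero _ hx, by rw [Ideal.span_singleton_pow]⟩

theorem Pr.mul {I J : Ideal (𝓞 K)} (h : Pr I) (h' : Pr J) : Pr (I * J) := by
  obtain ⟨x, hx, rfl⟩ := h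
  obtain ⟨y, hy, rfl⟩ := h'
  exact ⟨x * y, mul_ne_zero hx hy, by rw [Ideal.span_singleton_mul_span_singleton]⟩

theorem Pr.cancel {I J : Ideal (𝓞 K)} (h : Pr I) (h' : Pr (I * J)) : Pr J := by
  obtain ⟨x, hx, rfl⟩ := h
  obtain ⟨y, hy, e⟩ := h'
  exact Pr.of_mul hx hy e

theorem Pr.odd {I : Ideal (𝓞 K)} {m : ℕ} (hm : Odd m) (h2 : Pr (I ^ 2)) (h : Pr (I ^ m)) : Pr I := by
  obtain ⟨j, rfl⟩ := hm
  refine Pr.cancel (h2.pow j) ?_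
  rwa [← pow_mul, ← pow_succ]

theorem Pr.class (K : Type*) [Field K] [NumberField K] {I : Ideal (𝓞 K)} (hI : I ≠ ⊥) : Pr (I ^ classNumber K) := pow_class_principal K hI

theorem two_tors (D : QC F K) (hodd : Odd (classNumber F)) {e : Ideal (𝓞 K)} (he : e ≠ ⊥) (h : Pr (e ^ 2)) :
    ∃ (β : 𝓞 K) (n : 𝓞 F) (ε : (𝓞 F)ˣ), e ^ 2 = Ideal.span {β} ∧ e * D.s e = Ideal.span {algebraMap (𝓞 F) (𝓞 K) n} ∧
      β * D.σ β = algebraMap (𝓞 F) (𝓞 K) n ^ 2 * algebraMap (𝓞 F) (𝓞 K) ε := by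
  obtain ⟨β, hβ, h1⟩ := h
  set a := Ideal.relNorm (𝓞 F) e
  have ha : a ≠ ⊥ := by
    intro h
    have := D.ext_relNorm he
    rw [show Ideal.relNorm (𝓞 F) e = ⊥ from h] at this
    have h2 : e * D.s e = 0 := by rw [← this]; exact Ideal.map_bot
    rcases mul_eq_zero.1 h2 with h | h
    · exact he h
    · exact D.s_ne_bot he h
  have ha2 : a ^ 2 = Ideal.span {RingOfIntegers.norm F β} := by
    rw [← map_pow, h1, Ideal.relNorm_singleton, QC.intNorm_eq]
  have hN : RingOfIntegers.norm F β ≠ 0 := by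
    intro h0
    rw [h0] at ha2
    exact ha (pow_eq_zero_iff two_ne_zero |>.1 (by rw [ha2]; simp))
  obtain ⟨n, hn, hn'⟩ := Pr.odd hodd ⟨_, hN, ha2⟩ (Pr.class F ha)
  rw [hn', Ideal.span_singleton_pow] at ha2
  obtain ⟨ε, hε⟩ := span_eq_span ha2
  refine ⟨β, n, ε, h1, ?_, ?_⟩
  · rw [← D.ext_relNorm he, ← ext_span, ← hn']
  · rw [← D.norm, ← hε, map_mul, map_pow]

theorem AMB' (D : QC F K) (hA : AmbPr D) (hodd : Odd (classNumber F)) (hN : NU F K = ⊤) {e : Ideal (𝓞 K)} (he : e ≠ ⊥) (h : Pr (e ^ 2)) :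
    Pr (e ^ classNumber F) := by
  obtain ⟨β, n, ε, h1, h2, h3⟩ := two_tors D hodd he h
  have : ε ∈ NU F K := by rw [hN]; trivial
  obtain ⟨η, hη⟩ := mem_NU.1 this
  rw [D.norm_eq_iff] at hη
  exact AMB D hA he h1 h2 η (by rw [h3, hη])

theorem odd_order (D : QC F K) (hA : AmbPr D) (hodd : Odd (classNumber F)) (hN : NU F K = ⊤) {b : Ideal (𝓞 K)} (hb : b ≠ ⊥) :
    ∃ m, Odd m ∧ Pr (b ^ m) := by
  obtain ⟨s, m, hm, hs⟩ := Nat.exists_eq_two_pow_mul_odd (classNumber_ne_zero' K)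
  have h := Pr.class K hb
  rw [hs] at h
  clear hs
  induction s generalizing m with
  | zero => exact ⟨m, hm, by simpa using h⟩
  | succ s ih =>
    refine ih (m * classNumber F) (hm.mul hodd) ?_
    rw [← mul_assoc, pow_mul]
    refine AMB' D hA hodd hN (pow_ne_zero _ hb) ?_
    rwa [← pow_mul, mul_right_comm, ← pow_succ]

theorem t1_NU (D : QC F K) (hodd : Odd (classNumber F)) (h2 : Module.finrank F K = 2)
    (hinf : UnramifiedAtInfinitePlaces F K) {P : Ideal (𝓞 K)} (hR : ∀ Q, Ram F Q → Q = P) : NU F K = ⊤ ∧ AmbPr D := by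
  have h := (G_core D hodd h2 hinf {P} (by simpa using hR)).1
  have h0 := NU_index_ne D
  rw [Finset.card_singleton] at h
  have h1 : (NU F K).index = 1 := by omega
  refine ⟨Subgroup.index_eq_one.1 h1, G_B D hodd h2 hinf {P} (by simpa using hR) (by rw [h1]; simp)⟩

theorem t1_H1 (D : QC F K) (hodd : Odd (classNumber F)) {P : Ideal (𝓞 K)} (hR : ∀ Q, Ram F Q → Q = P)
    {θ : 𝓞 K} (hθ : θ ≠ 0) (hσ : D.σ θ = -θ) {a : Ideal (𝓞 F)} (ha : a ≠ ⊥) (hI : Ideal.span {θ} = ext K a * P)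
    {u : (𝓞 K)ˣ} (hu : (u : 𝓞 K) * D.σ u = 1) : ∃ v : (𝓞 K)ˣ, u * D.u v = v ∨ u * D.u v = - v := by
  have hu : u ∈ D.nn.ker := Units.ext hu
  obtain ⟨A, γ, b, hγ, h, hb, hA, he⟩ := H1_data D hu
  rcases Finset.subset_singleton_iff.1 (show A ⊆ {P} from fun Q hQ => by simpa using hR Q (hA Q hQ)) with rfl | rfl
  · obtain ⟨v, hv⟩ := inj_H1 D hodd hu (one_mem _) (γ' := 1) hγ one_ne_zero h (by simp) hb (a' := 1) one_ne_zero 1 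
      (by simpa using he) (by rw [ext_top]; simp)
    refine ⟨v, Or.inl ?_⟩
    rw [QC.dd_ap, div_one] at hv; rw [← hv]; simp
  · obtain ⟨v, hv⟩ := inj_H1 D hodd hu (u' := -1) (by rw [MonoidHom.mem_ker, QC.nn_ap]; refine Units.ext ?_; simp [D.u_val]) (γ' := θ) hγ hθ h (by simp [hσ]) hb ha P 
      (by simpa using he) hI
    refine ⟨v, Or.inr ?_⟩
    rw [QC.dd_ap] at hv
    rw [eq_div_iff_mul_eq'] at hv
    rw [← hv, div_eq_mul_inv]
    simp
    
end S06

section S07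
variable {F K : Type*} [Field F] [NumberField F] [Field K] [NumberField K] [Algebra F K]

/-- square modulo `P` -/
def Rs (P : Ideal (𝓞 K)) (x : 𝓞 K) : Prop := ∃ b, x - b * b ∈ P

theorem Rs_iff {P : Ideal (𝓞 K)} {x : 𝓞 K} : Rs P x ↔ IsSquare (Ideal.Quotient.mk P x) := by
  constructor
  · rintro ⟨b, hb⟩
    exact ⟨Ideal.Quotient.mk P b, by rw [← map_mul]; exact Ideal.Quotient.eq.2 hb⟩
  · rintro ⟨b, hb⟩
    obtain ⟨b, rfl⟩ := Ideal.Quotient.mk_surjective b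
    exact ⟨b, Ideal.Quotient.eq.1 (by rw [hb, map_mul])⟩

theorem Rs.mul {P : Ideal (𝓞 K)} {x y : 𝓞 K} (h : Rs P x) (h' : Rs P y) : Rs P (x * y) := by
  rw [Rs_iff] at *; rw [map_mul]; exact IsSquare.mul h h'

theorem Rs.pow {P : Ideal (𝓞 K)} {x : 𝓞 K} (h : Rs P x) (n : ℕ) : Rs P (x ^ n) := by
  rw [Rs_iff] at *; rw [map_pow]; exact IsSquare.pow n h

theorem Rs_sq (P : Ideal (𝓞 K)) (x : 𝓞 K) : Rs P (x * x) := ⟨x, by simp⟩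

theorem Rs_congr {P : Ideal (𝓞 K)} {x y : 𝓞 K} (h : x - y ∈ P) : Rs P x ↔ Rs P y := by
  rw [Rs_iff, Rs_iff, Ideal.Quotient.eq.2 h]

theorem Rs_of_mul {P : Ideal (𝓞 K)} (hP : P.IsPrime) (h0 : P ≠ ⊥) {x y : 𝓞 K} (h : Rs P (x * y)) (hx : Rs P x) (hx0 : x ∉ P) :
    Rs P y := by
  haveI := hP.isMaximal h0
  letI := Ideal.Quotient.field P
  rw [Rs_iff] at *
  rw [map_mul] at h
  have hx0 : Ideal.Quotient.mk P x ≠ 0 := fun h => hx0 (Ideal.Quotient.eq_zero_iff_mem.1 h)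
  have := IsSquare.div h hx
  rwa [mul_div_cancel_left₀ _ hx0] at this

theorem Rs_of_pow_odd {P : Ideal (𝓞 K)} (hP : P.IsPrime) (h0 : P ≠ ⊥) {x : 𝓞 K} {n : ℕ} (hn : Odd n) (h : Rs P (x ^ n)) (hx0 : x ∉ P) :
    Rs P x := by
  obtain ⟨m, rfl⟩ := hn
  refine Rs_of_mul hP h0 (x := x ^ (2 * m)) (by rwa [← pow_succ]) ?_ ?_
  · rw [two_mul, pow_add]; exact Rs_sq _ _
  · exact fun h => hx0 (hP.mem_of_pow_mem _ h)

theorem card_quot (P : Ideal (𝓞 K)) : Nat.card (𝓞 K ⧸ P) = Ideal.absNorm P := by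
  rw [Ideal.absNorm_apply]; rfl

theorem euler {P : Ideal (𝓞 K)} (hP : P.IsPrime) (h0 : P ≠ ⊥) (hodd : Odd (Ideal.absNorm P)) {x : 𝓞 K} (hx : x ∉ P) :
    (Rs P x ↔ x ^ ((Ideal.absNorm P - 1) / 2) - 1 ∈ P) ∧ 
      (x ^ ((Ideal.absNorm P - 1) / 2) - 1 ∈ P ∨ x ^ ((Ideal.absNorm P - 1) / 2) + 1 ∈ P) ∧ (2 : 𝓞 K) ∉ P := by
  haveI := hP.isMaximal h0
  letI := Ideal.Quotient.field P
  haveI := Ideal.finiteQuotientOfFreeOfNeBot P h0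
  letI := Fintype.ofFinite (𝓞 K ⧸ P)
  have hx0 : Ideal.Quotient.mk P x ≠ 0 := fun h => hx (Ideal.Quotient.eq_zero_iff_mem.1 h)
  have hc : Fintype.card (𝓞 K ⧸ P) = Ideal.absNorm P := by rw [← card_quot, Nat.card_eq_fintype_card]
  have h2 : ringChar (𝓞 K ⧸ P) ≠ 2 := by
    intro h
    rw [FiniteField.even_card_iff_char_two, hc] at h
    rw [Nat.odd_iff] at hodd; omega
  have e : Fintype.card (𝓞 K ⧸ P) / 2 = (Ideal.absNorm P - 1) / 2 := by
    rw [hc]; obtain ⟨m, hm⟩ := hodd; omega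
  have h3 := FiniteField.isSquare_iff h2 hx0
  have h4 := FiniteField.pow_dichotomy h2 hx0
  rw [e] at h3 h4
  refine ⟨?_, ?_, ?_⟩
  · rw [Rs_iff, h3, ← map_pow, ← map_one (Ideal.Quotient.mk P), Ideal.Quotient.eq]
  · rw [← map_pow] at h4
    refine h4.imp (fun h => ?_) (fun h => ?_)
    · rwa [← map_one (Ideal.Quotient.mk P), Ideal.Quotient.eq] at h
    · rw [← Ideal.Quotient.eq_zero_iff_mem, map_add, h, map_one]; simp
  · intro h
    have : (2 : 𝓞 K ⧸ P) = 0 := by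
      rw [← map_ofNat (Ideal.Quotient.mk P) 2]; exact Ideal.Quotient.eq_zero_iff_mem.2 h
    exact Ring.two_ne_zero h2 this

theorem sym_eq_one {P : Ideal (𝓞 K)} (hP : P.IsPrime) (h0 : P ≠ ⊥) (hodd : Odd (Ideal.absNorm P)) {x : 𝓞 K} (hx : x ∉ P) :
    quadResSym K P x = 1 ↔ Rs P x := by
  rw [(euler hP h0 hodd hx).1]; unfold quadResSym
  split_ifs with h <;> simp [h]

theorem sym_val (P : Ideal (𝓞 K)) (x : 𝓞 K) : quadResSym K P x = 1 ∨ quadResSym K P x = -1 := by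
  unfold quadResSym; split_ifs <;> simp

theorem two_notMem {P : Ideal (𝓞 K)} (hP : P.IsPrime) (h0 : P ≠ ⊥) (hodd : Odd (Ideal.absNorm P)) : (2 : 𝓞 K) ∉ P :=
  (euler hP h0 hodd (x := 1) (fun h => hP.ne_top ((Ideal.eq_top_iff_one _).2 h))).2.2

theorem Rs_or {P : Ideal (𝓞 K)} (hP : P.IsPrime) (h0 : P ≠ ⊥) (hodd : Odd (Ideal.absNorm P)) {x y : 𝓞 K} (hx : x ∉ P) (hy : y ∉ P)
    (h1 : ¬ Rs P x) (h2 : ¬ Rs P y) : Rs P (x * y) := by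
  have hxy : x * y ∉ P := fun h => (hP.mem_or_mem h).elim hx hy
  rw [(euler hP h0 hodd hxy).1]
  have a := (euler hP h0 hodd hx).2.1.resolve_left (fun h => h1 ((euler hP h0 hodd hx).1.2 h))
  have b := (euler hP h0 hodd hy).2.1.resolve_left (fun h => h2 ((euler hP h0 hodd hy).1.2 h))
  rw [mul_pow]
  have := P.sub_mem (P.mul_mem_left (x ^ ((Ideal.absNorm P - 1) / 2)) b) a
  convert this using 1; ring

theorem sym_mul {P : Ideal (𝓞 K)} (hP : P.IsPrime) (h0 : P ≠ ⊥) (hodd : Odd (Ideal.absNorm P)) {x y : 𝓞 K} (hx : x ∉ P) (hy : y ∉ P) :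
    quadResSym K P (x * y) = quadResSym K P x * quadResSym K P y := by
  have hxy : x * y ∉ P := fun h => (hP.mem_or_mem h).elim hx hy
  have A := sym_eq_one hP h0 hodd hx
  have B := sym_eq_one hP h0 hodd hy
  have C := sym_eq_one hP h0 hodd hxy
  by_cases h1 : Rs P x <;> by_cases h2 : Rs P y
  · rw [A.2 h1, B.2 h2, C.2 (h1.mul h2)]; rfl
  · rw [A.2 h1, one_mul, (sym_val P y).resolve_left (fun h => h2 (B.1 h)), (sym_val P _).resolve_left (fun h => h2 (Rs_of_mul hP h0 (C.1 h) h1 hx))]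
  · rw [B.2 h2, mul_one, (sym_val P x).resolve_left (fun h => h1 (A.1 h)), (sym_val P _).resolve_left (fun h => h1 (Rs_of_mul hP h0 (by rw [mul_comm]; exact C.1 h) h2 hy))]
  · rw [C.2 (Rs_or hP h0 hodd hx hy h1 h2), (sym_val P x).resolve_left (fun h => h1 (A.1 h)), (sym_val P y).resolve_left (fun h => h2 (B.1 h))]; rfl

theorem unit_notMem {P : Ideal (𝓞 K)} (hP : P.IsPrime) (u : (𝓞 K)ˣ) : (u : 𝓞 K) ∉ P := fun h =>
  hP.ne_top (Ideal.eq_top_of_isUnit_mem _ h u.isUnit)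

/-- restriction to base when the residue field does not grow -/
theorem Rs_alg {P : Ideal (𝓞 K)} (hs : ∀ y, ∃ a : 𝓞 F, y - algebraMap (𝓞 F) (𝓞 K) a ∈ P) (x : 𝓞 F) :
    Rs P (algebraMap (𝓞 F) (𝓞 K) x) ↔ Rs (P.comap (algebraMap (𝓞 F) (𝓞 K))) x := by
  constructor
  · rintro ⟨b, hb⟩
    obtain ⟨a, ha⟩ := hs b
    refine ⟨a, ?_⟩
    rw [Ideal.mem_comap, map_sub, map_mul]
    have := P.add_mem hb (P.mul_mem_left (b + algebraMap (𝓞 F) (𝓞 K) a) ha)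
    convert this using 1; ring
  · rintro ⟨b, hb⟩
    refine ⟨algebraMap (𝓞 F) (𝓞 K) b, ?_⟩
    rw [Ideal.mem_comap, map_sub, map_mul] at hb; exact hb

theorem Ram.surj {P : Ideal (𝓞 K)} (D : QC F K) (h : Ram F P) (y : 𝓞 K) : ∃ a : 𝓞 F, y - algebraMap (𝓞 F) (𝓞 K) a ∈ P :=
  surj_of_absNorm h.2.1 (h.norm D).2 y

theorem Ram.Rs_norm {P : Ideal (𝓞 K)} (D : QC F K) (h : Ram F P) {y : 𝓞 K} {n : 𝓞 F} (hn : y * D.σ y = algebraMap (𝓞 F) (𝓞 K) n) :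
    Rs (P.comap (algebraMap (𝓞 F) (𝓞 K))) n := by
  rw [← Rs_alg (h.surj D), ← hn]
  exact ⟨y, by convert P.mul_mem_left y (h.act D y) using 1; ring⟩

/-- units squares modulo p -/
def US (p : Ideal (𝓞 F)) : Prop := ∀ u : (𝓞 F)ˣ, Rs p (u : 𝓞 F)

theorem US_of {p : Ideal (𝓞 F)} (hp : p.IsPrime) (h0 : p ≠ ⊥) (ho : Odd (Ideal.absNorm p)) (h : IsPrimaryIdeal F p) : US p :=
  fun u => (sym_eq_one hp h0 ho (unit_notMem hp u)).1 (h u)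

theorem span_desc (D : QC F K) {a b : 𝓞 F} (h : (Ideal.span {algebraMap (𝓞 F) (𝓞 K) a} : Ideal (𝓞 K)) = Ideal.span {algebraMap (𝓞 F) (𝓞 K) b}) :
    (Ideal.span {a} : Ideal (𝓞 F)) = Ideal.span {b} := by
  obtain ⟨v, hv⟩ := span_eq_span h
  apply ideal_pow_inj two_ne_zero
  rw [Ideal.span_singleton_pow, Ideal.span_singleton_pow, Ideal.span_singleton_eq_span_singleton]
  refine ⟨Units.map (RingOfIntegers.norm F : 𝓞 K →* 𝓞 F) v, ?_⟩
  rw [← D.norm_alg, ← D.norm_alg, ← hv, map_mul]; rfl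

/-- coprime lemma -/
theorem Wlem (D : QC F K) {P : Ideal (𝓞 K)} (h : Ram F P) (hU : US (P.comap (algebraMap (𝓞 F) (𝓞 K))))
    {b b' : Ideal (𝓞 K)} (hb : ¬ b ≤ P) (hb' : ¬ b' ≤ P) {x y : 𝓞 K} (hx : x ≠ 0) (hy : y ≠ 0)
    (e : b * Ideal.span {x} = b' * Ideal.span {y}) {n n' : 𝓞 F} (hn : b * D.s b = Ideal.span {algebraMap (𝓞 F) (𝓞 K) n})
    (hn' : b' * D.s b' = Ideal.span {algebraMap (𝓞 F) (𝓞 K) n'}) : Rs (P.comap (algebraMap (𝓞 F) (𝓞 K))) (n * n') := by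
  have hPp := h.1
  obtain ⟨z, hz, hzP⟩ := Set.not_subset.1 hb'
  have h1 : z * y ∈ b * Ideal.span {x} := by rw [e]; exact Ideal.mul_mem_mul hz (Ideal.mem_span_singleton_self y)
  rw [Ideal.mem_mul_span_singleton] at h1
  obtain ⟨z', hz', ez⟩ := h1
  have e2 : b * Ideal.span {z} = b' * Ideal.span {z'} := by
    have hxb : (Ideal.span {x} : Ideal (𝓞 K)) ≠ 0 := by simpa using hx
    apply mul_right_cancel₀ hxb
    have hyb : (Ideal.span {y} : Ideal (𝓞 K)) ≠ 0 := by simpa using hy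
    rw [mul_right_comm, e, mul_assoc, mul_assoc, Ideal.span_singleton_mul_span_singleton, Ideal.span_singleton_mul_span_singleton, ez, mul_comm y z]
  have hz0 : z ≠ 0 := fun h => hzP (by rw [h]; exact P.zero_mem)
  have hz'P : z' ∉ P := by
    intro hz'P
    have : b * Ideal.span {z} ≤ P := by
      rw [e2]; exact (Ideal.mul_le_right (J := Ideal.span {z'})).trans ((Ideal.span_singleton_le_iff_mem _).2 hz'P)
    rcases (Ideal.IsPrime.mul_le hPp).1 this with h | h
    · exact hb h
    · exact hzP (h (Ideal.mem_span_singleton_self z))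
  have e3 : Ideal.span {algebraMap (𝓞 F) (𝓞 K) n * (z * D.σ z)} = Ideal.span {algebraMap (𝓞 F) (𝓞 K) n' * (z' * D.σ z')} := by
    rw [← Ideal.span_singleton_mul_span_singleton, ← Ideal.span_singleton_mul_span_singleton, ← Ideal.span_singleton_mul_span_singleton,
      ← Ideal.span_singleton_mul_span_singleton, ← hn, ← hn', ← D.s_span, ← D.s_span]
    calc _ = (b * Ideal.span {z}) * D.s (b * Ideal.span {z}) := by rw [D.s_mul]; ring
      _ = (b' * Ideal.span {z'}) * D.s (b' * Ideal.span {z'}) := by rw [e2]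
      _ = _ := by rw [D.s_mul]; ring
  rw [← D.norm, ← D.norm, ← map_mul, ← map_mul, ← ext_span, ← ext_span] at e3
  set p := P.comap (algebraMap (𝓞 F) (𝓞 K)) with hp
  have e4 : (Ideal.span {n * RingOfIntegers.norm F z} : Ideal (𝓞 F)) = Ideal.span {n' * RingOfIntegers.norm F z'} := by
    rw [ext_span, ext_span] at e3
    exact span_desc D e3
  obtain ⟨u, hu⟩ := span_eq_span e4
  have r1 := h.Rs_norm D (y := z) (D.norm z).symm
  have r2 := h.Rs_norm D (y := z') (D.norm z').symm
  have hpp : p.IsPrime := Ideal.comap_isPrime _ _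
  have hp0 : p ≠ ⊥ := QC.ne_bot_comap h.2.1
  have nz : ∀ w, w ∉ P → RingOfIntegers.norm F w ∉ p := by
    intro w hw hw'
    rw [hp, Ideal.mem_comap, D.norm] at hw'
    rcases hPp.mem_or_mem hw' with h5 | h5
    · exact hw h5
    · rw [← D.mem_s, (h.norm D).1] at h5; exact hw h5
  refine Rs_of_mul hpp hp0 (x := RingOfIntegers.norm F z' ) ?_ r2 (nz _ hz'P)
  have : RingOfIntegers.norm F z' * (n * n') = (n * n) * RingOfIntegers.norm F z * u := by rw [mul_comm n n', ← mul_assoc, mul_comm _ n', ← hu]; ring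
  rw [this]
  exact ((Rs_sq _ _).mul r1).mul (hU u)
end S07

section S08
variable {F K : Type*} [Field F] [NumberField F] [Field K] [NumberField K] [Algebra F K]

/-- `θ` is a square root of `x` generating `K` -/
def SQ (D : QC F K) (x : 𝓞 F) (θ : 𝓞 K) : Prop := θ * θ = algebraMap (𝓞 F) (𝓞 K) x ∧ D.σ θ = -θ

theorem SQ.of (D : QC F K) {x : 𝓞 F} {θ : 𝓞 K} (h : θ * θ = algebraMap (𝓞 F) (𝓞 K) x) (hx : ¬ IsSquare x) : SQ D x θ := by
  refine ⟨h, ?_⟩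
  have h1 : D.σ θ * D.σ θ = θ * θ := by rw [← map_mul, h, D.fix]
  rcases mul_self_eq_mul_self_iff.1 h1 with h2 | h2
  · obtain ⟨a, rfl⟩ := D.desc θ h2
    exact absurd ⟨a, alg_inj (K := K) (by rw [← h, map_mul])⟩ hx
  · exact h2

theorem SQ.ne_zero {D : QC F K} {x : 𝓞 F} {θ : 𝓞 K} (h : SQ D x θ) (hx : x ≠ 0) : θ ≠ 0 := by
  rintro rfl
  have := h.1
  rw [mul_zero] at this
  exact alg_ne_zero (K := K) hx this.symm

theorem int_quad (z : K) (a b : 𝓞 K) (h : z * z = a * z + b) : ∃ w : 𝓞 K, (w : K) = z := by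
  have : IsIntegral (𝓞 K) z := by
    refine ⟨Polynomial.X ^ 2 - Polynomial.C a * Polynomial.X - Polynomial.C b, ?_, ?_⟩
    · rw [sub_sub]
      apply Polynomial.monic_X_pow_sub
      compute_degree!
    · simp only [Polynomial.eval₂_sub, Polynomial.eval₂_mul, Polynomial.eval₂_pow, Polynomial.eval₂_X, Polynomial.eval₂_C]
      rw [sq, h]; simp
  have h2 : IsIntegral ℤ z := isIntegral_trans (A := 𝓞 K) z this
  exact ⟨⟨z, h2⟩, rfl⟩

theorem int_sqrt (z : K) (a : 𝓞 K) (h : z * z = a) : ∃ w : 𝓞 K, (w : K) = z ∧ w * w = a := by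
  obtain ⟨w, hw⟩ := int_quad z 0 a (by simpa using h)
  exact ⟨w, hw, RingOfIntegers.ext (by rw [← h, ← hw]; simp)⟩

/-- if `4 ∣ z²-2az+..` then halves are integral -/
theorem int_half (c a b : 𝓞 K) (h : c * c = 2 * a * c + 4 * b) : ∃ w : 𝓞 K, 2 * w = c := by
  obtain ⟨w, hw⟩ := int_quad ((c : K) / 2) a b (by
    have := congrArg (algebraMap (𝓞 K) K) h
    simp only [map_mul, map_add, map_ofNat] at this
    linear_combination this / 4)
  exact ⟨w, RingOfIntegers.ext (by
    change algebraMap (𝓞 K) K (2 * w) = _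
    rw [map_mul, map_ofNat]
    change 2 * (w : K) = _
    rw [hw]; ring)⟩

theorem SQ.omega {D : QC F K} {x : 𝓞 F} {θ : 𝓞 K} (h : SQ D x θ) {ξ : 𝓞 F} (hx : (4 : 𝓞 F) ∣ x - ξ ^ 2) :
    ∃ ω : 𝓞 K, 2 * ω = algebraMap (𝓞 F) (𝓞 K) ξ + θ ∧ ω - D.σ ω = θ := by
  obtain ⟨m, hm⟩ := hx
  obtain ⟨ω, hω⟩ := int_half (algebraMap (𝓞 F) (𝓞 K) ξ + θ) (algebraMap (𝓞 F) (𝓞 K) ξ) (algebraMap (𝓞 F) (𝓞 K) m) (by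
    have := congrArg (algebraMap (𝓞 F) (𝓞 K)) hm
    simp only [map_sub, map_mul, map_pow, map_ofNat] at this
    rw [← h.1] at this
    linear_combination this)
  refine ⟨ω, hω, ?_⟩
  have h1 := congrArg D.σ hω
  rw [map_mul, map_ofNat, map_add, D.fix, h.2] at h1
  apply mul_left_cancel₀ (two_ne_zero (α := 𝓞 K))
  linear_combination hω - h1

theorem SQ.mem_of_ram {D : QC F K} {x : 𝓞 F} {θ : 𝓞 K} (h : SQ D x θ) (hx : ∃ ξ : 𝓞 F, (4 : 𝓞 F) ∣ x - ξ ^ 2) {P : Ideal (𝓞 K)} (hP : Ram F P) :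
    θ ∈ P := by
  obtain ⟨ξ, hξ⟩ := hx
  obtain ⟨ω, -, hω⟩ := h.omega hξ
  rw [← hω, ← neg_mem_iff, neg_sub]; exact hP.act D ω

theorem SQ.lin {D : QC F K} {x : 𝓞 F} {θ : 𝓞 K} (h : SQ D x θ) (y : 𝓞 K) : ∃ t s : 𝓞 F,
    2 * y = algebraMap (𝓞 F) (𝓞 K) t + (y - D.σ y) ∧ θ * (y - D.σ y) = algebraMap (𝓞 F) (𝓞 K) s := by
  obtain ⟨t, ht⟩ := D.trace y
  obtain ⟨s, hs⟩ := D.desc (θ * (y - D.σ y)) (by rw [map_mul, map_sub, D.inv, h.2]; ring)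
  exact ⟨t, s, by rw [ht]; ring, hs.symm⟩

theorem SQ.surj {D : QC F K} {x : 𝓞 F} {θ : 𝓞 K} (h : SQ D x θ) {Q : Ideal (𝓞 K)} (hQ : Q.IsPrime) (h0 : Q ≠ ⊥)
    {b : 𝓞 F} (hb : θ - algebraMap (𝓞 F) (𝓞 K) b ∈ Q) (h2 : (2 : 𝓞 K) ∉ Q) (hθ : θ ∉ Q) (y : 𝓞 K) :
    ∃ a : 𝓞 F, y - algebraMap (𝓞 F) (𝓞 K) a ∈ Q := by
  set q := Q.comap (algebraMap (𝓞 F) (𝓞 K)) with hq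
  have hqp : q.IsPrime := Ideal.comap_isPrime _ _
  have hqm : q.IsMaximal := hqp.isMaximal (QC.ne_bot_comap h0)
  have h2b : 2 * b ∉ q := by
    intro hm
    rcases hqp.mem_or_mem hm with h3 | h3
    · exact h2 (by rw [hq, Ideal.mem_comap, map_ofNat] at h3; exact h3)
    · apply hθ; have := Q.add_mem hb h3; simpa using this
  obtain ⟨c, i, hi, hc⟩ := (Ideal.IsMaximal.exists_inv hqm h2b)
  obtain ⟨t, s, h3, h4⟩ := h.lin y
  refine ⟨c * (t * b + s), ?_⟩
  have h5 : (2 * θ) * y = algebraMap (𝓞 F) (𝓞 K) t * θ + algebraMap (𝓞 F) (𝓞 K) s := by rw [← h4]; linear_combination θ * h3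
  have h6 : algebraMap (𝓞 F) (𝓞 K) c * (2 * algebraMap (𝓞 F) (𝓞 K) b) + algebraMap (𝓞 F) (𝓞 K) i = 1 := by
    rw [← map_ofNat (algebraMap (𝓞 F) (𝓞 K)) 2, ← map_mul, ← map_mul, ← map_add, hc, map_one]
  have h7 := Q.add_mem (Q.mul_mem_left (algebraMap (𝓞 F) (𝓞 K) c * (algebraMap (𝓞 F) (𝓞 K) t - 2 * y)) hb) (Q.mul_mem_left y (show algebraMap (𝓞 F) (𝓞 K) i ∈ Q from hi))
  convert h7 using 1
  rw [map_mul, map_add, map_mul]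
  linear_combination (-y) * h6 + algebraMap (𝓞 F) (𝓞 K) c * h5

theorem exists_over {p : Ideal (𝓞 F)} (hp : p.IsPrime) (hp0 : p ≠ ⊥) : ∃ Q : Ideal (𝓞 K), Q.IsPrime ∧ Q ≠ ⊥ ∧ Q.comap (algebraMap (𝓞 F) (𝓞 K)) = p := by
  obtain ⟨Q, hQ, h⟩ := Ideal.exists_ideal_over_prime_of_isIntegral_of_isDomain (S := 𝓞 K) p (by
    rw [(RingHom.injective_iff_ker_eq_bot _).1 alg_inj]; exact bot_le)
  refine ⟨Q, hQ, ?_, h⟩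
  rintro rfl
  apply hp0; rw [← h]
  exact Ideal.comap_bot_of_injective _ alg_inj

theorem SQ.split {D : QC F K} {x : 𝓞 F} {θ : 𝓞 K} (h : SQ D x θ) {Q : Ideal (𝓞 K)} (hQ : Q.IsPrime) (h0 : Q ≠ ⊥) (h2 : (2 : 𝓞 K) ∉ Q)
    (hx : x ∉ Q.comap (algebraMap (𝓞 F) (𝓞 K))) (hs : Rs (Q.comap (algebraMap (𝓞 F) (𝓞 K))) x) :
    ext K (Q.comap (algebraMap (𝓞 F) (𝓞 K))) = Q * D.s Q ∧ D.s Q ≠ Q ∧ (∀ y : 𝓞 K, ∃ a : 𝓞 F, y - algebraMap (𝓞 F) (𝓞 K) a ∈ Q) ∧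
      Ideal.absNorm Q = Ideal.absNorm (Q.comap (algebraMap (𝓞 F) (𝓞 K))) := by
  have hθ : θ ∉ Q := fun h3 => hx (by rw [Ideal.mem_comap, ← h.1]; exact Q.mul_mem_left _ h3)
  have hb : ∃ b : 𝓞 F, θ - algebraMap (𝓞 F) (𝓞 K) b ∈ Q := by
    obtain ⟨b, hb⟩ := hs
    rw [Ideal.mem_comap, map_sub, ← h.1, map_mul, mul_self_sub_mul_self] at hb
    rcases hQ.mem_or_mem hb with h3 | h3
    · exact ⟨-b, by rw [map_neg, sub_neg_eq_add]; exact h3⟩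
    · exact ⟨b, h3⟩
  obtain ⟨b, hb⟩ := hb
  have hne : D.s Q ≠ Q := by
    intro hs
    have h3 := hb
    rw [← hs, D.mem_s, map_sub, D.fix, h.2] at h3
    have h4 := Q.sub_mem hb h3
    rcases hQ.mem_or_mem (show 2 * θ ∈ Q by convert h4 using 1; ring) with h5 | h5
    · exact h2 h5
    · exact hθ h5
  rcases D.dich hQ h0 with h3 | h3
  · exact absurd h3.2 hne
  · exact ⟨h3.1, hne, h.surj hQ h0 hb h2 hθ, h3.2⟩

theorem SQ.inert {D : QC F K} {x : 𝓞 F} {θ : 𝓞 K} (h : SQ D x θ) {Q : Ideal (𝓞 K)} (hQ : Q.IsPrime) (h0 : Q ≠ ⊥)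
    (hs : ¬ Rs (Q.comap (algebraMap (𝓞 F) (𝓞 K))) x) :
    ext K (Q.comap (algebraMap (𝓞 F) (𝓞 K))) = Q ∧ D.s Q = Q := by
  rcases D.dich hQ h0 with h3 | h3
  · exact h3
  · exfalso
    apply hs
    rw [← Rs_alg (surj_of_absNorm h0 h3.2)]
    exact ⟨θ, by rw [h.1]; simp⟩

theorem absNorm_ext (D : QC F K) {Q : Ideal (𝓞 K)} (hQ : Q.IsPrime) (h0 : Q ≠ ⊥) (h1 : ext K (Q.comap (algebraMap (𝓞 F) (𝓞 K))) = Q)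
    (h3 : D.s Q = Q) : Ideal.absNorm Q = Ideal.absNorm (Q.comap (algebraMap (𝓞 F) (𝓞 K))) ^ 2 := by
  set p := Q.comap (algebraMap (𝓞 F) (𝓞 K)) with hp
  haveI : p.IsPrime := Ideal.comap_isPrime _ _
  haveI : Q.LiesOver p := ⟨rfl⟩
  obtain ⟨f, hf⟩ := Ideal.exists_relNorm_eq_pow_of_isPrime (R := 𝓞 F) Q p
  have h4 := D.ext_relNorm h0
  rw [hf, ext_pow, h1, h3, ← sq] at h4
  have h5 : Ideal.absNorm Q ^ f = Ideal.absNorm Q ^ 2 := by rw [← map_pow, h4, map_pow]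
  have a1 : Ideal.absNorm Q ≠ 0 := by rw [Ne, Ideal.absNorm_eq_zero_iff]; exact h0
  have a2 : Ideal.absNorm Q ≠ 1 := by rw [Ne, Ideal.absNorm_eq_one_iff]; exact hQ.ne_top
  have h6 := Nat.pow_right_injective (show 2 ≤ Ideal.absNorm Q by omega) h5
  rw [← Ideal.absNorm_relNorm (𝓞 F), hf, h6, map_pow]

/-- units in the inert case are residues -/
theorem inert_Rs (D : QC F K) {Q : Ideal (𝓞 K)} (hQ : Q.IsPrime) (h0 : Q ≠ ⊥) (ho : Odd (Ideal.absNorm (Q.comap (algebraMap (𝓞 F) (𝓞 K)))))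
    (h1 : ext K (Q.comap (algebraMap (𝓞 F) (𝓞 K))) = Q) (h3 : D.s Q = Q) {η : 𝓞 K} {ε : 𝓞 F} (hη : η * D.σ η = algebraMap (𝓞 F) (𝓞 K) ε)
    (hε : Rs (Q.comap (algebraMap (𝓞 F) (𝓞 K))) ε) : Rs Q η := by
  set q := Q.comap (algebraMap (𝓞 F) (𝓞 K)) with hq
  have hqp : q.IsPrime := Ideal.comap_isPrime _ _
  have hq0 : q ≠ ⊥ := QC.ne_bot_comap h0
  have hN := absNorm_ext D hQ h0 h1 h3
  have key : ∀ a : 𝓞 F, Rs Q (algebraMap (𝓞 F) (𝓞 K) a) := by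
    intro a
    by_cases ha : a ∈ q
    · exact ⟨0, by rw [mul_zero, sub_zero]; exact ha⟩
    have ha' : algebraMap (𝓞 F) (𝓞 K) a ∉ Q := ha
    rw [(euler hQ h0 (by rw [hN]; exact ho.pow) ha').1, hN]
    obtain ⟨m, hm⟩ := ho
    have e1 : (Ideal.absNorm q ^ 2 - 1) / 2 = m * (2 * (m + 1)) := by
      rw [show Ideal.absNorm q ^ 2 = 2 * (m * (2 * (m+1))) + 1 by rw [hm]; ring]; omega
    have e2 := (euler hqp hq0 ⟨m, hm⟩ ha).2.1
    rw [show (Ideal.absNorm q - 1) / 2 = m by omega] at e2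
    rw [e1, ← map_pow, ← map_one (algebraMap (𝓞 F) (𝓞 K)), ← map_sub]
    change _ ∈ q
    rw [pow_mul, pow_mul]
    have e3 : (a ^ m) ^ 2 - 1 ∈ q := by
      rw [show (a ^ m) ^ 2 - 1 = (a ^ m - 1) * (a ^ m + 1) by ring]
      rcases e2 with e | e
      · exact q.mul_mem_right _ e
      · exact q.mul_mem_left _ e
    have := sub_dvd_pow_sub_pow ((a ^ m) ^ 2) 1 (m + 1)
    rw [one_pow] at this
    exact q.mem_of_dvd this e3
  obtain ⟨b, hb⟩ := hε
  have hb : algebraMap (𝓞 F) (𝓞 K) ε - algebraMap (𝓞 F) (𝓞 K) b * algebraMap (𝓞 F) (𝓞 K) b ∈ Q := by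
    rw [← map_mul, ← map_sub]; exact hb
  by_cases hc : algebraMap (𝓞 F) (𝓞 K) b + η ∈ Q
  · rw [Rs_congr (y := algebraMap (𝓞 F) (𝓞 K) (-b)) (by rw [map_neg]; convert hc using 1; ring)]
    exact key _
  · set n := RingOfIntegers.norm F (algebraMap (𝓞 F) (𝓞 K) b + η)
    have hn : algebraMap (𝓞 F) (𝓞 K) n = (algebraMap (𝓞 F) (𝓞 K) b + η) * (algebraMap (𝓞 F) (𝓞 K) b + D.σ η) := by
      rw [D.norm, map_add, D.fix]
    refine Rs_of_mul hQ h0 (x := algebraMap (𝓞 F) (𝓞 K) n) ?_ (key n) ?_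
    · rw [Rs_congr (y := algebraMap (𝓞 F) (𝓞 K) b * ((algebraMap (𝓞 F) (𝓞 K) b + η) * (algebraMap (𝓞 F) (𝓞 K) b + η)))]
      · exact (key b).mul (Rs_sq _ _)
      · rw [← hη] at hb
        convert Q.mul_mem_left (algebraMap (𝓞 F) (𝓞 K) b + η) hb using 1
        rw [hn]; ring
    · rw [hn]
      intro h
      rcases hQ.mem_or_mem h with h | h
      · exact hc h
      · apply hc; rw [← h3, D.mem_s, map_add, D.fix]; exact h

theorem ram_of_diff (D : QC F K) {Q : Ideal (𝓞 K)} (hQ : Q.IsPrime) (h0 : Q ≠ ⊥) (h : ∀ y, y - D.σ y ∈ Q) : Ram F Q := by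
  refine ⟨hQ, h0, ?_⟩
  have hs : D.s Q = Q := by
    ext y
    rw [D.mem_s]
    constructor
    · intro h1; have := Q.add_mem (h y) h1; simpa using this
    · intro h1; have := Q.sub_mem h1 (h y); simpa using this
  rcases D.dich hQ h0 with h3 | h3
  · exfalso
    have hN := absNorm_ext D hQ h0 h3.1 h3.2
    set q := Q.comap (algebraMap (𝓞 F) (𝓞 K)) with hq
    have hqp : q.IsPrime := Ideal.comap_isPrime _ _
    have hq0 : q ≠ ⊥ := QC.ne_bot_comap h0
    haveI := hQ.isMaximal h0
    haveI := hqp.isMaximal hq0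
    letI := Ideal.Quotient.field Q
    haveI := Ideal.finiteQuotientOfFreeOfNeBot Q h0
    haveI := Ideal.finiteQuotientOfFreeOfNeBot q hq0
    have surj : Function.Surjective (Ideal.quotientMap Q (algebraMap (𝓞 F) (𝓞 K)) (le_of_eq hq)) := by
      intro y
      by_cases h2 : (2 : 𝓞 K) ∈ Q
      · have h2' : (2 : 𝓞 K ⧸ Q) = 0 := by
          rw [← map_ofNat (Ideal.Quotient.mk Q) 2]; exact Ideal.Quotient.eq_zero_iff_mem.2 h2
        have inj : Function.Injective (fun z : 𝓞 K ⧸ Q => z * z) := by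
          intro a b hab
          have : (a - b) * (a - b) = 0 := by
            simp only at hab
            linear_combination hab + (b * b - a * b) * h2'
          simpa [sub_eq_zero] using this
        obtain ⟨z, rfl⟩ := (Finite.injective_iff_surjective.1 inj) y
        obtain ⟨z, rfl⟩ := Ideal.Quotient.mk_surjective z
        refine ⟨Ideal.Quotient.mk q (RingOfIntegers.norm F z), ?_⟩
        rw [Ideal.quotientMap_mk, D.norm]; dsimp only; rw [← map_mul]
        refine Ideal.Quotient.eq.2 ?_
        rw [← neg_mem_iff]
        convert Q.mul_mem_left z (h z) using 1; ring
      · have h2' : (2 : 𝓞 K ⧸ Q) ≠ 0 := by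
          rw [← map_ofNat (Ideal.Quotient.mk Q) 2]; exact fun h => h2 (Ideal.Quotient.eq_zero_iff_mem.1 h)
        obtain ⟨z, rfl⟩ : ∃ z, y = 2 * z := ⟨y / 2, by field_simp⟩
        obtain ⟨z, rfl⟩ := Ideal.Quotient.mk_surjective z
        obtain ⟨t, ht⟩ := D.trace z
        refine ⟨Ideal.Quotient.mk q t, ?_⟩
        rw [Ideal.quotientMap_mk, ht, ← map_ofNat (Ideal.Quotient.mk Q) 2, ← map_mul]
        refine Ideal.Quotient.eq.2 ?_
        rw [← neg_mem_iff]
        convert (h z) using 1; ring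
    have := Nat.card_le_card_of_surjective _ surj
    rw [card_quot, card_quot, hN] at this
    have h1 : 1 < Ideal.absNorm q := by
      have a1 : Ideal.absNorm q ≠ 0 := by rw [Ne, Ideal.absNorm_eq_zero_iff]; exact hq0
      have a2 : Ideal.absNorm q ≠ 1 := by rw [Ne, Ideal.absNorm_eq_one_iff]; exact hqp.ne_top
      omega
    nlinarith
  · rw [h3.1, hs, sq]

theorem SQ.unram_inf {D : QC F K} {x : 𝓞 F} {θ : 𝓞 K} (h : SQ D x θ) (hx : ∀ φ : F →+* ℝ, 0 < φ (algebraMap (𝓞 F) F x)) :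
    UnramifiedAtInfinitePlaces F K := by
  intro φ
  letI : Algebra F ℂ := ((algebraMap ℝ ℂ).comp φ).toAlgebra
  let ψ : K →ₐ[F] ℂ := IsAlgClosed.lift
  have hψ : ∀ a : 𝓞 F, ψ (algebraMap (𝓞 K) K (algebraMap (𝓞 F) (𝓞 K) a)) = (φ (algebraMap (𝓞 F) F a) : ℂ) := by
    intro a
    rw [← IsScalarTower.algebraMap_apply, IsScalarTower.algebraMap_apply (𝓞 F) F K, ψ.commutes]; rfl
  obtain ⟨r, hr⟩ : ∃ r : ℝ, ψ (θ : K) = r := by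
    have h1 : ψ (θ : K) * ψ (θ : K) = ((Real.sqrt (φ (algebraMap (𝓞 F) F x)) : ℝ) : ℂ) * ((Real.sqrt (φ (algebraMap (𝓞 F) F x)) : ℝ) : ℂ) := by
      rw [← Complex.ofReal_mul, Real.mul_self_sqrt (hx φ).le, ← hψ, ← h.1, map_mul, map_mul]
    rcases mul_self_eq_mul_self_iff.1 h1 with h2 | h2
    · exact ⟨_, h2⟩
    · exact ⟨-_, by rw [h2, Complex.ofReal_neg]⟩
  have hx0 : x ≠ 0 := by
    rintro rfl
    have := hx φ
    simp at this
  have hθ0 : ψ (θ : K) ≠ 0 := by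
    rw [Ne, map_eq_zero]; exact fun h' => h.ne_zero hx0 (RingOfIntegers.ext h')
  have hreal : ComplexEmbedding.IsReal (ψ : K →+* ℂ) := by
    rw [ComplexEmbedding.isReal_iff]
    apply IsLocalization.ringHom_ext (nonZeroDivisors (𝓞 K))
    ext1 y
    obtain ⟨t, s, h3, h4⟩ := h.lin y
    have h5 : (2 * θ) * y = algebraMap (𝓞 F) (𝓞 K) t * θ + algebraMap (𝓞 F) (𝓞 K) s := by rw [← h4]; linear_combination θ * h3
    have h6 := congrArg (fun z => ψ (algebraMap (𝓞 K) K z)) h5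
    simp only [map_mul, map_add, map_ofNat, hψ] at h6
    have hr' : ψ (algebraMap (𝓞 K) K θ) = r := hr
    rw [hr'] at h6 hθ0
    have h7 : ψ (algebraMap (𝓞 K) K y) = (((φ (algebraMap (𝓞 F) F t) * r + φ (algebraMap (𝓞 F) F s)) / (2 * r) : ℝ) : ℂ) := by
      push_cast
      rw [← h6]; field_simp
    change (starRingEnd ℂ) (ψ (algebraMap (𝓞 K) K y)) = ψ (algebraMap (𝓞 K) K y)
    rw [h7, Complex.conj_ofReal]
  refine ⟨hreal.embedding, ?_⟩
  ext a
  apply Complex.ofReal_injective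
  rw [RingHom.comp_apply, ComplexEmbedding.IsReal.coe_embedding_apply]
  change ψ (algebraMap F K a) = _
  rw [ψ.commutes]; rfl
end S08

section S09
variable {F K : Type*} [Field F] [NumberField F] [Field K] [NumberField K] [Algebra F K]

/-- primary prime ideal with primary generator of its `h`-th power -/
structure PD (p : Ideal (𝓞 F)) (π : 𝓞 F) : Prop where
  prime : p.IsPrime
  ne_bot : p ≠ ⊥
  odd : Odd (Ideal.absNorm p)
  us : US p
  pos : ∀ φ : F →+* ℝ, 0 < φ (algebraMap (𝓞 F) F π)
  sq : ∃ ξ : 𝓞 F, (4 : 𝓞 F) ∣ π - ξ ^ 2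
  gen : p ^ classNumber F = Ideal.span {π}

theorem even_of_sq {p I : Ideal (𝓞 F)} (hp : p.IsPrime) (h0 : p ≠ ⊥) {n : ℕ} (h : I ^ 2 = p ^ n) : Even n := by
  have hpp := Ideal.prime_of_isPrime h0 hp
  obtain ⟨i, -, hi⟩ := (dvd_prime_pow hpp n).1 (show I ∣ p ^ n from ⟨I, by rw [← h, sq]⟩)
  rw [associated_iff_eq] at hi
  rw [hi, ← pow_mul] at h
  have a1 : Ideal.absNorm p ≠ 0 := by rw [Ne, Ideal.absNorm_eq_zero_iff]; exact h0
  have a2 : Ideal.absNorm p ≠ 1 := by rw [Ne, Ideal.absNorm_eq_one_iff]; exact hp.ne_top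
  have h5 : Ideal.absNorm p ^ (i * 2) = Ideal.absNorm p ^ n := by rw [← map_pow, h, map_pow]
  have h6 := Nat.pow_right_injective (show 2 ≤ Ideal.absNorm p by omega) h5
  exact ⟨i, by omega⟩

theorem PD.ne_zero {p : Ideal (𝓞 F)} {π : 𝓞 F} (h : PD p π) : π ≠ 0 := by
  rintro rfl
  have := h.gen
  rw [Ideal.span_singleton_eq_bot.2 rfl] at this
  exact h.ne_bot (pow_eq_zero_iff (classNumber_ne_zero' F) |>.1 this)

theorem PD.not_sq {p : Ideal (𝓞 F)} {π : 𝓞 F} (h : PD p π) (hodd : Odd (classNumber F)) : ¬ IsSquare π := by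
  rintro ⟨y, rfl⟩
  have := h.gen
  rw [← Ideal.span_singleton_mul_span_singleton, ← _root_.sq] at this
  exact (Nat.not_even_iff_odd.2 hodd) (even_of_sq h.prime h.ne_bot this.symm)

theorem PD.mem {p : Ideal (𝓞 F)} {π : 𝓞 F} (h : PD p π) : π ∈ p := by
  have : (Ideal.span {π} : Ideal (𝓞 F)) ≤ p := by rw [← h.gen]; exact Ideal.pow_le_self (classNumber_ne_zero' F)
  exact this (Ideal.mem_span_singleton_self π)

theorem PD.eq_of_mem {p q : Ideal (𝓞 F)} {π : 𝓞 F} (h : PD p π) (hq : q.IsPrime) (hm : π ∈ q) : q = p := by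
  rw [← Ideal.span_singleton_le_iff_mem, ← h.gen] at hm
  haveI := hq
  exact ((h.prime.isMaximal h.ne_bot).eq_of_le hq.ne_top (Ideal.IsPrime.le_of_pow_le hm)).symm

theorem PD.notMem {p q : Ideal (𝓞 F)} {π : 𝓞 F} (h : PD p π) (hq : q.IsPrime) (hne : q ≠ p) : π ∉ q :=
  fun h1 => hne (h.eq_of_mem hq h1)

theorem Ram.inj {P Q : Ideal (𝓞 K)} (h : Ram F P) (h' : Ram F Q) (e : P.comap (algebraMap (𝓞 F) (𝓞 K)) = Q.comap (algebraMap (𝓞 F) (𝓞 K))) : P = Q := by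
  apply ideal_pow_inj two_ne_zero
  rw [← h.2.2, ← h'.2.2, e]

theorem kj {D : QC F K} {p : Ideal (𝓞 F)} {π : 𝓞 F} {θ : 𝓞 K} (hp : PD p π) (hodd : Odd (classNumber F)) (h2 : Module.finrank F K = 2)
    (h : SQ D π θ) : ∃ P : Ideal (𝓞 K), Ram F P ∧ P.comap (algebraMap (𝓞 F) (𝓞 K)) = p ∧ (∀ Q : Ideal (𝓞 K), Ram F Q → Q = P) ∧
      NU F K = ⊤ ∧ AmbPr D ∧ ∃ a : Ideal (𝓞 F), a ≠ ⊥ ∧ Ideal.span {θ} = ext K a * P := by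
  have hinf := h.unram_inf hp.pos
  have hc : ∀ P : Ideal (𝓞 K), Ram F P → P.comap (algebraMap (𝓞 F) (𝓞 K)) = p := by
    intro P hP
    refine hp.eq_of_mem (hP.1.comap _) ?_
    rw [Ideal.mem_comap, ← h.1]
    exact P.mul_mem_left _ (h.mem_of_ram hp.sq hP)
  obtain ⟨P, hP⟩ : ∃ P : Ideal (𝓞 K), Ram F P := by
    by_contra hno
    push Not at hno
    have := (G_core D hodd h2 hinf ∅ (fun P hP => absurd hP (hno P))).1
    have := NU_index_ne D
    simp at *; omega
  have hu : ∀ Q : Ideal (𝓞 K), Ram F Q → Q = P := fun Q hQ => hQ.inj hP (by rw [hc Q hQ, hc P hP])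
  obtain ⟨h3, h4⟩ := t1_NU D hodd h2 hinf hu
  obtain ⟨m, hm⟩ := hodd
  refine ⟨P, hP, hc P hP, hu, h3, h4, p ^ m, pow_ne_zero _ hp.ne_bot, ?_⟩
  apply ideal_pow_inj two_ne_zero
  have h5 := hP.2.2
  rw [hc P hP] at h5
  rw [Ideal.span_singleton_pow, _root_.sq θ, h.1, ← ext_span, ← hp.gen, hm, mul_pow, ext_pow, ext_pow, ← h5]; ring

theorem wd {D : QC F K} {p : Ideal (𝓞 F)} {π : 𝓞 F} {θ : 𝓞 K} (hp : PD p π) (hodd : Odd (classNumber F)) (h2 : Module.finrank F K = 2)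
    (h : SQ D π θ) {Q : Ideal (𝓞 K)} (hQ : Q.IsPrime) (h0 : Q ≠ ⊥) (hU : US (Q.comap (algebraMap (𝓞 F) (𝓞 K))))
    {η η' : (𝓞 K)ˣ} (e : (η : 𝓞 K) * D.σ η = η' * D.σ η') (hr : Rs Q (η : 𝓞 K)) : Rs Q (η' : 𝓞 K) := by
  obtain ⟨P, hP, hc, hu, -, -, a, ha, hI⟩ := kj hp hodd h2 h
  have hUQ : ∀ u : (𝓞 F)ˣ, Rs Q (algebraMap (𝓞 F) (𝓞 K) u) := by
    intro u
    obtain ⟨b, hb⟩ := hU u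
    exact ⟨algebraMap (𝓞 F) (𝓞 K) b, by rw [← map_mul, ← map_sub]; exact hb⟩
  obtain ⟨v, hv⟩ := t1_H1 D hodd hu (h.ne_zero hp.ne_zero) h.2 ha hI (u := η / η') (by
    have e' : η * D.u η = η' * D.u η' := Units.ext e
    have : (η / η') * D.u (η / η') = 1 := by rw [map_div, div_mul_div_comm, e', div_self']
    exact congrArg Units.val this)
  obtain ⟨w, hw⟩ : ∃ w : (𝓞 F)ˣ, η * D.u v ^ 2 = η' * Units.map (algebraMap (𝓞 F) (𝓞 K) : 𝓞 F →* 𝓞 K) w := by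
    let n : (𝓞 F)ˣ := Units.map (RingOfIntegers.norm F : 𝓞 K →* 𝓞 F) v
    have hn : Units.map (algebraMap (𝓞 F) (𝓞 K) : 𝓞 F →* 𝓞 K) n = v * D.u v := Units.ext (D.norm v)
    rcases hv with hv | hv
    · refine ⟨n, ?_⟩
      have hv' : η * D.u v = η' * v := by rw [div_mul_eq_mul_div, div_eq_iff_eq_mul] at hv; rw [hv, mul_comm]
      rw [hn, ← mul_assoc, pow_two, ← mul_assoc, hv']
    · refine ⟨-n, ?_⟩
      rw [show Units.map (algebraMap (𝓞 F) (𝓞 K) : 𝓞 F →* 𝓞 K) (-n) = - Units.map (algebraMap (𝓞 F) (𝓞 K) : 𝓞 F →* 𝓞 K) n from Units.ext (by simp)]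
      have hv' : η * D.u v = η' * (-v) := by rw [div_mul_eq_mul_div, div_eq_iff_eq_mul] at hv; rw [hv, mul_comm]
      rw [hn, ← neg_mul, ← mul_assoc, pow_two, ← mul_assoc, hv']
  refine Rs_of_mul hQ h0 (x := algebraMap (𝓞 F) (𝓞 K) w) ?_ (hUQ w) (unit_notMem hQ (Units.map (algebraMap (𝓞 F) (𝓞 K) : 𝓞 F →* 𝓞 K) w))
  have := congrArg Units.val hw
  push_cast at this
  rw [mul_comm]
  have h3 : (η' : 𝓞 K) * algebraMap (𝓞 F) (𝓞 K) w = η * ((D.u v : 𝓞 K) * (D.u v)) := by rw [← _root_.sq]; exact this.symm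
  rw [h3]
  exact hr.mul (Rs_sq _ _)

theorem recip {D : QC F K} {p p' : Ideal (𝓞 F)} {π π' : 𝓞 F} {θ : 𝓞 K} (hp : PD p π) (hp' : PD p' π') (hne : p ≠ p') (hodd : Odd (classNumber F)) (h2 : Module.finrank F K = 2)
    (h : SQ D π θ) (hr : Rs p' π) : Rs p π' := by
  obtain ⟨P, hP, hc, hu, hN, hA, -⟩ := kj hp hodd h2 h
  obtain ⟨Q, hQ, hQ0, rfl⟩ := exists_over (K := K) hp'.prime hp'.ne_bot
  have h2Q : (2 : 𝓞 K) ∉ Q := by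
    intro h2
    apply two_notMem hp'.prime hp'.ne_bot hp'.odd
    rw [Ideal.mem_comap, map_ofNat]; exact h2
  obtain ⟨h3, -, -⟩ := h.split hQ hQ0 h2Q (hp.notMem hp'.prime hne.symm) hr
  obtain ⟨m, hm, α, hα, hm'⟩ := odd_order D hA hodd hN hQ0
  have h4 : (Ideal.span {algebraMap (𝓞 F) (𝓞 K) (RingOfIntegers.norm F α ^ classNumber F)} : Ideal (𝓞 K)) = Ideal.span {algebraMap (𝓞 F) (𝓞 K) (π' ^ m)} := by
    rw [map_pow, map_pow, ← Ideal.span_singleton_pow, ← Ideal.span_singleton_pow, ← ext_span π', ← hp'.gen, ext_pow, h3, D.norm,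
      ← Ideal.span_singleton_mul_span_singleton, ← D.s_span, ← hm', D.s_pow]; ring
  obtain ⟨u, hu⟩ := span_eq_span (span_desc D h4)
  refine Rs_of_pow_odd hp.prime hp.ne_bot hm ?_ (hp'.notMem hp.prime hne)
  rw [← hu]
  have := hP.Rs_norm D (D.norm α).symm
  rw [hc] at this
  exact (this.pow _).mul (hp.us u)
end S09

section S10
universe u
variable {F : Type u} {K : Type*} [Field F] [NumberField F] [Field K] [NumberField K] [Algebra F K]

theorem not_sq_field {x : 𝓞 F} (h : ¬ IsSquare x) : ¬ IsSquare (x : F) := by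
  rintro ⟨z, hz⟩
  obtain ⟨w, -, hw⟩ := int_sqrt z x hz.symm
  exact h ⟨w, hw.symm⟩

theorem exists_SQ {x : 𝓞 F} (h : ¬ IsSquare x) : ∃ (M : Type u) (_ : Field M) (_ : NumberField M) (_ : Algebra F M),
    Module.finrank F M = 2 ∧ ∃ (D : QC F M) (θ : 𝓞 M), SQ D x θ := by
  obtain ⟨M, i1, i2, i3, h2, θ, hθ⟩ := exists_sqrt_ext F (x : F) (not_sq_field h)
  obtain ⟨D, -⟩ := QC.exists h2
  obtain ⟨w, -, hw⟩ := int_sqrt θ (algebraMap (𝓞 F) (𝓞 M) x) (by rw [← sq, hθ]; rfl)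
  exact ⟨M, i1, i2, i3, h2, D, w, SQ.of D hw h⟩

theorem two_ne_zero_O : (2 : 𝓞 K) ≠ 0 := two_ne_zero

/-- transfer of unramifiedness at 2 -/
theorem transfer {M : Type*} [Field M] [NumberField M] [Algebra F M] {D : QC F K} {D' : QC F M} {w : 𝓞 F} {u : (𝓞 F)ˣ}
    {ρ : 𝓞 K} {μ : 𝓞 M} (hρ : SQ D (u * w) ρ) (hμ : SQ D' (u : 𝓞 F) μ) (hw : ∃ ξ : 𝓞 F, (4 : 𝓞 F) ∣ w - ξ ^ 2)
    {Q : Ideal (𝓞 M)} (hQ : Ram F Q) {P : Ideal (𝓞 K)} (hP : P.IsPrime) (hP0 : P ≠ ⊥) 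
    (hPQ : P.comap (algebraMap (𝓞 F) (𝓞 K)) = Q.comap (algebraMap (𝓞 F) (𝓞 M))) (hn : ¬ Ram F P)
    (hwq : w ∉ P.comap (algebraMap (𝓞 F) (𝓞 K))) (h2 : (2 : 𝓞 F) ∈ P.comap (algebraMap (𝓞 F) (𝓞 K))) : False := by
  have : ¬ ∀ y, y - D.σ y ∈ P := fun h => hn (ram_of_diff D hP hP0 h)
  push Not at this
  obtain ⟨y, hy⟩ := this
  obtain ⟨t, s, h3, h4⟩ := hρ.lin y
  obtain ⟨ξ, v, hv⟩ := hw
  set n := RingOfIntegers.norm F y with hn'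
  have hN : y * D.σ y = algebraMap (𝓞 F) (𝓞 K) n := (D.norm y).symm
  set Δ := t ^ 2 - 4 * n with hΔ
  have ht : y + D.σ y = algebraMap (𝓞 F) (𝓞 K) t := by linear_combination h3
  have hD : (y - D.σ y) ^ 2 = algebraMap (𝓞 F) (𝓞 K) Δ := by
    rw [hΔ, map_sub, map_mul, map_pow, ← ht, ← hN, map_ofNat]; ring
  have hs : s ^ 2 = u * w * Δ := by
    apply alg_inj (F := F) (K := K)
    rw [map_pow, ← h4, map_mul, ← hD, ← hρ.1]; ring
  obtain ⟨ζ, hζ⟩ := int_half (algebraMap (𝓞 F) (𝓞 M) (u * w * t) + algebraMap (𝓞 F) (𝓞 M) (ξ * s) * μ) (algebraMap (𝓞 F) (𝓞 M) (u * w * t))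
    (algebraMap (𝓞 F) (𝓞 M) (u ^ 2 * w * (-n * w - v * t ^ 2 + 4 * v * n))) (by
      have e1 : (algebraMap (𝓞 F) (𝓞 M) (ξ * s) * μ) ^ 2 = algebraMap (𝓞 F) (𝓞 M) ((u * w * t) ^ 2 + 4 * (u ^ 2 * w * (-n * w - v * t ^ 2 + 4 * v * n))) := by
        rw [mul_pow, sq μ, hμ.1, ← map_pow, ← map_mul]; congr 1
        have : ξ ^ 2 = w - 4 * v := by linear_combination -hv
        rw [mul_pow, hs, this]; ring
      rw [map_add, map_mul _ (4 : 𝓞 F), map_ofNat, map_pow] at e1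
      linear_combination e1)
  have h5 : ζ - D'.σ ζ = algebraMap (𝓞 F) (𝓞 M) (ξ * s) * μ := by
    apply mul_left_cancel₀ (two_ne_zero_O (K := M))
    have := congrArg D'.σ hζ
    rw [map_mul, map_ofNat, map_add, D'.fix, map_mul D'.σ, D'.fix, hμ.2] at this
    linear_combination hζ - this
  have h6 : algebraMap (𝓞 F) (𝓞 M) (ξ * s) * μ ∈ Q := by
    rw [← h5, ← neg_sub]; exact Q.neg_mem (hQ.act D' ζ)
  have h7 : ξ ^ 2 * (u * u) * (w * Δ) ∈ Q.comap (algebraMap (𝓞 F) (𝓞 M)) := by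
    rw [Ideal.mem_comap]
    have : algebraMap (𝓞 F) (𝓞 M) (ξ ^ 2 * (u * u) * (w * Δ)) = (algebraMap (𝓞 F) (𝓞 M) (ξ * s) * μ) ^ 2 := by
      rw [mul_pow, sq μ, hμ.1, ← map_pow, ← map_mul, mul_pow, hs]; congr 1; ring
    rw [this]; exact Ideal.pow_mem_of_mem _ h6 _ two_pos
  rw [← hPQ] at h7
  have hpp := hP.comap (algebraMap (𝓞 F) (𝓞 K))
  rcases hpp.mem_or_mem h7 with h8 | h8
  · rcases hpp.mem_or_mem h8 with h8 | h8
    · apply hwq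
      have : w = ξ ^ 2 + 2 * (2 * v) := by linear_combination hv
      rw [this]; exact Ideal.add_mem _ h8 (Ideal.mul_mem_right _ _ h2)
    · exact unit_notMem hpp (u * u) (by push_cast; exact h8)
  · rcases hpp.mem_or_mem h8 with h8 | h8
    · exact hwq h8
    · rw [Ideal.mem_comap, ← hD] at h8
      exact hy (hP.mem_of_pow_mem _ h8)

theorem sq_mul_mod {x y : 𝓞 F} (h1 : ∃ ξ : 𝓞 F, (4 : 𝓞 F) ∣ x - ξ ^ 2) (h2 : ∃ ξ : 𝓞 F, (4 : 𝓞 F) ∣ y - ξ ^ 2) :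
    ∃ ξ : 𝓞 F, (4 : 𝓞 F) ∣ x * y - ξ ^ 2 := by
  obtain ⟨a, u, hu⟩ := h1
  obtain ⟨b, v, hv⟩ := h2
  exact ⟨a * b, u * y + a ^ 2 * v, by linear_combination y * hu + a ^ 2 * hv⟩

theorem ident {D : QC F K} {p1 p2 : Ideal (𝓞 F)} {π1 π2 : 𝓞 F} (hp1 : PD p1 π1) (hp2 : PD p2 π2) (hne : p1 ≠ p2) (hodd : Odd (classNumber F))
    (h2 : Module.finrank F K = 2) (hinf : UnramifiedAtInfinitePlaces F K) {P1 P2 : Ideal (𝓞 K)} (hP1 : Ram F P1) (hP2 : Ram F P2)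
    (c1 : P1.comap (algebraMap (𝓞 F) (𝓞 K)) = p1) (c2 : P2.comap (algebraMap (𝓞 F) (𝓞 K)) = p2) (hR : ∀ P, Ram F P → P = P1 ∨ P = P2) :
    ∃ θ : 𝓞 K, SQ D (π1 * π2) θ ∧ Ideal.span {θ} = P1 ^ classNumber F * P2 ^ classNumber F := by
  set h := classNumber F with hh
  have hPne : P1 ≠ P2 := by rintro rfl; exact hne (c1.symm.trans c2)
  obtain ⟨ρ, hρ0, hρσ, A, hA, hρA⟩ : ∃ ρ : 𝓞 K, ρ ≠ 0 ∧ D.σ ρ = -ρ ∧ ∃ A : Finset (Ideal (𝓞 K)), (∀ P ∈ A, Ram F P) ∧ Ideal.span {ρ} = ∏ P ∈ A, P ^ h := by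
    obtain ⟨s, hs0, hsσ⟩ := D.anti
    obtain ⟨a, A, ha, hA, hJ⟩ := G4 D (Ideal.span {s}) (by simpa using hs0) (by rw [D.s_span, hsσ, Ideal.span_singleton_neg])
    obtain ⟨x, hx0, hx⟩ := ext_pow_principal (K := K) ha
    have h3 : Ideal.span {s ^ h} = Ideal.span {algebraMap (𝓞 F) (𝓞 K) x} * ∏ P ∈ A, P ^ h := by
      rw [← Ideal.span_singleton_pow, hJ, mul_pow, hx, Finset.prod_pow]
    obtain ⟨ρ, hρ⟩ : algebraMap (𝓞 F) (𝓞 K) x ∣ s ^ h := by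
      rw [← Ideal.span_singleton_le_span_singleton, h3]; exact Ideal.mul_le_left
    have hx' := alg_ne_zero (K := K) hx0
    refine ⟨ρ, ?_, ?_, A, hA, ?_⟩
    · rintro rfl; rw [mul_zero] at hρ; exact pow_ne_zero _ hs0 hρ
    · apply mul_left_cancel₀ hx'
      have := congrArg D.σ hρ
      rw [map_pow, hsσ, hodd.neg_pow, map_mul, D.fix, hρ] at this
      rw [← this]; ring
    · rw [hρ, ← Ideal.span_singleton_mul_span_singleton] at h3
      exact mul_left_cancel₀ (by simpa using hx') h3
  have hin : ∀ (P : Ideal (𝓞 K)) (p : Ideal (𝓞 F)) (π : 𝓞 F), PD p π → Ram F P → P.comap (algebraMap (𝓞 F) (𝓞 K)) = p → P ∈ A := by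
    intro P p π hp hP hc
    have : ρ ∈ P := by
      have h3 := hP.act D ρ
      rw [hρσ, show -ρ - ρ = -(2 * ρ) by ring, neg_mem_iff] at h3
      refine (hP.1.mem_or_mem h3).resolve_left fun h4 => ?_
      apply two_notMem hp.prime hp.ne_bot hp.odd
      rw [← hc, Ideal.mem_comap, map_ofNat]; exact h4
    rw [← Ideal.span_singleton_le_iff_mem, hρA, hP.1.prod_le] at this
    obtain ⟨P', hP', hle⟩ := this
    haveI := hP.1
    have := (hA P' hP')
    rwa [← ((this.1.isMaximal this.2.1).eq_of_le hP.1.ne_top (Ideal.IsPrime.le_of_pow_le hle))]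
  have hA2 : A = {P1, P2} := by
    ext P
    simp only [Finset.mem_insert, Finset.mem_singleton]
    constructor
    · exact fun hP => hR P (hA P hP)
    · rintro (rfl | rfl)
      · exact hin _ _ _ hp1 hP1 c1
      · exact hin _ _ _ hp2 hP2 c2
  rw [hA2, Finset.prod_pair hPne] at hρA
  obtain ⟨w', hw'⟩ := D.desc (ρ * ρ) (by rw [map_mul, hρσ]; ring)
  obtain ⟨u, hu⟩ := span_eq_span (span_desc D (a := π1 * π2) (b := w') (by
    rw [hw', ← Ideal.span_singleton_mul_span_singleton, hρA, map_mul, ← Ideal.span_singleton_mul_span_singleton, ← ext_span, ← ext_span, ← hp1.gen, ← hp2.gen,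
      ext_pow, ext_pow, ← c1, ← c2, hP1.2.2, hP2.2.2]; ring))
  have hρS : SQ D (u * (π1 * π2)) ρ := ⟨by rw [← hw', ← hu, mul_comm], hρσ⟩
  have hsq : IsSquare (u : 𝓞 F) := by
    by_contra hns
    obtain ⟨M, i1, i2, i3, hM2, D', μ, hμ⟩ := exists_SQ hns
    have hpos : ∀ φ : F →+* ℝ, 0 < φ (algebraMap (𝓞 F) F (u : 𝓞 F)) := by
      intro φ
      obtain ⟨ψ, hψ⟩ := hinf φ
      have h3 : ψ ρ * ψ ρ = φ (u : 𝓞 F) * (φ π1 * φ π2) := by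
        have := congrArg (fun z : 𝓞 K => ψ z) hρS.1
        simp only [map_mul] at this
        rw [← hψ]; exact this
      have h4 : ψ ρ ≠ 0 := by simpa using hρ0
      have h5 : 0 < ψ ρ * ψ ρ := mul_self_pos.2 h4
      rw [h3] at h5
      exact pos_of_mul_pos_left h5 (mul_pos (hp1.pos φ) (hp2.pos φ)).le
    have := (G_core D' hodd hM2 (hμ.unram_inf hpos) ∅ (fun Q hQ => by
      exfalso
      have h2Q : (2 : 𝓞 M) ∈ Q := by
        have h3 := hQ.act D' μ
        rw [hμ.2, show -μ - μ = -(2 * μ) by ring, neg_mem_iff] at h3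
        refine (hQ.1.mem_or_mem h3).resolve_right fun h4 => ?_
        have : (u : 𝓞 F) ∈ Q.comap (algebraMap (𝓞 F) (𝓞 M)) := by rw [Ideal.mem_comap, ← hμ.1]; exact Q.mul_mem_left _ h4
        exact unit_notMem (hQ.1.comap _) u this
      have h2q : (2 : 𝓞 F) ∈ Q.comap (algebraMap (𝓞 F) (𝓞 M)) := by rwa [Ideal.mem_comap, map_ofNat]
      have hqp := hQ.1.comap (algebraMap (𝓞 F) (𝓞 M))
      have q1 : Q.comap (algebraMap (𝓞 F) (𝓞 M)) ≠ p1 := fun e => two_notMem hp1.prime hp1.ne_bot hp1.odd (e ▸ h2q)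
      have q2 : Q.comap (algebraMap (𝓞 F) (𝓞 M)) ≠ p2 := fun e => two_notMem hp2.prime hp2.ne_bot hp2.odd (e ▸ h2q)
      obtain ⟨P, hP, hP0, hPQ⟩ := exists_over (K := K) hqp (QC.ne_bot_comap hQ.2.1)
      refine transfer hρS hμ (sq_mul_mod hp1.sq hp2.sq) hQ hP hP0 hPQ ?_ ?_ ?_
      · intro hr
        rcases hR P hr with rfl | rfl
        · exact q1 (hPQ.symm.trans c1)
        · exact q2 (hPQ.symm.trans c2)
      · rw [hPQ]; intro hm
        rcases hqp.mem_or_mem hm with hm | hm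
        · exact hp1.notMem hqp q1 hm
        · exact hp2.notMem hqp q2 hm
      · rw [hPQ]; exact h2q)).1
    have := NU_index_ne D'
    simp at *; omega
  obtain ⟨v, hv⟩ := hsq
  have hvu : IsUnit v := isUnit_of_mul_isUnit_left (hv ▸ u.isUnit)
  obtain ⟨v, rfl⟩ := hvu
  have hvi : algebraMap (𝓞 F) (𝓞 K) ((v⁻¹ : (𝓞 F)ˣ) : 𝓞 F) * algebraMap (𝓞 F) (𝓞 K) (v : 𝓞 F) = 1 := by
    rw [← map_mul, Units.inv_mul, map_one]
  refine ⟨algebraMap (𝓞 F) (𝓞 K) ((v⁻¹ : (𝓞 F)ˣ) : 𝓞 F) * ρ, ⟨?_, ?_⟩, ?_⟩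
  · rw [mul_mul_mul_comm, hρS.1, ← map_mul, ← map_mul, hv]; congr 1
    linear_combination ((v⁻¹ : (𝓞 F)ˣ) * v * π1 * π2 + π1 * π2 : 𝓞 F) * v.inv_mul
  · rw [map_mul, D.fix, hρσ]; ring
  · rw [← hρA]
    exact Ideal.span_singleton_mul_left_unit (IsUnit.of_mul_eq_one _ hvi) ρ
end S10

section S11
universe u
variable {F : Type*} {K : Type u} [Field F] [NumberField F] [Field K] [NumberField K] [Algebra F K]

theorem ext_inj (h2 : Module.finrank F K = 2) {I J : Ideal (𝓞 F)} (h : ext K I = ext K J) : I = J := by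
  have h3 : ∀ I : Ideal (𝓞 F), Ideal.relNorm (𝓞 F) (ext K I) = I ^ 2 := by
    intro I
    have := Ideal.relNorm_algebraMap (R := 𝓞 F) (𝓞 K) I
    rwa [← Algebra.IsAlgebraic.finrank_of_isFractionRing (𝓞 F) F (𝓞 K) K, h2] at this
  apply ideal_pow_inj two_ne_zero
  rw [← h3, ← h3, h]

def TD (π : 𝓞 F) (ε t : 𝓞 F) : Prop := ∃ s : F, s ^ 2 * (π : F) = (t : F) ^ 2 - 4 * (ε : F)

theorem TD.neg {π ε t : 𝓞 F} (h : TD π ε t) : TD π ε (-t) := by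
  obtain ⟨s, hs⟩ := h
  exact ⟨s, by rw [hs]; push_cast; ring⟩

theorem SQ.TD {D : QC F K} {π ε t : 𝓞 F} {θ : 𝓞 K} (h : SQ D π θ) (hπ : π ≠ 0) {η : 𝓞 K} (hη : η * D.σ η = algebraMap (𝓞 F) (𝓞 K) ε)
    (ht : η + D.σ η = algebraMap (𝓞 F) (𝓞 K) t) : TD π ε t := by
  obtain ⟨t', s, -, h4⟩ := h.lin η
  have h5 : s ^ 2 = π * (t ^ 2 - 4 * ε) := by
    apply alg_inj (F := F) (K := K)
    rw [map_pow, ← h4, map_mul, map_sub, map_mul, map_pow, ← ht, ← hη, map_ofNat, ← h.1]; ring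
  have h6 : (s : F) ^ 2 = (π : F) * ((t : F) ^ 2 - 4 * (ε : F)) := by
    have := congrArg (algebraMap (𝓞 F) F) h5
    rw [map_pow, map_mul, map_sub, map_mul, map_pow, map_ofNat] at this
    exact this
  have hπ' : (π : F) ≠ 0 := by simpa using hπ
  exact ⟨s / π, by rw [div_pow, h6]; field_simp⟩

theorem pi_not_sq {D : QC F K} {π1 π2 : 𝓞 F} {θ : 𝓞 K} (hθ : SQ D (π1 * π2) θ) (h0 : π1 ≠ 0) (h1 : ¬ IsSquare π1) (h2 : ¬ IsSquare π2) :
    ¬ IsSquare (algebraMap (𝓞 F) (𝓞 K) π1) := by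
  rintro ⟨y, hy⟩
  have h3 := SQ.of D hy.symm h1
  obtain ⟨b, hb⟩ := D.desc (y * θ) (by rw [map_mul, h3.2, hθ.2]; ring)
  have h4 : b ^ 2 = π1 ^ 2 * π2 := by
    apply alg_inj (F := F) (K := K)
    rw [map_pow, hb, mul_pow, sq y, sq θ, ← hy, hθ.1, ← map_mul]; congr 1; ring
  apply not_sq_field h2
  have hπ' : (π1 : F) ≠ 0 := by simpa using h0
  have h6 : (b : F) ^ 2 = (π1 : F) ^ 2 * (π2 : F) := by
    have := congrArg (algebraMap (𝓞 F) F) h4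
    simpa using this
  exact ⟨b / π1, by rw [← sq, div_pow, h6]; field_simp⟩

theorem M9 {D : QC F K} {p1 p2 : Ideal (𝓞 F)} {π1 π2 : 𝓞 F} {θ : 𝓞 K} (hp1 : PD p1 π1) (hp2 : PD p2 π2) (hne : p1 ≠ p2) (hodd : Odd (classNumber F))
    (hF2 : Module.finrank F K = 2) (hθ : SQ D (π1 * π2) θ) {ε : (𝓞 F)ˣ} {t1 t2 : 𝓞 F} (h1 : TD π1 ε t1) (h2 : TD π2 ε t2) (hc : t1 + t2 ≠ 0) :
    ∃ (a : Ideal (𝓞 K)) (d : 𝓞 K), a ≠ ⊥ ∧ a ^ 2 = Ideal.span {d} ∧ a * D.s a = Ideal.span {algebraMap (𝓞 F) (𝓞 K) (t1 + t2)} ∧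
      d * D.σ d = algebraMap (𝓞 F) (𝓞 K) (t1 + t2) ^ 2 * algebraMap (𝓞 F) (𝓞 K) ε := by
  obtain ⟨s1, hs1⟩ := h1
  obtain ⟨s2, hs2⟩ := h2
  have hθK : (θ : K) ^ 2 = algebraMap F K π1 * algebraMap F K π2 := by
    have := congrArg (algebraMap (𝓞 K) K) hθ.1
    rw [sq, ← map_mul, this, ← map_mul]; rfl
  have hsK1 : (algebraMap F K s1) ^ 2 * algebraMap F K π1 = (algebraMap F K t1) ^ 2 - 4 * algebraMap F K (ε : 𝓞 F) := by
    have := congrArg (algebraMap F K) hs1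
    rw [map_mul, map_pow, map_sub, map_mul, map_pow, map_ofNat] at this
    exact this
  have hsK2 : (algebraMap F K s2) ^ 2 * algebraMap F K π2 = (algebraMap F K t2) ^ 2 - 4 * algebraMap F K (ε : 𝓞 F) := by
    have := congrArg (algebraMap F K) hs2
    rw [map_mul, map_pow, map_sub, map_mul, map_pow, map_ofNat] at this
    exact this
  have hal : ∀ x : 𝓞 F, ((algebraMap (𝓞 F) (𝓞 K) x : 𝓞 K) : K) = algebraMap F K x := fun x => rfl
  -- δ
  obtain ⟨δ, hδK, hδ⟩ := int_sqrt (algebraMap F K (s1 * s2) * (θ : K)) (algebraMap (𝓞 F) (𝓞 K) ((t1 ^ 2 - 4 * ε) * (t2 ^ 2 - 4 * ε))) (by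
    have : algebraMap F K (s1 * s2) * (θ : K) * (algebraMap F K (s1 * s2) * (θ : K)) = (algebraMap F K s1) ^ 2 * (algebraMap F K s2) ^ 2 * (θ : K) ^ 2 := by
      rw [map_mul]; ring
    rw [this, hθK]
    have h4 : algebraMap (𝓞 K) K (algebraMap (𝓞 F) (𝓞 K) ((t1 ^ 2 - 4 * ε) * (t2 ^ 2 - 4 * ε))) =
      (algebraMap F K t1 ^ 2 - 4 * algebraMap F K (ε : 𝓞 F)) * (algebraMap F K t2 ^ 2 - 4 * algebraMap F K (ε : 𝓞 F)) := by
      simp only [map_mul, map_sub, map_pow, map_ofNat]; rfl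
    refine Eq.trans ?_ h4.symm
    linear_combination algebraMap F K s2 ^ 2 * algebraMap F K π2 * hsK1 + (algebraMap F K t1 ^ 2 - 4 * algebraMap F K (ε : 𝓞 F)) * hsK2)
  have hδσ : D.σ δ = -δ := by
    obtain ⟨x, -, hx, -⟩ := hθ.lin δ
    -- δ * θ is in F
    have h3 : ∃ b c : 𝓞 F, c ≠ 0 ∧ algebraMap (𝓞 F) (𝓞 K) c * δ = algebraMap (𝓞 F) (𝓞 K) b * θ := by
      obtain ⟨b, c, hc0, hbc⟩ := IsFractionRing.div_surjective (A := 𝓞 F) (s1 * s2)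
      have hc0' : (c : F) ≠ 0 := by simpa using nonZeroDivisors.ne_zero hc0
      refine ⟨b, c, nonZeroDivisors.ne_zero hc0, ?_⟩
      apply RingOfIntegers.ext
      change algebraMap F K c * (δ : K) = algebraMap F K b * (θ : K)
      rw [hδK, ← hbc, map_div₀]
      have : algebraMap F K c ≠ 0 := by simpa using hc0'
      rw [← mul_assoc, mul_div_cancel₀ _ this]
    obtain ⟨b, c, hc0, hbc⟩ := h3
    apply mul_left_cancel₀ (alg_ne_zero (K := K) hc0)
    have := congrArg D.σ hbc
    rw [map_mul, map_mul, D.fix, D.fix, hθ.2] at this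
    linear_combination this + hbc
  simp only [map_mul, map_sub, map_pow, map_ofNat] at hδ
  set T1 := algebraMap (𝓞 F) (𝓞 K) t1 with hT1
  set T2 := algebraMap (𝓞 F) (𝓞 K) t2 with hT2
  set E := algebraMap (𝓞 F) (𝓞 K) ε with hE
  obtain ⟨d', hd'⟩ := int_half (T1 * T2 - δ) (T1 * T2) (- E * T1 ^ 2 - E * T2 ^ 2 + 4 * E ^ 2) (by linear_combination hδ)
  set d := 2 * E + d' with hd
  have hd'σ : 2 * D.σ d' = T1 * T2 + δ := by
    have := congrArg D.σ hd'
    rw [map_mul, map_ofNat, map_sub, map_mul, D.fix, D.fix, hδσ] at this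
    linear_combination this
  have hdN : d * D.σ d = algebraMap (𝓞 F) (𝓞 K) (t1 + t2) ^ 2 * E := by
    rw [hd, map_add, map_mul, map_ofNat, D.fix, map_add, ← hT1, ← hT2, ← hE]
    apply mul_left_cancel₀ (mul_ne_zero (two_ne_zero_O (K := K)) (two_ne_zero_O (K := K)))
    linear_combination 2 * D.σ d' * hd' + (T1 * T2 - δ) * hd'σ - hδ + 4 * E * hd' + 4 * E * hd'σ
  have hd0 : d ≠ 0 := by
    intro h
    rw [h, zero_mul, eq_comm, ← map_pow, hE, ← map_mul] at hdN
    exact alg_ne_zero (mul_ne_zero (pow_ne_zero 2 hc) ε.ne_zero) hdN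
  -- L
  obtain ⟨L, i1, i2, i3, hL2, D', lam, hlam⟩ := exists_SQ (pi_not_sq hθ hp1.ne_zero (hp1.not_sq hodd) (hp2.not_sq hodd))
  have hlam0 : (lam : L) ≠ 0 := by
    have := hlam.ne_zero (alg_ne_zero hp1.ne_zero)
    simpa using this
  set f : F →+* L := (algebraMap K L).comp (algebraMap F K) with hf
  have hlL : (lam : L) ^ 2 = f π1 := by
    have := congrArg (algebraMap (𝓞 L) L) hlam.1
    rw [sq, ← map_mul, this]; rfl
  have hθL : (algebraMap K L θ) ^ 2 = f π1 * f π2 := by rw [← map_pow, hθK, map_mul]; rfl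
  obtain ⟨mu, hmuL, hmu⟩ := int_sqrt (algebraMap K L θ / lam) (algebraMap (𝓞 K) (𝓞 L) (algebraMap (𝓞 F) (𝓞 K) π2)) (by
    rw [← sq, div_pow, hθL, hlL]
    have : f π1 ≠ 0 := by rw [← hlL]; exact pow_ne_zero 2 hlam0
    rw [mul_div_cancel_left₀ _ this]; rfl)
  have hml : mu * lam = algebraMap (𝓞 K) (𝓞 L) θ := by
    apply RingOfIntegers.ext
    change (mu : L) * (lam : L) = algebraMap K L θ
    rw [hmuL, div_mul_cancel₀ _ hlam0]
  have hmuσ : D'.σ mu = -mu := by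
    have := congrArg D'.σ hml
    rw [map_mul, hlam.2, D'.fix, ← hml] at this
    apply mul_right_cancel₀ (hlam.ne_zero (alg_ne_zero hp1.ne_zero))
    linear_combination -this
  have hmuS : SQ D' (algebraMap (𝓞 F) (𝓞 K) π2) mu := ⟨hmu, hmuσ⟩
  have hnoram : ∀ P : Ideal (𝓞 L), ¬ Ram K P := by
    intro P hP
    have key : ∀ (p : Ideal (𝓞 F)) (π : 𝓞 F) (l : 𝓞 L), PD p π → SQ D' (algebraMap (𝓞 F) (𝓞 K) π) l → 
        π ∈ (P.comap (algebraMap (𝓞 K) (𝓞 L))).comap (algebraMap (𝓞 F) (𝓞 K)) := by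
      intro p π l hp hl
      rw [Ideal.mem_comap, Ideal.mem_comap, ← hl.1]
      refine P.mul_mem_left _ (hl.mem_of_ram ?_ hP)
      obtain ⟨ξ, v, hv⟩ := hp.sq
      refine ⟨algebraMap (𝓞 F) (𝓞 K) ξ, algebraMap (𝓞 F) (𝓞 K) v, ?_⟩
      rw [← map_pow, ← map_sub, hv, map_mul, map_ofNat]
    have hpr := (hP.1.comap (algebraMap (𝓞 K) (𝓞 L))).comap (algebraMap (𝓞 F) (𝓞 K))
    exact hne ((hp1.eq_of_mem hpr (key _ _ _ hp1 hlam)).symm.trans (hp2.eq_of_mem hpr (key _ _ _ hp2 hmuS)))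
  -- eta
  set g := algebraMap (𝓞 K) (𝓞 L) with hg
  have hgL : ∀ x : 𝓞 F, ((g (algebraMap (𝓞 F) (𝓞 K) x) : 𝓞 L) : L) = f x := fun x => rfl
  have hsL1 : (f s1) ^ 2 * f π1 = (f t1) ^ 2 - 4 * f (ε : 𝓞 F) := by
    have := congrArg f hs1
    rw [map_mul, map_pow, map_sub, map_mul, map_pow, map_ofNat] at this
    exact this
  have hsL2 : (f s2) ^ 2 * f π2 = (f t2) ^ 2 - 4 * f (ε : 𝓞 F) := by
    have := congrArg f hs2
    rw [map_mul, map_pow, map_sub, map_mul, map_pow, map_ofNat] at this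
    exact this
  have hL0 : (2 : L) ≠ 0 := two_ne_zero
  obtain ⟨e1, he1⟩ := int_quad ((f t1 + f s1 * lam) / 2) (g T1) (-g E) (by
    change _ = f t1 * ((f t1 + f s1 * lam) / 2) + -(f (ε : 𝓞 F))
    field_simp
    linear_combination 1 * hsL1 + (f s1) ^ 2 * hlL)
  have hmuL2 : (mu : L) ^ 2 = f π2 := by
    have := congrArg (algebraMap (𝓞 L) L) hmu
    rw [sq, ← map_mul, this]; rfl
  obtain ⟨e2, he2⟩ := int_quad ((f t2 + f s2 * mu) / 2) (g T2) (-g E) (by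
    change _ = f t2 * ((f t2 + f s2 * mu) / 2) + -(f (ε : 𝓞 F))
    field_simp
    linear_combination 1 * hsL2 + (f s2) ^ 2 * hmuL2)
  have q1 : e1 * (g T1 - e1) = g E := by
    apply RingOfIntegers.ext
    change (e1 : L) * (f t1 - e1) = f (ε : 𝓞 F)
    rw [he1]
    field_simp
    linear_combination -1 * hsL1 - (f s1) ^ 2 * hlL
  have q2 : e2 * (g T2 - e2) = g E := by
    apply RingOfIntegers.ext
    change (e2 : L) * (f t2 - e2) = f (ε : 𝓞 F)
    rw [he2]
    field_simp
    linear_combination -1 * hsL2 - (f s2) ^ 2 * hmuL2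
  have q3 : (2 * e1 - g T1) * (2 * e2 - g T2) = g δ := by
    apply RingOfIntegers.ext
    change (algebraMap (𝓞 L) L 2 * (e1 : L) - f t1) * (algebraMap (𝓞 L) L 2 * (e2 : L) - f t2) = ((g δ : 𝓞 L) : L)
    rw [map_ofNat, he1, he2]
    have : ((g δ : 𝓞 L) : L) = f s1 * f s2 * (mu * lam) := by
      have e1 : ((g δ : 𝓞 L) : L) = algebraMap K L δ := rfl
      have e2 : (mu * lam : L) = algebraMap K L θ := by
        have := congrArg (algebraMap (𝓞 L) L) hml
        rw [map_mul] at this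
        exact this
      rw [e1, e2, hδK, map_mul, map_mul, map_mul]; rfl
    rw [this]
    field_simp
    ring
  have hE1 : IsUnit (g E) := by
    have := (ε.isUnit.map (algebraMap (𝓞 F) (𝓞 K))).map g
    exact this
  have hu1 : IsUnit e1 := isUnit_of_mul_isUnit_left (q1 ▸ hE1)
  have hu2 : IsUnit e2 := isUnit_of_mul_isUnit_left (q2 ▸ hE1)
  have hL2' := two_ne_zero_O (K := L)
  have q4 : g E * (e1 + e2) ^ 2 = e1 * e2 * g d := by
    rw [hd, map_add, map_mul, map_ofNat]
    apply mul_left_cancel₀ hL2'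
    have hd2 : 2 * g d' = g T1 * g T2 - g δ := by rw [← map_ofNat g 2, ← map_mul, hd', map_sub, map_mul]
    linear_combination -e1 * e2 * hd2 - e1 * e2 * q3 - 2 * e2 ^ 2 * q1 - 2 * e1 ^ 2 * q2
  have q5 : e1 * e2 * (g (algebraMap (𝓞 F) (𝓞 K) (t1 + t2)) - (e1 + e2)) = g E * (e1 + e2) := by
    rw [map_add, map_add]
    linear_combination e2 * q1 + e1 * q2
  have hσ12 : D'.σ (e1 + e2) = g (algebraMap (𝓞 F) (𝓞 K) (t1 + t2)) - (e1 + e2) := by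
    have hself : ∀ (s : F) (t : 𝓞 F) (e l : 𝓞 L), (e : L) = (f t + f s * l) / 2 → D'.σ l = - l → D'.σ e = g (algebraMap (𝓞 F) (𝓞 K) t) - e := by
      intro s t e l he hl
      obtain ⟨b, c, hc0, hbc⟩ := IsFractionRing.div_surjective (A := 𝓞 F) s
      have hc0' : (c : F) ≠ 0 := by simpa using nonZeroDivisors.ne_zero hc0
      have hc1 : f c ≠ 0 := by simpa using hc0'
      have hce : 2 * (g (algebraMap (𝓞 F) (𝓞 K) c) * e) = g (algebraMap (𝓞 F) (𝓞 K) c) * g (algebraMap (𝓞 F) (𝓞 K) t) + g (algebraMap (𝓞 F) (𝓞 K) b) * l := by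
        apply RingOfIntegers.ext
        change algebraMap (𝓞 L) L 2 * (f c * (e : L)) = f c * f t + f b * (l : L)
        rw [map_ofNat, he, ← hbc, map_div₀]
        field_simp
      have := congrArg D'.σ hce
      rw [map_mul, map_mul, map_ofNat, map_add, map_mul, map_mul, D'.fix, D'.fix, D'.fix, hl] at this
      have hgc : g (algebraMap (𝓞 F) (𝓞 K) c) ≠ 0 := alg_ne_zero (alg_ne_zero (nonZeroDivisors.ne_zero hc0))
      apply mul_left_cancel₀ (mul_ne_zero hL2' hgc)
      linear_combination this + hce
    rw [map_add, hself s1 t1 e1 lam he1 hlam.2, hself s2 t2 e2 mu he2 hmuσ, map_add, map_add]; ring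
  have hI2 : Ideal.span {e1 + e2} ^ 2 = ext L (Ideal.span {d}) := by
    rw [ext_span, Ideal.span_singleton_pow, ← Ideal.span_singleton_mul_left_unit hE1, q4, Ideal.span_singleton_mul_left_unit (hu1.mul hu2)]
  have hA0 : (Ideal.span {e1 + e2} : Ideal (𝓞 L)) ≠ ⊥ := by
    intro h
    rw [h] at hI2
    exact ext_ne_bot (K := L) (p := Ideal.span {d}) (by simpa using hd0) (by rw [← hI2, Ideal.bot_pow two_ne_zero])
  obtain ⟨a, A, ha, hA, haA⟩ := G4 D' (Ideal.span {e1 + e2}) hA0 (by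
    rw [D'.s_span, hσ12, ← Ideal.span_singleton_mul_left_unit (hu1.mul hu2), q5, Ideal.span_singleton_mul_left_unit hE1])
  have : A = ∅ := Finset.eq_empty_of_forall_notMem fun P hP => hnoram P (hA P hP)
  rw [this, Finset.prod_empty, mul_one] at haA
  have ha2 : a ^ 2 = Ideal.span {d} := by
    apply ext_inj (K := L) hL2
    rw [ext_pow, ← haA, hI2]
  refine ⟨a, d, ha, ha2, ?_, hdN⟩
  apply ideal_pow_inj two_ne_zero
  rw [mul_pow, ← D.s_pow, ha2, D.s_span, Ideal.span_singleton_mul_span_singleton, hdN, mul_comm,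
    Ideal.span_singleton_mul_left_unit (ε.isUnit.map (algebraMap (𝓞 F) (𝓞 K))), Ideal.span_singleton_pow]

theorem cSym {D : QC F K} {Q : Ideal (𝓞 K)} (hQ : Q.IsPrime) (h0 : Q ≠ ⊥) (hs : ∀ y, ∃ a : 𝓞 F, y - algebraMap (𝓞 F) (𝓞 K) a ∈ Q)
    {η : 𝓞 K} {ε : (𝓞 F)ˣ} {t t' : 𝓞 F} (hη : η * D.σ η = algebraMap (𝓞 F) (𝓞 K) ε) (ht : η + D.σ η = algebraMap (𝓞 F) (𝓞 K) t)
    (ht' : t' ^ 2 - 4 * (ε : 𝓞 F) ∈ Q.comap (algebraMap (𝓞 F) (𝓞 K))) (h2 : (2 : 𝓞 K) ∉ Q) (hc : t + t' ∉ Q.comap (algebraMap (𝓞 F) (𝓞 K))) :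
    Rs Q η ↔ Rs (Q.comap (algebraMap (𝓞 F) (𝓞 K))) (t + t') := by
  rw [← Rs_alg hs]
  have h3 : Rs Q (2 * 2 * (algebraMap (𝓞 F) (𝓞 K) (t + t') * η)) := by
    refine ⟨2 * η + algebraMap (𝓞 F) (𝓞 K) t', ?_⟩
    rw [Ideal.mem_comap, map_sub, map_pow, map_mul, map_ofNat] at ht'
    have : 2 * 2 * (algebraMap (𝓞 F) (𝓞 K) (t + t') * η) - (2 * η + algebraMap (𝓞 F) (𝓞 K) t') * (2 * η + algebraMap (𝓞 F) (𝓞 K) t')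
      = - (algebraMap (𝓞 F) (𝓞 K) t' ^ 2 - 4 * algebraMap (𝓞 F) (𝓞 K) ε) := by
      rw [← hη, map_add, ← ht]; ring
    rw [this]; exact Q.neg_mem ht'
  have h4 := Rs_of_mul hQ h0 h3 (Rs_sq _ _) (fun h => (hQ.mem_or_mem h).elim h2 h2)
  have hηQ : η ∉ Q := by
    intro h
    have : algebraMap (𝓞 F) (𝓞 K) ε ∈ Q := by rw [← hη]; exact Q.mul_mem_right _ h
    exact unit_notMem (hQ.comap (algebraMap (𝓞 F) (𝓞 K))) ε this
  constructor
  · intro h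
    exact Rs_of_mul hQ h0 (by rwa [mul_comm] at h4) h hηQ
  · intro h
    exact Rs_of_mul hQ h0 h4 h hc

theorem tr_mem {D : QC F K} {P : Ideal (𝓞 K)} (hP : Ram F P) {η : 𝓞 K} {ε t : 𝓞 F} (hη : η * D.σ η = algebraMap (𝓞 F) (𝓞 K) ε) (ht : η + D.σ η = algebraMap (𝓞 F) (𝓞 K) t) :
    t ^ 2 - 4 * ε ∈ P.comap (algebraMap (𝓞 F) (𝓞 K)) := by
  rw [Ideal.mem_comap, map_sub, map_pow, map_mul, map_ofNat, ← hη, ← ht, show (η + D.σ η) ^ 2 - 4 * (η * D.σ η) = (D.σ η - η) ^ 2 by ring]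
  exact Ideal.pow_mem_of_mem _ (hP.act D η) _ two_pos
end S11

section S12
universe u
variable {F : Type*} {K : Type u} [Field F] [NumberField F] [Field K] [NumberField K] [Algebra F K]

structure KD (D : QC F K) (p1 p2 : Ideal (𝓞 F)) (π1 π2 : 𝓞 F) (P1 P2 : Ideal (𝓞 K)) : Prop where
  hp1 : PD p1 π1
  hp2 : PD p2 π2
  hne : p1 ≠ p2
  hodd : Odd (classNumber F)
  h2 : Module.finrank F K = 2
  hinf : UnramifiedAtInfinitePlaces F K
  hP1 : Ram F P1
  hP2 : Ram F P2
  c1 : P1.comap (algebraMap (𝓞 F) (𝓞 K)) = p1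
  c2 : P2.comap (algebraMap (𝓞 F) (𝓞 K)) = p2
  hR : ∀ P, Ram F P → P = P1 ∨ P = P2

variable {D : QC F K} {p1 p2 : Ideal (𝓞 F)} {π1 π2 : 𝓞 F} {P1 P2 : Ideal (𝓞 K)}

theorem KD.symm (H : KD D p1 p2 π1 π2 P1 P2) : KD D p2 p1 π2 π1 P2 P1 :=
  ⟨H.hp2, H.hp1, H.hne.symm, H.hodd, H.h2, H.hinf, H.hP2, H.hP1, H.c2, H.c1, fun P hP => (H.hR P hP).symm⟩

theorem not_le_of_n {a P : Ideal (𝓞 K)} {n : 𝓞 F} (h : a * D.s a = Ideal.span {algebraMap (𝓞 F) (𝓞 K) n})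
    (hn : n ∉ P.comap (algebraMap (𝓞 F) (𝓞 K))) : ¬ a ≤ P := by
  intro h'
  apply hn
  rw [Ideal.mem_comap]
  have := Ideal.mem_span_singleton_self (algebraMap (𝓞 F) (𝓞 K) n)
  rw [← h] at this
  exact h' (Ideal.mul_le_left this)

theorem ne_bot_of_n {a : Ideal (𝓞 K)} {n : 𝓞 F} (h : a * D.s a = Ideal.span {algebraMap (𝓞 F) (𝓞 K) n})
    (hn : n ≠ 0) : a ≠ ⊥ := by
  rintro rfl
  rw [Ideal.bot_mul, eq_comm, Ideal.span_singleton_eq_bot] at h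
  exact alg_ne_zero hn h

theorem nrm_pow {a : Ideal (𝓞 K)} {n : 𝓞 F} (h : a * D.s a = Ideal.span {algebraMap (𝓞 F) (𝓞 K) n}) (k : ℕ) :
    a ^ k * D.s (a ^ k) = Ideal.span {algebraMap (𝓞 F) (𝓞 K) (n ^ k)} := by
  rw [D.s_pow, ← mul_pow, h, Ideal.span_singleton_pow, map_pow]

theorem nrm_mul {a b : Ideal (𝓞 K)} {n m : 𝓞 F} (h : a * D.s a = Ideal.span {algebraMap (𝓞 F) (𝓞 K) n})
    (h' : b * D.s b = Ideal.span {algebraMap (𝓞 F) (𝓞 K) m}) :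
    a * b * D.s (a * b) = Ideal.span {algebraMap (𝓞 F) (𝓞 K) (n * m)} := by
  rw [D.s_mul, mul_mul_mul_comm, h, h', Ideal.span_singleton_mul_span_singleton, map_mul]

theorem nrm_top : (⊤ : Ideal (𝓞 K)) * D.s ⊤ = Ideal.span {algebraMap (𝓞 F) (𝓞 K) 1} := by
  rw [← Ideal.one_eq_top, D.s_top, map_one, Ideal.span_singleton_one, mul_one, Ideal.one_eq_top]

theorem Rs_prin {P : Ideal (𝓞 K)} (hP : Ram F P) (hU : US (P.comap (algebraMap (𝓞 F) (𝓞 K)))) {b : Ideal (𝓞 K)} {n : 𝓞 F}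
    (h : b * D.s b = Ideal.span {algebraMap (𝓞 F) (𝓞 K) n}) (hn : n ∉ P.comap (algebraMap (𝓞 F) (𝓞 K))) (hb : Pr b) :
    Rs (P.comap (algebraMap (𝓞 F) (𝓞 K))) n := by
  obtain ⟨x, hx, e⟩ := hb
  have := Wlem D hP hU (not_le_of_n h hn) (b' := ⊤) (fun h => hP.1.ne_top (top_le_iff.1 h)) one_ne_zero hx (by
    rw [Ideal.span_singleton_one, Ideal.mul_top, Ideal.top_mul, e]) h nrm_top
  rwa [mul_one] at this

theorem KD.LC (H : KD D p1 p2 π1 π2 P1 P2) (hr : Rs p2 π1) {a : Ideal (𝓞 K)} {n : 𝓞 F}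
    (h : a * D.s a = Ideal.span {algebraMap (𝓞 F) (𝓞 K) n}) (hn : n ∉ p2) {x : 𝓞 K} (hx : x ≠ 0)
    (hs : D.s (a * Ideal.span {x}) = a * Ideal.span {x}) : Rs p2 n := by
  have hn0 : n ≠ 0 := by rintro rfl; exact hn p2.zero_mem
  have ha := ne_bot_of_n h hn0
  obtain ⟨θ, hθ, hθP⟩ := ident (D := D) H.hp1 H.hp2 H.hne H.hodd H.h2 H.hinf H.hP1 H.hP2 H.c1 H.c2 H.hR
  obtain ⟨b, A, hb, hA, e⟩ := G4 D _ (mul_ne_zero ha (by simpa using hx)) hs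
  obtain ⟨y, hy, hyb⟩ := ext_pow_principal (K := K) hb
  have hθ0 := hθ.ne_zero (mul_ne_zero H.hp1.ne_zero H.hp2.ne_zero)
  have hy0 : algebraMap (𝓞 F) (𝓞 K) y ≠ 0 := alg_ne_zero hy
  have hA' : A ⊆ {P1, P2} := fun P hP => by simpa using H.hR P (hA P hP)
  have hPne : P1 ≠ P2 := by rintro rfl; exact H.hne (H.c1.symm.trans H.c2)
  have eh : a ^ classNumber F * Ideal.span {x ^ classNumber F} = Ideal.span {algebraMap (𝓞 F) (𝓞 K) y} * (∏ P ∈ A, P) ^ classNumber F := by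
    rw [← Ideal.span_singleton_pow, ← mul_pow, e, mul_pow, hyb]
  have hPP : P1 ^ classNumber F * P1 ^ classNumber F = Ideal.span {algebraMap (𝓞 F) (𝓞 K) π1} := by
    rw [← mul_pow, ← sq, ← H.hP1.2.2, ← ext_pow, H.c1, H.hp1.gen, ext_span]
  have hsP : P1 ^ classNumber F * D.s (P1 ^ classNumber F) = Ideal.span {algebraMap (𝓞 F) (𝓞 K) π1} := by
    rw [D.s_pow, (H.hP1.norm D).1, hPP]
  have hn' := nrm_pow h (classNumber F)
  have hnh : n ^ classNumber F ∉ p2 := fun h => hn (H.hp2.prime.mem_of_pow_mem _ h)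
  have hU := H.hp2.us
  have hxh : x ^ classNumber F ≠ 0 := pow_ne_zero _ hx
  have hπ1 : π1 ∉ p2 := H.hp1.notMem H.hp2.prime H.hne.symm
  have hc2 := H.c2
  subst hc2
  have f1 := not_le_of_n hn' hnh
  have ftop : ¬ (⊤ : Ideal (𝓞 K)) ≤ P2 := fun h => H.hP2.1.ne_top (top_le_iff.1 h)
  have fP1 := not_le_of_n hsP hπ1
  have fin1 : Rs (P2.comap (algebraMap (𝓞 F) (𝓞 K))) (n ^ classNumber F * 1) → Rs (P2.comap (algebraMap (𝓞 F) (𝓞 K))) n := by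
    rw [mul_one]; intro h; exact Rs_of_pow_odd H.hp2.prime H.hp2.ne_bot H.hodd h hn
  have fin2 : Rs (P2.comap (algebraMap (𝓞 F) (𝓞 K))) (n ^ classNumber F * π1) → Rs (P2.comap (algebraMap (𝓞 F) (𝓞 K))) n := by
    intro h
    rw [mul_comm] at h
    exact Rs_of_pow_odd H.hp2.prime H.hp2.ne_bot H.hodd (Rs_of_mul H.hp2.prime H.hp2.ne_bot h hr hπ1) hn
  have h4 : A = ∅ ∨ A = {P1} ∨ A = {P2} ∨ A = {P1, P2} := by
    rw [← Finset.coe_subset, Finset.coe_pair, Set.subset_pair_iff_eq] at hA'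
    exact_mod_cast hA'
  rcases h4 with h0 | h0 | h0 | h0
  · rw [h0, Finset.prod_empty, one_pow, mul_one] at eh
    exact fin1 (Wlem D H.hP2 hU f1 ftop hxh hy0 (by rw [eh, Ideal.top_mul]) hn' nrm_top)
  · rw [h0, Finset.prod_singleton, mul_comm (Ideal.span {_})] at eh
    exact fin2 (Wlem D H.hP2 hU f1 fP1 hxh hy0 eh hn' hsP)
  · rw [h0, Finset.prod_singleton] at eh
    refine fin2 (Wlem D H.hP2 hU f1 fP1 (x := x ^ classNumber F * algebraMap (𝓞 F) (𝓞 K) π1) (y := algebraMap (𝓞 F) (𝓞 K) y * θ) (mul_ne_zero hxh (alg_ne_zero H.hp1.ne_zero))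
      (mul_ne_zero hy0 hθ0) ?_ hn' hsP)
    rw [← Ideal.span_singleton_mul_span_singleton, ← Ideal.span_singleton_mul_span_singleton, ← mul_assoc, eh, ← hPP, hθP]; ring
  · rw [h0, Finset.prod_pair hPne, mul_pow, ← hθP, Ideal.span_singleton_mul_span_singleton] at eh
    exact fin1 (Wlem D H.hP2 hU f1 ftop hxh (mul_ne_zero hy0 hθ0) (by rw [eh, Ideal.top_mul]) hn' nrm_top)

/-- last claim -/
theorem KD.last (H : KD D p1 p2 π1 π2 P1 P2) (hr : Rs p2 π1) {a : Ideal (𝓞 K)} {d : 𝓞 K} {c : 𝓞 F} {ε : (𝓞 F)ˣ}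
    (h1 : a ^ 2 = Ideal.span {d}) (h2 : a * D.s a = Ideal.span {algebraMap (𝓞 F) (𝓞 K) c}) (hc : c ∉ p2)
    (h3 : d * D.σ d = algebraMap (𝓞 F) (𝓞 K) c ^ 2 * algebraMap (𝓞 F) (𝓞 K) ε) (hε : ε ∈ NU F K) : Rs p2 c := by
  obtain ⟨u, hu⟩ := mem_NU.1 hε
  rw [D.norm_eq_iff] at hu
  have hn0 : c ≠ 0 := by rintro rfl; exact hc p2.zero_mem
  have ha := ne_bot_of_n h2 hn0
  obtain ⟨γ, hγ, e⟩ := D.h90 (a := d) (b := algebraMap (𝓞 F) (𝓞 K) c * u) (mul_ne_zero (alg_ne_zero hn0) u.ne_zero) (by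
    rw [h3, map_mul, D.fix, ← hu]; ring)
  have hγ' : D.σ γ ≠ 0 := by simpa using hγ
  refine H.LC hr h2 hc hγ' ?_
  rw [D.s_mul, D.s_span, D.inv]
  apply mul_left_cancel₀ (show a ≠ 0 from ha)
  rw [← mul_assoc, ← mul_assoc, h2, ← sq, h1, Ideal.span_singleton_mul_span_singleton, Ideal.span_singleton_mul_span_singleton, e,
    mul_right_comm, Ideal.span_singleton_mul_right_unit u.isUnit]

theorem KD.bad (H : KD D p1 p2 π1 π2 P1 P2) {ε : (𝓞 F)ˣ} (hε : ε ∉ NU F K) {a a' : Ideal (𝓞 K)} {d d' : 𝓞 K} {c c' : 𝓞 F}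
    (h1 : a ^ 2 = Ideal.span {d}) (h2 : a * D.s a = Ideal.span {algebraMap (𝓞 F) (𝓞 K) c}) (hc : c ∉ p2)
    (h3 : d * D.σ d = algebraMap (𝓞 F) (𝓞 K) c ^ 2 * algebraMap (𝓞 F) (𝓞 K) ε) (hcr : ¬ Rs p2 c)
    (h1' : a' ^ 2 = Ideal.span {d'}) (h2' : a' * D.s a' = Ideal.span {algebraMap (𝓞 F) (𝓞 K) c'}) (hc' : c' ∉ p1)
    (h3' : d' * D.σ d' = algebraMap (𝓞 F) (𝓞 K) c' ^ 2 * algebraMap (𝓞 F) (𝓞 K) ε) (hcr' : Rs p1 c')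
    {B : Ideal (𝓞 K)} {q : 𝓞 F} (hB : B * D.s B = Ideal.span {algebraMap (𝓞 F) (𝓞 K) q}) (hq1 : q ∉ p1) (hq2 : q ∉ p2) (hqr : ¬ Rs p1 q) : False := by
  have hPne : P1 ≠ P2 := by rintro rfl; exact H.hne (H.c1.symm.trans H.c2)
  have hcard : ({P1, P2} : Finset (Ideal (𝓞 K))).card = 2 := Finset.card_pair hPne
  have hidx : (NU F K).index = 2 := by
    have h0 := NU_index_ne D
    have h4 := (G_core D H.hodd H.h2 H.hinf {P1, P2} (by simpa using H.hR)).1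
    rw [hcard] at h4
    have h5 : (NU F K).index ≠ 1 := by
      intro h5
      rw [Subgroup.index_eq_one] at h5
      exact hε (h5 ▸ Subgroup.mem_top ε)
    omega
  have hA : AmbPr D := G_B D H.hodd H.h2 H.hinf {P1, P2} (by simpa using H.hR) (by rw [hcard, hidx]; norm_num)
  have hq0 : q ≠ 0 := by rintro rfl; exact hq1 p1.zero_mem
  have hBb := ne_bot_of_n hB hq0
  have hp1 := H.hp1
  have hp2 := H.hp2
  have hc1 := H.c1
  have hc2 := H.c2
  subst hc1 hc2
  obtain ⟨t, m, hm, ht⟩ := Nat.exists_eq_two_pow_mul_odd (classNumber_ne_zero' K)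
  have hex : ∃ s, Pr ((B ^ m) ^ 2 ^ s) := ⟨t, by rw [← pow_mul, mul_comm, ← ht]; exact Pr.class K hBb⟩
  obtain ⟨s, hs, hmin⟩ : ∃ s, Pr ((B ^ m) ^ 2 ^ s) ∧ ∀ s' < s, ¬ Pr ((B ^ m) ^ 2 ^ s') :=
    ⟨Nat.find hex, Nat.find_spec hex, fun s' h => Nat.find_min hex h⟩
  have npow : ∀ {p : Ideal (𝓞 F)} (hp : p.IsPrime) {x : 𝓞 F} (k : ℕ), x ∉ p → x ^ k ∉ p := fun hp x k hx h => hx (hp.mem_of_pow_mem _ h)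
  rcases s with _ | s
  · rw [pow_zero, pow_one] at hs
    exact hqr (Rs_of_pow_odd hp1.prime hp1.ne_bot hm (Rs_prin H.hP1 hp1.us (nrm_pow hB m) (npow hp1.prime m hq1) hs) hq1)
  · set e := (B ^ m) ^ 2 ^ s with he
    have hne : ¬ Pr e := hmin s (Nat.lt_succ_self s)
    have he2 : Pr (e ^ 2) := by rw [he, ← pow_mul, ← pow_succ]; exact hs
    have heb : e ≠ ⊥ := pow_ne_zero _ (pow_ne_zero _ hBb)
    obtain ⟨β, n, ε', g1, g2, g3⟩ := two_tors D H.hodd heb he2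
    have hε' : ε' ∉ NU F K := by
      intro h
      obtain ⟨η, hη⟩ := mem_NU.1 h
      rw [D.norm_eq_iff] at hη
      exact hne (Pr.odd H.hodd he2 (AMB D hA heb g1 g2 η (by rw [g3, hη])))
    have hεε : ε' * ε ∈ NU F K := by
      rw [Subgroup.mul_mem_iff_of_index_two hidx]
      exact ⟨fun h => absurd h hε', fun h => absurd h hε⟩
    obtain ⟨η, hη⟩ := mem_NU.1 hεε
    rw [D.norm_eq_iff] at hη
    have key : ∀ {a : Ideal (𝓞 K)} {d : 𝓞 K} {c : 𝓞 F}, c ≠ 0 → a ^ 2 = Ideal.span {d} → a * D.s a = Ideal.span {algebraMap (𝓞 F) (𝓞 K) c} →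
        d * D.σ d = algebraMap (𝓞 F) (𝓞 K) c ^ 2 * algebraMap (𝓞 F) (𝓞 K) ε → Pr (e * a) := by
      intro a d c hc0 k1 k2 k3
      have hab := ne_bot_of_n k2 hc0
      have kk : (e * a) ^ 2 = Ideal.span {β * d} := by rw [mul_pow, g1, k1, Ideal.span_singleton_mul_span_singleton]
      have hd0 : d ≠ 0 := by
        rintro rfl
        rw [Ideal.span_singleton_eq_bot.2 rfl] at k1
        exact pow_ne_zero 2 hab k1
      have hβ0 : β ≠ 0 := by
        rintro rfl
        rw [Ideal.span_singleton_eq_bot.2 rfl] at g1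
        exact pow_ne_zero 2 heb g1
      refine Pr.odd H.hodd ⟨_, mul_ne_zero hβ0 hd0, kk⟩ (AMB D hA (mul_ne_zero heb hab) kk (nrm_mul g2 k2) η ?_)
      rw [hη, map_mul, Units.val_mul, map_mul, map_mul]
      linear_combination d * D.σ d * g3 + algebraMap (𝓞 F) (𝓞 K) n ^ 2 * algebraMap (𝓞 F) (𝓞 K) ε' * k3
    have nz : ∀ {p : Ideal (𝓞 F)} {x : 𝓞 F}, x ∉ p → x ≠ 0 := by rintro p x hx rfl; exact hx p.zero_mem
    have nmul : ∀ {p : Ideal (𝓞 F)} (hp : p.IsPrime) {x y : 𝓞 F}, x ∉ p → y ∉ p → x * y ∉ p := fun hp x y hx hy h => (hp.mem_or_mem h).elim hx hy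
    rcases s with _ | s
    · have k := key (nz hc') h1' h2' h3'
      rw [he, pow_zero, pow_one] at k
      have hqm := npow hp1.prime m hq1
      have := Rs_prin H.hP1 hp1.us (nrm_mul (nrm_pow hB m) h2') (nmul hp1.prime hqm hc') k
      rw [mul_comm] at this
      exact hqr (Rs_of_pow_odd hp1.prime hp1.ne_bot hm (Rs_of_mul hp1.prime hp1.ne_bot this hcr' hc') hq1)
    · have k := key (nz hc) h1 h2 h3
      rw [he] at k
      have hqm := npow hp2.prime (2 ^ (s+1)) (npow hp2.prime m hq2)
      have := Rs_prin H.hP2 hp2.us (nrm_mul (nrm_pow (nrm_pow hB m) (2 ^ (s+1))) h2) (nmul hp2.prime hqm hc) k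
      refine hcr (Rs_of_mul hp2.prime hp2.ne_bot this ?_ hqm)
      rw [pow_succ, pow_mul, sq]
      exact Rs_sq _ _
end S12

section S13
variable {F : Type*} [Field F] [NumberField F]

theorem idx_mod4 : (powMonoidHom 2 : (𝓞 F ⧸ (Ideal.span {4} : Ideal (𝓞 F)))ˣ →* (𝓞 F ⧸ (Ideal.span {4} : Ideal (𝓞 F)))ˣ).range.index
    ≤ 2 ^ Module.finrank ℚ F := by
  haveI : Finite (𝓞 F ⧸ (Ideal.span {4} : Ideal (𝓞 F))) := Ideal.finiteQuotientOfFreeOfNeBot _ (by simp)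
  haveI : Finite (𝓞 F ⧸ (Ideal.span {2} : Ideal (𝓞 F))) := Ideal.finiteQuotientOfFreeOfNeBot _ (by simp)
  rw [Subgroup.index_range]
  have h2 : Nat.card (𝓞 F ⧸ (Ideal.span {2} : Ideal (𝓞 F))) = 2 ^ Module.finrank ℚ F := by
    have h := Ideal.absNorm_span_natCast (S := 𝓞 F) 2
    rw [RingOfIntegers.rank] at h
    rw [← h, Nat.cast_ofNat]
    rfl
  rw [← h2]
  have hw : ∀ g : (powMonoidHom 2 : (𝓞 F ⧸ (Ideal.span {4} : Ideal (𝓞 F)))ˣ →* (𝓞 F ⧸ (Ideal.span {4} : Ideal (𝓞 F)))ˣ).ker,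
      ∃ w : 𝓞 F, ((g : (𝓞 F ⧸ (Ideal.span {4} : Ideal (𝓞 F)))ˣ) : 𝓞 F ⧸ (Ideal.span {4} : Ideal (𝓞 F))) = Ideal.Quotient.mk _ (1 + 2 * w) := by
    rintro ⟨g, hg⟩
    obtain ⟨y, hy⟩ := Ideal.Quotient.mk_surjective (g : 𝓞 F ⧸ (Ideal.span {4} : Ideal (𝓞 F)))
    have h1 : (g : 𝓞 F ⧸ (Ideal.span {4} : Ideal (𝓞 F))) ^ 2 = 1 := by
      have := congrArg Units.val (MonoidHom.mem_ker.1 hg)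
      simpa using this
    rw [← hy, ← map_pow, ← map_one (Ideal.Quotient.mk _), Ideal.Quotient.eq, Ideal.mem_span_singleton] at h1
    obtain ⟨v, hv⟩ := h1
    obtain ⟨w, hw⟩ := int_half (y - 1) (-1) v (by linear_combination hv)
    exact ⟨w, by rw [hw, ← hy]; congr 1; ring⟩
  choose w hw using hw
  refine Nat.card_le_card_of_injective (fun g => Ideal.Quotient.mk _ (w g)) ?_
  intro g g' h
  simp only [Ideal.Quotient.eq, Ideal.mem_span_singleton] at h
  apply Subtype.ext
  apply Units.ext
  rw [hw, hw, Ideal.Quotient.eq, Ideal.mem_span_singleton]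
  obtain ⟨v, hv⟩ := h
  exact ⟨v, by linear_combination 2 * hv⟩

theorem unit_mod4 {x : 𝓞 F} (h : Odd (Ideal.absNorm (Ideal.span {x}))) : IsUnit (Ideal.Quotient.mk (Ideal.span {4} : Ideal (𝓞 F)) x) := by
  obtain ⟨y, hy⟩ := Ideal.mem_span_singleton.1 (Ideal.absNorm_mem (Ideal.span {x}))
  obtain ⟨k, hk⟩ := h
  rw [hk] at hy
  push_cast at hy
  apply IsUnit.of_mul_eq_one (Ideal.Quotient.mk _ (y * (2 * k + 1)))
  rw [← map_mul, ← map_one (Ideal.Quotient.mk _), Ideal.Quotient.eq, Ideal.mem_span_singleton]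
  exact ⟨k ^ 2 + k, by linear_combination - (2 * (k : 𝓞 F) + 1) * hy⟩

theorem pigeon {ι : Type*} [Finite ι] (f : ι → 𝓞 F) (hf : ∀ i, Odd (Ideal.absNorm (Ideal.span {f i})))
    (hc : (2 ^ Fintype.card (InfinitePlace F)) ^ 2 < Nat.card ι) :
    ∃ i j, i ≠ j ∧ (∀ φ : F →+* ℝ, 0 < φ (algebraMap (𝓞 F) F (f i * f j))) ∧ ∃ ξ : 𝓞 F, (4 : 𝓞 F) ∣ f i * f j - ξ ^ 2 := by
  haveI : Finite (𝓞 F ⧸ (Ideal.span {4} : Ideal (𝓞 F))) := Ideal.finiteQuotientOfFreeOfNeBot _ (by simp)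
  choose g hg using fun i => unit_mod4 (hf i)
  let S := (powMonoidHom 2 : (𝓞 F ⧸ (Ideal.span {4} : Ideal (𝓞 F)))ˣ →* (𝓞 F ⧸ (Ideal.span {4} : Ideal (𝓞 F)))ˣ).range
  let m : ι → ({φ : F →+* ℂ // ComplexEmbedding.IsReal φ} → Bool) × ((𝓞 F ⧸ (Ideal.span {4} : Ideal (𝓞 F)))ˣ ⧸ S) :=
    fun i => (fun φ => decide (0 < (φ.1 (algebraMap (𝓞 F) F (f i))).re), QuotientGroup.mk (g i))
  have hcard : Nat.card (({φ : F →+* ℂ // ComplexEmbedding.IsReal φ} → Bool) × ((𝓞 F ⧸ (Ideal.span {4} : Ideal (𝓞 F)))ˣ ⧸ S)) ≤ (2 ^ Fintype.card (InfinitePlace F)) ^ 2 := by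
    rw [Nat.card_prod, Nat.card_fun, Nat.card_eq_fintype_card (α := Bool), Fintype.card_bool, Nat.card_eq_fintype_card, InfinitePlace.card_real_embeddings]
    refine (Nat.mul_le_mul_left _ (show S.index ≤ _ from idx_mod4)).trans ?_
    rw [← InfinitePlace.card_add_two_mul_card_eq_rank, InfinitePlace.card_eq_nrRealPlaces_add_nrComplexPlaces, ← pow_add, ← pow_mul]
    apply le_of_eq; congr 1; ring
  have hni : ¬ Function.Injective m := fun h => absurd ((Nat.card_le_card_of_injective m h).trans hcard) (not_le.2 hc)
  simp only [Function.Injective, not_forall] at hni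
  obtain ⟨i, j, e, hij⟩ := hni
  refine ⟨i, j, hij, ?_, ?_⟩
  · intro φ
    have hr : ComplexEmbedding.IsReal (Complex.ofRealHom.comp φ) := by
      ext x; simp
    have h1 := congrFun (congrArg Prod.fst e) ⟨_, hr⟩
    have h1' : (0 < φ (algebraMap (𝓞 F) F (f i))) ↔ (0 < φ (algebraMap (𝓞 F) F (f j))) := by
      simpa [m] using h1
    have h0 : ∀ i, φ (algebraMap (𝓞 F) F (f i)) ≠ 0 := by
      intro i h
      rw [map_eq_zero] at h
      have h' : f i = 0 := by simpa using h
      have := hf i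
      rw [h'] at this
      simp at this
    rw [map_mul, map_mul]
    rcases lt_or_gt_of_ne (h0 i) with h | h
    · exact mul_pos_of_neg_of_neg h (lt_of_le_of_ne (not_lt.1 fun h' => absurd (h1'.2 h') (not_lt.2 h.le)) (h0 j))
    · exact mul_pos h (h1'.1 h)
  · have h2 : (QuotientGroup.mk (g i) : (𝓞 F ⧸ (Ideal.span {4} : Ideal (𝓞 F)))ˣ ⧸ S) = QuotientGroup.mk (g j) := congrArg Prod.snd e
    rw [QuotientGroup.eq] at h2
    obtain ⟨s, hs⟩ := h2
    have hs' : g i * s ^ 2 = g j := by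
      have : s ^ 2 = (g i)⁻¹ * g j := hs
      rw [this, mul_inv_cancel_left]
    obtain ⟨ξ, hξ⟩ := Ideal.Quotient.mk_surjective ((g i * s : (𝓞 F ⧸ (Ideal.span {4} : Ideal (𝓞 F)))ˣ) : 𝓞 F ⧸ (Ideal.span {4} : Ideal (𝓞 F)))
    refine ⟨ξ, Ideal.mem_span_singleton.1 (Ideal.Quotient.eq.1 ?_)⟩
    rw [map_pow, hξ, map_mul, ← hg, ← hg, ← hs', ← Units.val_mul, ← Units.val_pow_eq_pow_val]
    congr 1
    rw [mul_pow, sq (g i), mul_assoc]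
end S13

section S14
universe u
variable {K : Type*} [Field K] [NumberField K]
open Filter Topology

noncomputable def wt (s : ℝ) (I : Ideal (𝓞 K)) : ENNReal := ENNReal.ofReal ((Ideal.absNorm I : ℝ) ^ (-s))
noncomputable def Zt (K : Type*) [Field K] [NumberField K] (s : ℝ) : ENNReal := ∑' I : Ideal (𝓞 K), wt s I

theorem wt_mul (s : ℝ) (I J : Ideal (𝓞 K)) : wt s (I * J) = wt s I * wt s J := by
  unfold wt
  rw [map_mul, Nat.cast_mul, Real.mul_rpow (by positivity) (by positivity), ENNReal.ofReal_mul (by positivity)]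

theorem Zt_eq (s : ℝ) : Zt K s = ∑' n : ℕ, ENNReal.ofReal ((Nat.card {I : Ideal (𝓞 K) // Ideal.absNorm I = n} : ℝ) * (n : ℝ) ^ (-s)) := by
  unfold Zt
  rw [← ENNReal.tsum_fiberwise _ (fun I : Ideal (𝓞 K) => Ideal.absNorm I)]
  refine tsum_congr fun n => ?_
  have h : ∀ I : ((fun I : Ideal (𝓞 K) => Ideal.absNorm I) ⁻¹' {n} : Set (Ideal (𝓞 K))), wt s (I : Ideal (𝓞 K)) = ENNReal.ofReal ((n : ℝ) ^ (-s)) := by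
    intro I
    unfold wt
    have : Ideal.absNorm (I : Ideal (𝓞 K)) = n := I.2
    rw [this]
  rw [tsum_congr h]
  haveI : Finite ((fun I : Ideal (𝓞 K) => Ideal.absNorm I) ⁻¹' {n} : Set (Ideal (𝓞 K))) := Ideal.finite_setOfPred_absNorm_eq n
  haveI := Fintype.ofFinite ((fun I : Ideal (𝓞 K) => Ideal.absNorm I) ⁻¹' {n} : Set (Ideal (𝓞 K)))
  rw [tsum_fintype, Finset.sum_const, nsmul_eq_mul, ENNReal.ofReal_mul (by positivity), ENNReal.ofReal_natCast]
  congr 2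
  rw [Finset.card_univ, ← Nat.card_eq_fintype_card]
  rfl

theorem Zt_bound (K : Type*) [Field K] [NumberField K] : ∃ c C : ℝ, 0 < c ∧ ∀ᶠ s in 𝓝[>] (1:ℝ), ∃ z : ℝ, 0 ≤ z ∧ Zt K s = ENNReal.ofReal z ∧ c ≤ (s-1)*z ∧ (s-1)*z ≤ C := by
  have hpos := dedekindZeta_residue_pos K
  refine ⟨dedekindZeta_residue K / 2, dedekindZeta_residue K + 1, by linarith, ?_⟩
  have ht := tendsto_sub_one_mul_dedekindZeta_nhdsGT K
  have ht' := (Complex.continuous_re.tendsto _).comp ht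
  rw [Complex.ofReal_re] at ht'
  have h1 := ht'.eventually (lt_mem_nhds (show dedekindZeta_residue K / 2 < dedekindZeta_residue K by linarith))
  have h2 := ht'.eventually (gt_mem_nhds (show dedekindZeta_residue K < dedekindZeta_residue K + 1 by linarith))
  filter_upwards [h1, h2, self_mem_nhdsWithin] with s h1 h2 h3
  have h3 : 1 < s := h3
  set g : ℕ → ℝ := fun n => (Nat.card {I : Ideal (𝓞 K) // Ideal.absNorm I = n} : ℝ) * (n : ℝ) ^ (-s) with hg
  have hg0 : ∀ n, 0 ≤ g n := fun n => by positivity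
  have hz : dedekindZeta K s = ((∑' n, g n : ℝ) : ℂ) := by
    rw [Complex.ofReal_tsum]
    unfold dedekindZeta LSeries
    refine tsum_congr fun n => ?_
    rcases eq_or_ne n 0 with rfl | hn
    · rw [LSeries.term_zero]
      simp only [hg]
      rw [Nat.cast_zero, Real.zero_rpow (by linarith), mul_zero, Complex.ofReal_zero]
    · rw [LSeries.term_of_ne_zero hn]
      simp only [hg]
      rw [Complex.ofReal_mul, Complex.ofReal_cpow (by positivity), Complex.ofReal_neg, Complex.cpow_neg]
      simp [div_eq_mul_inv]
  have hr : ((s:ℂ) - 1) * dedekindZeta K s = (((s - 1) * ∑' n, g n : ℝ) : ℂ) := by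
    rw [hz]; push_cast; ring
  simp only [Function.comp_apply] at h1 h2
  rw [hr, Complex.ofReal_re] at h1 h2
  refine ⟨∑' n, g n, tsum_nonneg hg0, ?_, h1.le, h2.le⟩
  rw [Zt_eq, ENNReal.ofReal_tsum_of_nonneg hg0]
  by_contra h
  rw [tsum_eq_zero_of_not_summable h, mul_zero] at h1
  linarith

def Gd (S : Finset (Ideal (𝓞 K))) (I : Ideal (𝓞 K)) : Prop := I ≠ ⊥ ∧ ∀ P ∈ S, ¬ P ∣ I

noncomputable def ZS (S : Finset (Ideal (𝓞 K))) (s : ℝ) : ENNReal := ∑' I : Ideal (𝓞 K), if Gd S I then wt s I else 0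

theorem ZS_le (S : Finset (Ideal (𝓞 K))) (s : ℝ) : ZS S s ≤ Zt K s :=
  ENNReal.tsum_le_tsum fun I => by split_ifs <;> simp

theorem ZS_empty {s : ℝ} (hs : 1 < s) : ZS (∅ : Finset (Ideal (𝓞 K))) s = Zt K s :=
  tsum_congr fun I => by
    by_cases h : I = ⊥
    · subst h
      rw [if_neg (fun h => h.1 rfl)]
      unfold wt
      rw [Ideal.absNorm_bot, Nat.cast_zero, Real.zero_rpow (by linarith), ENNReal.ofReal_zero]
    · rw [if_pos ⟨h, by simp⟩]

theorem ZS_insert (S : Finset (Ideal (𝓞 K))) {P : Ideal (𝓞 K)} (hP : P.IsPrime) (h0 : P ≠ ⊥) {s : ℝ} (hs : 1 < s) (hf : Zt K s ≠ ⊤) :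
    ZS S s ≤ 2 * ZS (insert P S) s := by
  have hw : wt s P ≤ 2⁻¹ := by
    unfold wt
    have h2 : (2 : ℝ) ≤ Ideal.absNorm P := by
      have h1 : Ideal.absNorm P ≠ 1 := fun h => hP.ne_top (Ideal.absNorm_eq_one_iff.1 h)
      have h3 : Ideal.absNorm P ≠ 0 := fun h => h0 (Ideal.absNorm_eq_zero_iff.1 h)
      have : 2 ≤ Ideal.absNorm P := by omega
      exact_mod_cast this
    have : (Ideal.absNorm P : ℝ) ^ (-s) ≤ 2⁻¹ := by
      rw [Real.rpow_neg (by positivity)]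
      refine inv_anti₀ (by norm_num) ?_
      calc (2:ℝ) ≤ Ideal.absNorm P := h2
        _ = (Ideal.absNorm P : ℝ) ^ (1:ℝ) := (Real.rpow_one _).symm
        _ ≤ _ := Real.rpow_le_rpow_of_exponent_le (by linarith) hs.le
    refine (ENNReal.ofReal_le_ofReal this).trans ?_
    rw [ENNReal.ofReal_inv_of_pos (by norm_num)]; simp
  have hA : ZS S s ≤ ZS (insert P S) s + 2⁻¹ * ZS S s := by
    have h1 : ZS S s ≤ ZS (insert P S) s + ∑' I : Ideal (𝓞 K), if Gd S I ∧ P ∣ I then wt s I else 0 := by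
      unfold ZS
      rw [← ENNReal.tsum_add]
      refine ENNReal.tsum_le_tsum fun I => ?_
      by_cases h : Gd S I
      · by_cases hd : P ∣ I
        · rw [if_pos h, if_pos (show _ ∧ _ from ⟨h, hd⟩)]; exact le_add_self
        · rw [if_pos h, if_pos (show Gd (insert P S) I from ⟨h.1, fun Q hQ => by
            rcases Finset.mem_insert.1 hQ with rfl | hQ
            · exact hd
            · exact h.2 Q hQ⟩)]; exact le_self_add
      · rw [if_neg h]; exact zero_le
    refine h1.trans (add_le_add le_rfl ?_)
    have hinj : Function.Injective (fun J : Ideal (𝓞 K) => P * J) := fun a b h => mul_left_cancel₀ h0 h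
    rw [← hinj.tsum_eq (f := fun I => if Gd S I ∧ P ∣ I then wt s I else 0)]
    · unfold ZS
      rw [← ENNReal.tsum_mul_left]
      refine ENNReal.tsum_le_tsum fun J => ?_
      by_cases h : Gd S (P * J)
      · rw [if_pos (show _ ∧ _ from ⟨h, dvd_mul_right _ _⟩), if_pos, wt_mul]
        · exact mul_le_mul' hw le_rfl
        · exact ⟨fun hJ => h.1 (by rw [hJ, Ideal.mul_bot]), fun Q hQ hd => h.2 Q hQ (hd.mul_left _)⟩
      · rw [if_neg (fun h' => h h'.1)]; exact zero_le
    · intro I hI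
      rw [Function.mem_support] at hI
      by_cases h : Gd S I ∧ P ∣ I
      · obtain ⟨J, rfl⟩ := h.2; exact ⟨J, rfl⟩
      · exact absurd (if_neg h) hI
  have hf' : ZS S s ≠ ⊤ := ne_top_of_le_ne_top hf (ZS_le S s)
  by_cases ht : ZS (insert P S) s = ⊤
  · rw [ht]; simp
  lift ZS S s to NNReal using hf' with a
  lift ZS (insert P S) s to NNReal using ht with b
  have h3 : ((2:ENNReal)⁻¹) = (((2:NNReal)⁻¹ : NNReal) : ENNReal) := by rw [ENNReal.coe_inv (by norm_num)]; rfl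
  rw [h3] at hA
  have hA' : a ≤ b + 2⁻¹ * a := by exact_mod_cast hA
  have : a ≤ 2 * b := by
    rw [← NNReal.coe_le_coe] at hA' ⊢
    push_cast at hA' ⊢
    linarith
  exact_mod_cast this

theorem ZS_bd (S : Finset (Ideal (𝓞 K))) (hS : ∀ P ∈ S, P.IsPrime ∧ P ≠ ⊥) {s : ℝ} (hs : 1 < s) (hf : Zt K s ≠ ⊤) :
    Zt K s ≤ 2 ^ S.card * ZS S s := by
  induction S using Finset.induction_on with
  | empty => rw [ZS_empty hs]; simp
  | insert P S hPS ih =>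
    refine (ih fun Q hQ => hS Q (Finset.mem_insert_of_mem hQ)).trans ?_
    rw [Finset.card_insert_of_notMem hPS, pow_succ, mul_assoc]
    have := hS P (Finset.mem_insert_self _ _)
    exact mul_le_mul' le_rfl (ZS_insert S this.1 this.2 hs hf)

open UniqueFactorizationMonoid

theorem ZS_sq {M : Type*} [Field M] [NumberField M] [Algebra K M] (D : QC K M) (S : Finset (Ideal (𝓞 K))) (s : ℝ)
    (φ : Ideal (𝓞 K) → Ideal (𝓞 M)) (hφ : ∀ p : Ideal (𝓞 K), p.IsPrime → p ≠ ⊥ → p ∉ S →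
      (φ p).IsPrime ∧ φ p ≠ ⊥ ∧ (φ p).comap (algebraMap (𝓞 K) (𝓞 M)) = p ∧ D.s (φ p) ≠ φ p ∧ Ideal.absNorm (φ p) = Ideal.absNorm p ∧
      Ideal.absNorm (D.s (φ p)) = Ideal.absNorm p) :
    ZS S s * ZS S s ≤ Zt M s := by
  have hG : ∀ a : Ideal (𝓞 K), Gd S a → ∀ p ∈ normalizedFactors a, p.IsPrime ∧ p ≠ ⊥ ∧ p ∉ S := by
    intro a ha p hp
    have := prime_of_normalized_factor p hp
    exact ⟨Ideal.isPrime_of_prime this, this.ne_zero, fun h => ha.2 p h (dvd_of_mem_normalizedFactors hp)⟩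
  set X : Ideal (𝓞 K) → Ideal (𝓞 K) → Multiset (Ideal (𝓞 M)) := fun a b =>
    (normalizedFactors a).map φ + (normalizedFactors b).map (fun p => D.s (φ p)) with hX
  have hnf : ∀ a b, Gd S a → Gd S b → normalizedFactors (X a b).prod = X a b := by
    intro a b ha hb
    apply normalizedFactors_prod_of_prime
    intro Q hQ
    simp only [hX, Multiset.mem_add, Multiset.mem_map] at hQ
    rcases hQ with ⟨p, hp, rfl⟩ | ⟨p, hp, rfl⟩
    · obtain ⟨h1, h2, h3⟩ := hG a ha p hp
      obtain ⟨g1, g2, -⟩ := hφ p h1 h2 h3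
      exact Ideal.prime_of_isPrime g2 g1
    · obtain ⟨h1, h2, h3⟩ := hG b hb p hp
      obtain ⟨g1, g2, -⟩ := hφ p h1 h2 h3
      exact Ideal.prime_of_isPrime (D.s_ne_bot g2) (D.s_prime g1)
  have hrec1 : ∀ a b, Gd S a → Gd S b → ((X a b).filter (fun Q => Q = φ (Q.comap (algebraMap (𝓞 K) (𝓞 M))))).map
      (Ideal.comap (algebraMap (𝓞 K) (𝓞 M))) = normalizedFactors a := by
    intro a b ha hb
    simp only [hX, Multiset.filter_add, Multiset.filter_map, Multiset.map_add, Multiset.map_map]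
    rw [Multiset.filter_eq_self.2, Multiset.filter_eq_nil.2, Multiset.map_zero, add_zero]
    · conv_rhs => rw [← Multiset.map_id (normalizedFactors a)]
      refine Multiset.map_congr rfl fun p hp => ?_
      obtain ⟨h1, h2, h3⟩ := hG a ha p hp
      exact (hφ p h1 h2 h3).2.2.1
    · intro p hp h
      obtain ⟨h1, h2, h3⟩ := hG b hb p hp
      have g := hφ p h1 h2 h3
      simp only [Function.comp_apply] at h
      rw [D.s_comap, g.2.2.1] at h
      exact g.2.2.2.1 h
    · intro p hp
      obtain ⟨h1, h2, h3⟩ := hG a ha p hp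
      have g := hφ p h1 h2 h3
      simp only [Function.comp_apply]
      rw [g.2.2.1]
  have hrec2 : ∀ a b, Gd S a → Gd S b → ((X a b).filter (fun Q => ¬ Q = φ (Q.comap (algebraMap (𝓞 K) (𝓞 M))))).map
      (Ideal.comap (algebraMap (𝓞 K) (𝓞 M))) = normalizedFactors b := by
    intro a b ha hb
    simp only [hX, Multiset.filter_add, Multiset.filter_map, Multiset.map_add, Multiset.map_map]
    rw [Multiset.filter_eq_nil.2, Multiset.filter_eq_self.2, Multiset.map_zero, zero_add]
    · conv_rhs => rw [← Multiset.map_id (normalizedFactors b)]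
      refine Multiset.map_congr rfl fun p hp => ?_
      obtain ⟨h1, h2, h3⟩ := hG b hb p hp
      simp only [Function.comp_apply]
      rw [D.s_comap, (hφ p h1 h2 h3).2.2.1]; rfl
    · intro p hp h
      obtain ⟨h1, h2, h3⟩ := hG b hb p hp
      have g := hφ p h1 h2 h3
      simp only [Function.comp_apply] at h
      rw [D.s_comap, g.2.2.1] at h
      exact g.2.2.2.1 h
    · intro p hp h
      obtain ⟨h1, h2, h3⟩ := hG a ha p hp
      have g := hφ p h1 h2 h3
      simp only [Function.comp_apply] at h
      rw [g.2.2.1] at h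
      exact h rfl
  have hnorm : ∀ a b, Gd S a → Gd S b → Ideal.absNorm (X a b).prod = Ideal.absNorm (a * b) := by
    intro a b ha hb
    simp only [hX]
    rw [Multiset.prod_add, map_mul, map_mul, map_multiset_prod, map_multiset_prod, Multiset.map_map, Multiset.map_map]
    conv_rhs => rw [← Ideal.prod_normalizedFactors_eq_self ha.1, ← Ideal.prod_normalizedFactors_eq_self hb.1,
      map_multiset_prod, map_multiset_prod]
    congr 2
    · refine Multiset.map_congr rfl fun p hp => ?_
      obtain ⟨h1, h2, h3⟩ := hG a ha p hp
      exact (hφ p h1 h2 h3).2.2.2.2.1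
    · refine Multiset.map_congr rfl fun p hp => ?_
      obtain ⟨h1, h2, h3⟩ := hG b hb p hp
      exact (hφ p h1 h2 h3).2.2.2.2.2
  have hZ : ZS S s = ∑' a : {a : Ideal (𝓞 K) // Gd S a}, wt s (a : Ideal (𝓞 K)) := by
    unfold ZS
    have := tsum_subtype {a : Ideal (𝓞 K) | Gd S a} (fun a => wt s a)
    refine Eq.trans ?_ this.symm
    refine tsum_congr fun a => ?_
    rw [Set.indicator_apply]; rfl
  let T : {a : Ideal (𝓞 K) // Gd S a} × {a : Ideal (𝓞 K) // Gd S a} → Ideal (𝓞 M) := fun q => (X q.1 q.2).prod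
  have hT : Function.Injective T := by
    rintro ⟨⟨a, ha⟩, ⟨b, hb⟩⟩ ⟨⟨a', ha'⟩, ⟨b', hb'⟩⟩ h
    have h1 : X a b = X a' b' := by
      rw [← hnf a b ha hb, ← hnf a' b' ha' hb']
      exact congrArg _ h
    have e1 : a = a' := by
      rw [← Ideal.prod_normalizedFactors_eq_self ha.1, ← Ideal.prod_normalizedFactors_eq_self ha'.1,
        ← hrec1 a b ha hb, ← hrec1 a' b' ha' hb', h1]
    have e2 : b = b' := by
      rw [← Ideal.prod_normalizedFactors_eq_self hb.1, ← Ideal.prod_normalizedFactors_eq_self hb'.1,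
        ← hrec2 a b ha hb, ← hrec2 a' b' ha' hb', h1]
    subst e1; subst e2; rfl
  calc ZS S s * ZS S s = ∑' q : {a : Ideal (𝓞 K) // Gd S a} × {a : Ideal (𝓞 K) // Gd S a}, wt s (T q) := by
        rw [ENNReal.tsum_prod', hZ, ← ENNReal.tsum_mul_right]
        refine tsum_congr fun a => ?_
        rw [← ENNReal.tsum_mul_left]
        refine tsum_congr fun b => ?_
        rw [← wt_mul]
        unfold wt
        rw [hnorm a b a.2 b.2]
    _ ≤ Zt M s := ENNReal.tsum_comp_le_tsum_of_injective hT _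

end S14

section S15
universe u
open Filter Topology UniqueFactorizationMonoid

theorem nonres {K : Type u} [Field K] [NumberField K] {y : 𝓞 K} (hy : ¬ IsSquare y) (S : Finset (Ideal (𝓞 K))) :
    ∃ Q : Ideal (𝓞 K), Q.IsPrime ∧ Q ≠ ⊥ ∧ Q ∉ S ∧ (2 : 𝓞 K) ∉ Q ∧ y ∉ Q ∧ ¬ Rs Q y := by
  by_contra hcon
  push Not at hcon
  have hy0 : y ≠ 0 := by rintro rfl; exact hy ⟨0, by simp⟩
  obtain ⟨M, i1, i2, i3, h2, D, θ, hθ⟩ := exists_SQ hy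
  set S' : Finset (Ideal (𝓞 K)) := S.filter (fun P => P.IsPrime ∧ P ≠ ⊥) ∪ (normalizedFactors (Ideal.span {2 * y})).toFinset with hS'
  have hS1 : ∀ P ∈ S', P.IsPrime ∧ P ≠ ⊥ := by
    intro P hP
    rcases Finset.mem_union.1 hP with h | h
    · exact (Finset.mem_filter.1 h).2
    · have := prime_of_normalized_factor P (Multiset.mem_toFinset.1 h)
      exact ⟨Ideal.isPrime_of_prime this, this.ne_zero⟩
  have hne : (Ideal.span {2 * y} : Ideal (𝓞 K)) ≠ 0 := by
    intro h
    have := Ideal.span_singleton_eq_bot.1 h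
    exact mul_ne_zero two_ne_zero_O hy0 this
  have hS2 : ∀ P : Ideal (𝓞 K), P.IsPrime → P ≠ ⊥ → P ∉ S' → P ∉ S ∧ (2 : 𝓞 K) ∉ P ∧ y ∉ P := by
    intro P hP h0 h
    rw [hS', Finset.mem_union, not_or] at h
    have h3 : 2 * y ∉ P := fun h' => h.2 (Multiset.mem_toFinset.2
      ((mem_normalizedFactors_iff' hne).2 ⟨(Ideal.prime_of_isPrime h0 hP).irreducible, normalize_eq _, Ideal.dvd_span_singleton.2 h'⟩))
    exact ⟨fun h' => h.1 (Finset.mem_filter.2 ⟨h', hP, h0⟩), fun h' => h3 (P.mul_mem_right _ h'), fun h' => h3 (P.mul_mem_left _ h')⟩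
  have key : ∀ p : Ideal (𝓞 K), ∃ Q : Ideal (𝓞 M), p.IsPrime → p ≠ ⊥ → p ∉ S' →
      Q.IsPrime ∧ Q ≠ ⊥ ∧ Q.comap (algebraMap (𝓞 K) (𝓞 M)) = p ∧ D.s Q ≠ Q ∧ Ideal.absNorm Q = Ideal.absNorm p ∧
      Ideal.absNorm (D.s Q) = Ideal.absNorm p := by
    intro p
    by_cases h : p.IsPrime ∧ p ≠ ⊥ ∧ p ∉ S'
    · obtain ⟨hp, h0, hpS⟩ := h
      obtain ⟨g1, g2, g3⟩ := hS2 p hp h0 hpS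
      obtain ⟨Q, hQ, hQ0, hc⟩ := exists_over (K := M) hp h0
      have hr := hcon p hp h0 g1 g2 g3
      have h2' : ∀ R : Ideal (𝓞 M), R.comap (algebraMap (𝓞 K) (𝓞 M)) = p → (2 : 𝓞 M) ∉ R := by
        intro R hR h
        apply g2; rw [← hR, Ideal.mem_comap, map_ofNat]; exact h
      have a1 := hθ.split hQ hQ0 (h2' Q hc) (by rwa [hc]) (by rwa [hc])
      have hc' : (D.s Q).comap (algebraMap (𝓞 K) (𝓞 M)) = p := by rw [D.s_comap, hc]
      have a2 := hθ.split (D.s_prime hQ) (D.s_ne_bot hQ0) (h2' _ hc') (by rwa [hc']) (by rwa [hc'])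
      refine ⟨Q, fun _ _ _ => ⟨hQ, hQ0, hc, a1.2.1, ?_, ?_⟩⟩
      · rw [a1.2.2.2, hc]
      · rw [a2.2.2.2, hc']
    · exact ⟨⊤, fun h1 h2 h3 => absurd ⟨h1, h2, h3⟩ h⟩
  choose φ hφ using key
  obtain ⟨c, C0, hc, hK⟩ := Zt_bound K
  obtain ⟨c0, C, hc0, hM⟩ := Zt_bound M
  have hlim : Tendsto (fun s : ℝ => (4:ℝ) ^ S'.card * C * (s - 1)) (𝓝[>] 1) (𝓝 0) := by
    have : Continuous fun s : ℝ => (4:ℝ) ^ S'.card * C * (s - 1) := by fun_prop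
    have h := (this.tendsto 1).mono_left (nhdsWithin_le_nhds (s := Set.Ioi 1))
    simpa using h
  have hev := hlim.eventually (gt_mem_nhds (show (0:ℝ) < c ^ 2 by positivity))
  obtain ⟨s, ⟨z, hz0, hz, hz1, -⟩, ⟨w, hw0, hw, -, hw2⟩, h4, hs⟩ :=
    (hK.and (hM.and (hev.and (self_mem_nhdsWithin : Set.Ioi (1:ℝ) ∈ 𝓝[>] 1)))).exists
  have hs : 1 < s := hs
  have e1 := ZS_bd S' hS1 hs (by rw [hz]; exact ENNReal.ofReal_ne_top)
  have e2 := ZS_sq D S' s φ hφ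
  have e3 : Zt K s * Zt K s ≤ 4 ^ S'.card * Zt M s := by
    calc Zt K s * Zt K s ≤ (2 ^ S'.card * ZS S' s) * (2 ^ S'.card * ZS S' s) := mul_le_mul' e1 e1
      _ = 4 ^ S'.card * (ZS S' s * ZS S' s) := by
        rw [show (4:ENNReal) = 2 * 2 by norm_num, mul_pow]; ring
      _ ≤ _ := mul_le_mul' le_rfl e2
  rw [hz, hw, ← ENNReal.ofReal_mul hz0, show (4:ENNReal) = ENNReal.ofReal 4 by simp,
    ← ENNReal.ofReal_pow (by norm_num), ← ENNReal.ofReal_mul (by positivity), ENNReal.ofReal_le_ofReal_iff (by positivity)] at e3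
  have e4 : c ^ 2 ≤ ((s-1)*z)^2 := pow_le_pow_left₀ hc.le hz1 2
  have e5 : (s-1)^2 * (z*z) ≤ (s-1)^2 * (4 ^ S'.card * w) := mul_le_mul_of_nonneg_left e3 (by positivity)
  have e6 : (4 ^ S'.card * (s-1)) * ((s-1)*w) ≤ (4 ^ S'.card * (s-1)) * C := mul_le_mul_of_nonneg_left hw2 (by
    have : 0 ≤ s - 1 := by linarith
    positivity)
  nlinarith

end S15

section S16
universe u
variable {F : Type u} [Field F] [NumberField F]

theorem Rs_eqv {P : Ideal (𝓞 F)} (hP : P.IsPrime) (h0 : P ≠ ⊥) {x y : 𝓞 F} (h : Rs P (x * y)) (hx : x ∉ P) (hy : y ∉ P) : Rs P x ↔ Rs P y :=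
  ⟨fun h' => Rs_of_mul hP h0 h h' hx, fun h' => Rs_of_mul hP h0 (by rwa [mul_comm]) h' hy⟩

theorem Rs_mul_of_iff {P : Ideal (𝓞 F)} (hP : P.IsPrime) (h0 : P ≠ ⊥) (ho : Odd (Ideal.absNorm P)) {x y : 𝓞 F} (hx : x ∉ P) (hy : y ∉ P)
    (h : Rs P x ↔ Rs P y) : Rs P (x * y) := by
  by_cases h1 : Rs P x
  · exact h1.mul (h.1 h1)
  · exact Rs_or hP h0 ho hx hy h1 (fun h2 => h1 (h.2 h2))

theorem Rs_mul_iff {P : Ideal (𝓞 F)} (hP : P.IsPrime) (h0 : P ≠ ⊥) {x y : 𝓞 F} (hx : Rs P x) (hx0 : x ∉ P) : Rs P (x * y) ↔ Rs P y :=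
  ⟨fun h => Rs_of_mul hP h0 h hx hx0, fun h => hx.mul h⟩

theorem upi_notMem {p q : Ideal (𝓞 F)} {π : 𝓞 F} (hp : PD p π) (hq : q.IsPrime) (hne : q ≠ p) (w : (𝓞 F)ˣ) (j : ℕ) : (w : 𝓞 F) * π ^ j ∉ q := by
  intro h
  rcases hq.mem_or_mem h with h | h
  · exact unit_notMem hq w h
  · exact hp.notMem hq hne (hq.mem_of_pow_mem _ h)

theorem unit_of_sq {x y : 𝓞 F} (hx : x ≠ 0) {w : (𝓞 F)ˣ} (h : (w : 𝓞 F) * (x * x) = y * y) : w ∈ (powMonoidHom 2 : (𝓞 F)ˣ →* (𝓞 F)ˣ).range := by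
  have h1 : (Ideal.span {x} : Ideal (𝓞 F)) = Ideal.span {y} := by
    apply ideal_pow_inj two_ne_zero
    rw [Ideal.span_singleton_pow, Ideal.span_singleton_pow, sq, sq, ← h, Ideal.span_singleton_eq_span_singleton]
    exact ⟨w, by ring⟩
  obtain ⟨v, hv⟩ := span_eq_span h1
  refine ⟨v, Units.ext ?_⟩
  rw [powMonoidHom_apply, Units.val_pow_eq_pow_val]
  rw [← hv] at h
  have : (x * x) * ((v : 𝓞 F) ^ 2) = (x * x) * w := by rw [mul_comm _ (w : 𝓞 F), h]; ring
  exact mul_left_cancel₀ (mul_ne_zero hx hx) this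

theorem even_upi {p : Ideal (𝓞 F)} {π : 𝓞 F} (hp : PD p π) (hodd : Odd (classNumber F)) {w : (𝓞 F)ˣ} {j : ℕ} (h : IsSquare ((w : 𝓞 F) * π ^ j)) : Even j := by
  obtain ⟨y, hy⟩ := h
  have h1 : (Ideal.span {y} : Ideal (𝓞 F)) ^ 2 = p ^ (classNumber F * j) := by
    rw [pow_mul, hp.gen, Ideal.span_singleton_pow, Ideal.span_singleton_pow, sq, ← hy, Ideal.span_singleton_eq_span_singleton]
    exact ⟨w⁻¹, by rw [mul_right_comm]; simp⟩
  have := even_of_sq hp.prime hp.ne_bot h1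
  rcases Nat.even_mul.1 this with h | h
  · exact absurd h (Nat.not_even_iff_odd.2 hodd)
  · exact h

def SepT (π : 𝓞 F) (T : Finset (Ideal (𝓞 F))) : Prop := ∀ (w : (𝓞 F)ˣ) (j : ℕ), (∀ q ∈ T, Rs q ((w : 𝓞 F) * π ^ j)) → IsSquare ((w : 𝓞 F) * π ^ j)

noncomputable abbrev UQ (F : Type u) [Field F] [NumberField F] := (𝓞 F)ˣ ⧸ (powMonoidHom 2 : (𝓞 F)ˣ →* (𝓞 F)ˣ).range

theorem UQ_card : Nat.card (UQ F) = 2 ^ Fintype.card (InfinitePlace F) := index_sq_units F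

theorem UQ_fin : Finite (UQ F) := Nat.finite_of_card_ne_zero (by rw [UQ_card]; positivity)

theorem UQ_out (w : (𝓞 F)ˣ) : ∃ v : (𝓞 F)ˣ, w = Quotient.out (w : UQ F) * v ^ 2 := by
  have h : ((Quotient.out (w : UQ F) : (𝓞 F)ˣ) : UQ F) = (w : UQ F) := Quotient.out_eq' _
  rw [QuotientGroup.eq] at h
  obtain ⟨v, hv⟩ := h
  exact ⟨v, by rw [← powMonoidHom_apply, hv]; simp⟩

theorem UQ_eq {c c' : UQ F} (h : (Quotient.out c : (𝓞 F)ˣ) * Quotient.out c' ∈ (powMonoidHom 2 : (𝓞 F)ˣ →* (𝓞 F)ˣ).range) : c = c' := by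
  have h1 : ((Quotient.out c : (𝓞 F)ˣ) : UQ F) = (Quotient.out c' : (𝓞 F)ˣ) := by
    rw [QuotientGroup.eq]
    obtain ⟨v, hv⟩ := h
    refine ⟨(Quotient.out c : (𝓞 F)ˣ)⁻¹ * v, ?_⟩
    rw [map_mul, hv, powMonoidHom_apply]
    rw [inv_pow, sq]; simp [mul_assoc]
  exact (Quotient.out_eq' c).symm.trans (h1.trans (Quotient.out_eq' c'))

theorem exists_T {p : Ideal (𝓞 F)} {π : 𝓞 F} (hp : PD p π) {Qs : Set (Ideal (𝓞 F))} (hQ : ∀ q ∈ Qs, q.IsPrime ∧ q ≠ ⊥ ∧ q ≠ p)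
    (hsep : ∀ (w : (𝓞 F)ˣ) (j : ℕ), ¬ IsSquare ((w : 𝓞 F) * π ^ j) → ∃ q ∈ Qs, ¬ Rs q ((w : 𝓞 F) * π ^ j)) :
    ∃ T : Finset (Ideal (𝓞 F)), (∀ q ∈ T, q ∈ Qs) ∧ SepT π T ∧ ∀ q ∈ T, ¬ SepT π (T.erase q) := by
  have h0 : ∃ T : Finset (Ideal (𝓞 F)), (∀ q ∈ T, q ∈ Qs) ∧ SepT π T := by
    haveI := UQ_fin (F := F)
    haveI := Fintype.ofFinite (UQ F)
    have key : ∀ c : UQ F × Bool, ∃ T : Finset (Ideal (𝓞 F)), (∀ q ∈ T, q ∈ Qs) ∧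
        (¬ IsSquare (((Quotient.out c.1 : (𝓞 F)ˣ) : 𝓞 F) * π ^ (c.2.toNat)) → ∃ q ∈ T, ¬ Rs q (((Quotient.out c.1 : (𝓞 F)ˣ) : 𝓞 F) * π ^ (c.2.toNat))) := by
      intro c
      by_cases h : IsSquare (((Quotient.out c.1 : (𝓞 F)ˣ) : 𝓞 F) * π ^ (c.2.toNat))
      · exact ⟨∅, by simp, fun h' => absurd h h'⟩
      · obtain ⟨q, hq, h1⟩ := hsep _ _ h
        exact ⟨{q}, by simpa using hq, fun _ => ⟨q, by simp, h1⟩⟩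
    choose T hT hT' using key
    refine ⟨Finset.univ.biUnion T, fun q hq => ?_, fun w j h => ?_⟩
    · obtain ⟨c, -, hc⟩ := Finset.mem_biUnion.1 hq
      exact hT c q hc
    · obtain ⟨v, hv⟩ := UQ_out w
      set c : UQ F × Bool := ((w : UQ F), decide (Odd j)) with hc
      obtain ⟨i, hi⟩ : ∃ i, j = c.2.toNat + 2 * i := by
        rcases Nat.even_or_odd j with h | h
        · obtain ⟨i, hi⟩ := h
          exact ⟨i, by simp [hc, Nat.not_odd_iff_even.2 ⟨i, hi⟩]; omega⟩
        · have h' := h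
          obtain ⟨i, hi⟩ := h
          exact ⟨i, by simp [hc, h']; omega⟩
      have e : (w : 𝓞 F) * π ^ j = (((Quotient.out c.1 : (𝓞 F)ˣ) : 𝓞 F) * π ^ (c.2.toNat)) * (((v : 𝓞 F) * π ^ i) * ((v : 𝓞 F) * π ^ i)) := by
        conv_lhs => rw [hv, hi]
        push_cast
        rw [pow_add, two_mul, pow_add]; ring
      by_cases hs : IsSquare (((Quotient.out c.1 : (𝓞 F)ˣ) : 𝓞 F) * π ^ (c.2.toNat))
      · rw [e]; exact hs.mul ⟨_, rfl⟩
      · obtain ⟨q, hq, hq'⟩ := hT' c hs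
        obtain ⟨a1, a2, a3⟩ := hQ q (hT c q hq)
        have h1 := h q (Finset.mem_biUnion.2 ⟨c, Finset.mem_univ _, hq⟩)
        rw [e, mul_comm] at h1
        have h2 := upi_notMem hp a1 a3 v i
        exact absurd (Rs_of_mul a1 a2 h1 (Rs_sq _ _) (fun h3 => h2 ((or_self_iff).1 (a1.mem_or_mem h3)))) hq'
  obtain ⟨T, hT⟩ := h0
  induction hn : T.card using Nat.strong_induction_on generalizing T with
  | _ n ih =>
    by_cases h : ∀ q ∈ T, ¬ SepT π (T.erase q)
    · exact ⟨T, hT.1, hT.2, h⟩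
    · push Not at h
      obtain ⟨q, hq, h⟩ := h
      exact ih _ (by rw [← hn]; exact Finset.card_erase_lt_of_mem hq) (T.erase q) ⟨fun r hr => hT.1 r (Finset.mem_of_mem_erase hr), h⟩ rfl

end S16

section S17
universe u
variable {F : Type u} [Field F] [NumberField F]

theorem T_card {p : Ideal (𝓞 F)} {π : 𝓞 F} (hp : PD p π) (hodd : Odd (classNumber F)) {T : Finset (Ideal (𝓞 F))}
    (hT : ∀ q ∈ T, q.IsPrime ∧ q ≠ ⊥ ∧ q ≠ p ∧ Odd (Ideal.absNorm q)) (hs : SepT π T) :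
    2 * 2 ^ Fintype.card (InfinitePlace F) ≤ 2 ^ T.card := by
  haveI := UQ_fin (F := F)
  let rp : UQ F × Bool → 𝓞 F := fun c => ((Quotient.out c.1 : (𝓞 F)ˣ) : 𝓞 F) * π ^ (c.2.toNat)
  let f : UQ F × Bool → T.powerset := fun c => ⟨T.filter (fun q => ¬ Rs q (rp c)), Finset.mem_powerset.2 (Finset.filter_subset _ _)⟩
  have hf : Function.Injective f := by
    intro c d h
    have h1 : T.filter (fun q => ¬ Rs q (rp c)) = T.filter (fun q => ¬ Rs q (rp d)) := congrArg Subtype.val h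
    have e : rp c * rp d = ((Quotient.out c.1 * Quotient.out d.1 : (𝓞 F)ˣ) : 𝓞 F) * π ^ (c.2.toNat + d.2.toNat) := by
      simp only [rp]; push_cast; rw [pow_add]; ring
    have h2 : IsSquare (rp c * rp d) := by
      rw [e]
      apply hs
      intro q hq
      obtain ⟨a1, a2, a3, a4⟩ := hT q hq
      rw [← e]
      refine Rs_mul_of_iff a1 a2 a4 (upi_notMem hp a1 a3 _ _) (upi_notMem hp a1 a3 _ _) ?_
      have h3 := Finset.ext_iff.1 h1 q
      rw [Finset.mem_filter, Finset.mem_filter] at h3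
      have h4 : ¬ Rs q (rp c) ↔ ¬ Rs q (rp d) := by simpa [hq] using h3
      exact not_iff_not.1 h4
    have h3 := h2
    rw [e] at h3
    have h4 := even_upi hp hodd h3
    have h5 : c.2 = d.2 := by
      revert h4
      cases c.2 <;> cases d.2 <;> simp
    obtain ⟨y, hy⟩ := h3
    rw [← h5, pow_add] at hy
    have h6 := UQ_eq (unit_of_sq (pow_ne_zero _ hp.ne_zero) hy)
    exact Prod.ext h6 h5
  have := Nat.card_le_card_of_injective f hf
  rw [Nat.card_prod, UQ_card, Nat.card_eq_fintype_card, Nat.card_eq_fintype_card, Fintype.card_bool, Fintype.card_coe, Finset.card_powerset] at this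
  omega

theorem realize {p : Ideal (𝓞 F)} {π : 𝓞 F} (hp : PD p π) {T : Finset (Ideal (𝓞 F))}
    (hT : ∀ q ∈ T, q.IsPrime ∧ q ≠ ⊥ ∧ q ≠ p) (hs : SepT π T) (hm : ∀ q ∈ T, ¬ SepT π (T.erase q)) {A : Finset (Ideal (𝓞 F))} (hA : A ⊆ T) :
    ∃ (w : (𝓞 F)ˣ) (j : ℕ), ∀ q ∈ T, Rs q ((w : 𝓞 F) * π ^ j) ↔ q ∉ A := by
  induction A using Finset.induction_on with
  | empty => exact ⟨1, 0, fun q hq => by simpa using Rs_sq q 1⟩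
  | insert r A hr ih =>
    obtain ⟨w, j, h⟩ := ih (fun q hq => hA (Finset.mem_insert_of_mem hq))
    have hrT : r ∈ T := hA (Finset.mem_insert_self _ _)
    have h1 := hm r hrT
    unfold SepT at h1
    push Not at h1
    obtain ⟨v, i, h2, h3⟩ := h1
    have h4 : ¬ Rs r ((v : 𝓞 F) * π ^ i) := by
      intro h4
      apply h3
      apply hs
      intro q hq
      by_cases e : q = r
      · rw [e]; exact h4
      · exact h2 q (Finset.mem_erase.2 ⟨e, hq⟩)
    refine ⟨v * w, i + j, fun q hq => ?_⟩
    obtain ⟨a1, a2, a3⟩ := hT q hq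
    have e : ((v * w : (𝓞 F)ˣ) : 𝓞 F) * π ^ (i + j) = ((v : 𝓞 F) * π ^ i) * ((w : 𝓞 F) * π ^ j) := by
      push_cast; rw [pow_add]; ring
    rw [e]
    by_cases hq' : q = r
    · subst hq'
      have h5 : Rs q ((w : 𝓞 F) * π ^ j) := (h q hq).2 hr
      refine iff_of_false (fun h6 => h4 ?_) (fun h6 => h6 (Finset.mem_insert_self _ _))
      exact Rs_of_mul a1 a2 (by rwa [mul_comm]) h5 (upi_notMem hp a1 a3 _ _)
    · rw [Rs_mul_iff a1 a2 (h2 q (Finset.mem_erase.2 ⟨hq', hq⟩)) (upi_notMem hp a1 a3 _ _), h q hq, Finset.mem_insert, not_or]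
      exact ⟨fun h => ⟨hq', h⟩, fun h => h.2⟩

open UniqueFactorizationMonoid in
theorem exists_z {p : Ideal (𝓞 F)} {π : 𝓞 F} (hp : PD p π) (hodd : Odd (classNumber F)) {T : Finset (Ideal (𝓞 F))}
    (hT : ∀ q ∈ T, q.IsPrime ∧ q ≠ ⊥ ∧ q ≠ p ∧ Odd (Ideal.absNorm q) ∧ ∀ g : 𝓞 F, q ^ classNumber F = Ideal.span {g} → Rs p g) (hs : SepT π T) :
    ∃ z : 𝓞 F, ¬ IsSquare z ∧ (∀ φ : F →+* ℝ, 0 < φ (algebraMap (𝓞 F) F z)) ∧ (∃ ξ : 𝓞 F, (4 : 𝓞 F) ∣ z - ξ ^ 2) ∧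
      (∀ q : Ideal (𝓞 F), q.IsPrime → z ∈ q → q ∈ T) ∧ Rs p z := by
  haveI := UQ_fin (F := F)
  have hc := T_card hp hodd (fun q hq => ⟨(hT q hq).1, (hT q hq).2.1, (hT q hq).2.2.1, (hT q hq).2.2.2.1⟩) hs
  have hg : ∀ q : Ideal (𝓞 F), ∃ g : 𝓞 F, q ∈ T → g ≠ 0 ∧ q ^ classNumber F = Ideal.span {g} := by
    intro q
    by_cases h : q ∈ T
    · obtain ⟨g, h1, h2⟩ := pow_class_principal F (hT q h).2.1
      exact ⟨g, fun _ => ⟨h1, h2⟩⟩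
    · exact ⟨0, fun h' => absurd h' h⟩
  choose g hg using hg
  let G : T.powerset → 𝓞 F := fun A => ∏ q ∈ (A : Finset (Ideal (𝓞 F))), g q
  have hsub : ∀ A : T.powerset, ∀ q ∈ (A : Finset (Ideal (𝓞 F))), q ∈ T := fun A q hq => Finset.mem_powerset.1 A.2 hq
  have hG0 : ∀ A, G A ≠ 0 := fun A => Finset.prod_ne_zero_iff.2 fun q hq => (hg q (hsub A q hq)).1
  have hGs : ∀ A : T.powerset, (Ideal.span {G A} : Ideal (𝓞 F)) = ((classNumber F) • (A : Finset (Ideal (𝓞 F))).val).prod := by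
    intro A
    rw [Multiset.prod_nsmul, ← Ideal.prod_span_singleton, Finset.prod_val, ← Finset.prod_pow]
    exact Finset.prod_congr rfl fun q hq => (hg q (hsub A q hq)).2.symm
  let f : UQ F × T.powerset → 𝓞 F := fun c => ((Quotient.out c.1 : (𝓞 F)ˣ) : 𝓞 F) * G c.2
  have hf : ∀ c, (Ideal.span {f c} : Ideal (𝓞 F)) = Ideal.span {G c.2} := by
    intro c
    rw [Ideal.span_singleton_eq_span_singleton]
    refine ⟨(Quotient.out c.1 : (𝓞 F)ˣ)⁻¹, ?_⟩
    simp only [f]; rw [mul_right_comm]; simp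
  obtain ⟨c, d, hne, h1, h2⟩ := pigeon f (fun c => by
    rw [hf, ← Ideal.prod_span_singleton, map_prod]
    refine Finset.prod_induction _ Odd (fun _ _ => Odd.mul) odd_one fun q hq => ?_
    rw [← (hg q (hsub _ q hq)).2, map_pow]
    exact (hT q (hsub _ q hq)).2.2.2.1.pow) (by
    rw [Nat.card_prod, UQ_card, Nat.card_eq_fintype_card, Fintype.card_coe, Finset.card_powerset, _root_.sq]
    have : 0 < 2 ^ Fintype.card (InfinitePlace F) := by positivity
    exact Nat.mul_lt_mul_of_pos_left (by omega) this)
  have hprime : ∀ A : T.powerset, ∀ q ∈ ((classNumber F) • (A : Finset (Ideal (𝓞 F))).val), Prime q := by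
    intro A q hq
    have hq' := hsub A q (Multiset.mem_of_mem_nsmul hq)
    exact Ideal.prime_of_isPrime (hT q hq').2.1 (hT q hq').1
  refine ⟨f c * f d, ?_, h1, h2, ?_, ?_⟩
  · rintro ⟨y, hy⟩
    apply hne
    have hA : (c.2 : Finset (Ideal (𝓞 F))) = d.2 := by
      have h3 : ((classNumber F) • (c.2 : Finset (Ideal (𝓞 F))).val + (classNumber F) • (d.2 : Finset (Ideal (𝓞 F))).val).prod = (Ideal.span {y} : Ideal (𝓞 F)) ^ 2 := by
        rw [Multiset.prod_add, ← hGs, ← hGs, ← hf, ← hf, Ideal.span_singleton_mul_span_singleton, hy, Ideal.span_singleton_pow, _root_.sq]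
      have h4 := congrArg normalizedFactors h3
      rw [normalizedFactors_prod_of_prime (by
        intro q hq
        rcases Multiset.mem_add.1 hq with h | h
        · exact hprime _ q h
        · exact hprime _ q h), normalizedFactors_pow] at h4
      ext q
      have h5 := congrArg (Multiset.count q) h4
      rw [Multiset.count_add, Multiset.count_nsmul, Multiset.count_nsmul, Multiset.count_nsmul, ← mul_add] at h5
      have h6 : Even (Multiset.count q (c.2 : Finset (Ideal (𝓞 F))).val + Multiset.count q (d.2 : Finset (Ideal (𝓞 F))).val) := by
        have : Even (classNumber F * (Multiset.count q (c.2 : Finset (Ideal (𝓞 F))).val + Multiset.count q (d.2 : Finset (Ideal (𝓞 F))).val)) := by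
          rw [h5]; exact even_two_mul _
        rcases Nat.even_mul.1 this with h | h
        · exact absurd h (Nat.not_even_iff_odd.2 hodd)
        · exact h
      rw [Multiset.count_eq_of_nodup (Finset.nodup _), Multiset.count_eq_of_nodup (Finset.nodup _)] at h6
      simp only [Finset.mem_val] at h6
      by_cases a : q ∈ (c.2 : Finset (Ideal (𝓞 F))) <;> by_cases b : q ∈ (d.2 : Finset (Ideal (𝓞 F))) <;> simp [a, b] at h6 ⊢
    have hA' : c.2 = d.2 := Subtype.ext hA
    refine Prod.ext (UQ_eq (unit_of_sq (hG0 c.2) (y := y) ?_)) hA'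
    rw [← hy]
    simp only [f]
    rw [← hA', Units.val_mul]; ring
  · intro q hq hz
    have : ∀ c, f c ∈ q → q ∈ T := by
      intro c h
      rcases hq.mem_or_mem h with h | h
      · exact absurd h (unit_notMem hq _)
      · obtain ⟨r, hr, h⟩ := (hq.prod_mem_iff).1 h
        have hr' := hsub _ r hr
        have h3 : r ^ classNumber F ≤ q := by rw [(hg r hr').2, Ideal.span_singleton_le_iff_mem]; exact h
        haveI := hq
        have h4 := ((hT r hr').1.isMaximal (hT r hr').2.1).eq_of_le hq.ne_top (Ideal.IsPrime.le_of_pow_le h3)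
        rwa [← h4]
    rcases hq.mem_or_mem hz with h | h
    · exact this _ h
    · exact this _ h
  · have : ∀ c, Rs p (f c) := by
      intro c
      refine (hp.us _).mul ?_
      refine Finset.prod_induction _ (Rs p) (fun _ _ => Rs.mul) (by simpa using Rs_sq p 1) fun q hq => ?_
      exact (hT q (hsub _ q hq)).2.2.2.2 _ (hg q (hsub _ q hq)).2
    exact (this c).mul (this d)

end S17

section S18
universe u
variable {F : Type u} [Field F] [NumberField F]

/-- units that are residues at a family of primes -/
def KR (R : Finset (Ideal (𝓞 F))) (hR : ∀ q ∈ R, q.IsPrime ∧ q ≠ ⊥) : Subgroup (𝓞 F)ˣ where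
  carrier := {w | ∀ q ∈ R, Rs q (w : 𝓞 F)}
  mul_mem' := fun {a b} ha hb q hq => by rw [Units.val_mul]; exact (ha q hq).mul (hb q hq)
  one_mem' := fun q hq => by simpa using Rs_sq q 1
  inv_mem' := fun {a} ha q hq => Rs_of_mul (x := (a : 𝓞 F)) (hR q hq).1 (hR q hq).2 (by simpa using Rs_sq q 1) (ha q hq) (unit_notMem (hR q hq).1 a)

theorem KR_div {R : Finset (Ideal (𝓞 F))} {hR : ∀ q ∈ R, q.IsPrime ∧ q ≠ ⊥} {a b : (𝓞 F)ˣ} (h : (a : (𝓞 F)ˣ ⧸ KR R hR) = b) {q : Ideal (𝓞 F)} (hq : q ∈ R) :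
    ∃ c : 𝓞 F, (b : 𝓞 F) = a * c ∧ Rs q c ∧ c ∉ q := by
  rw [QuotientGroup.eq] at h
  exact ⟨((a⁻¹ * b : (𝓞 F)ˣ) : 𝓞 F), by rw [← Units.val_mul]; simp, h q hq, unit_notMem (hR q hq).1 _⟩

theorem KR_idx {R : Finset (Ideal (𝓞 F))} {hR : ∀ q ∈ R, q.IsPrime ∧ q ≠ ⊥} (h0 : (KR R hR).index ≠ 0) {x : 𝓞 F}
    (h : ∀ A ⊆ R, ∃ (w : (𝓞 F)ˣ) (b : Bool), ∀ q ∈ R, Rs q ((w : 𝓞 F) * x ^ b.toNat) ↔ q ∉ A) : 2 ^ R.card ≤ 2 * (KR R hR).index := by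
  choose! w b h using h
  haveI : Finite ((𝓞 F)ˣ ⧸ KR R hR) := Nat.finite_of_card_ne_zero h0
  let f : R.powerset → ((𝓞 F)ˣ ⧸ KR R hR) × Bool := fun A => ((w A : (𝓞 F)ˣ ⧸ KR R hR), b A)
  have hf : Function.Injective f := by
    rintro ⟨A, hA⟩ ⟨B, hB⟩ e
    have e1 : (w A : (𝓞 F)ˣ ⧸ KR R hR) = w B := congrArg Prod.fst e
    have e2 : b A = b B := congrArg Prod.snd e
    rw [Finset.mem_powerset] at hA hB
    refine Subtype.ext (Finset.ext fun q => ?_)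
    by_cases hq : q ∈ R
    · obtain ⟨c, hc, hc1, hc2⟩ := KR_div e1 hq
      have h1 := h A hA q hq
      have h2 := h B hB q hq
      rw [← e2, hc, mul_comm (w A : 𝓞 F) c, mul_assoc, Rs_mul_iff (hR q hq).1 (hR q hq).2 hc1 hc2, h1] at h2
      exact not_iff_not.1 h2
    · exact iff_of_false (fun h' => hq (hA h')) (fun h' => hq (hB h'))
  have := Nat.card_le_card_of_injective f hf
  rw [Nat.card_prod, Nat.card_eq_fintype_card (α := R.powerset), Nat.card_eq_fintype_card (α := Bool), Fintype.card_bool, Fintype.card_coe, Finset.card_powerset] at this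
  change 2 ^ R.card ≤ (KR R hR).index * 2 at this
  omega

theorem KR_idx' {R : Finset (Ideal (𝓞 F))} {hR : ∀ q ∈ R, q.IsPrime ∧ q ≠ ⊥} (h0 : (KR R hR).index ≠ 0)
    (h : ∀ A ⊆ R, ∃ (w : (𝓞 F)ˣ), ∀ q ∈ R, Rs q (w : 𝓞 F) ↔ q ∉ A) : 2 ^ R.card ≤ (KR R hR).index := by
  choose! w h using h
  haveI : Finite ((𝓞 F)ˣ ⧸ KR R hR) := Nat.finite_of_card_ne_zero h0
  let f : R.powerset → ((𝓞 F)ˣ ⧸ KR R hR) := fun A => (w A : (𝓞 F)ˣ ⧸ KR R hR)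
  have hf : Function.Injective f := by
    rintro ⟨A, hA⟩ ⟨B, hB⟩ e1
    rw [Finset.mem_powerset] at hA hB
    refine Subtype.ext (Finset.ext fun q => ?_)
    by_cases hq : q ∈ R
    · obtain ⟨c, hc, hc1, hc2⟩ := KR_div e1 hq
      have h1 := h A hA q hq
      have h2 := h B hB q hq
      rw [hc, mul_comm (w A : 𝓞 F) c, Rs_mul_iff (hR q hq).1 (hR q hq).2 hc1 hc2, h1] at h2
      exact not_iff_not.1 h2
    · exact iff_of_false (fun h' => hq (hA h')) (fun h' => hq (hB h'))
  have := Nat.card_le_card_of_injective f hf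
  rw [Nat.card_eq_fintype_card, Fintype.card_coe, Finset.card_powerset] at this
  exact this

theorem noT {p : Ideal (𝓞 F)} {π : 𝓞 F} (hp : PD p π) (hodd : Odd (classNumber F)) {T : Finset (Ideal (𝓞 F))}
    (hT : ∀ q ∈ T, q.IsPrime ∧ q ≠ ⊥ ∧ q ≠ p ∧ Odd (Ideal.absNorm q) ∧ ∀ g : 𝓞 F, q ^ classNumber F = Ideal.span {g} → Rs p g)
    (hs : SepT π T) (hm : ∀ q ∈ T, ¬ SepT π (T.erase q)) : False := by
  obtain ⟨z, hz1, hz2, hz3, hz4, hz5⟩ := exists_z hp hodd hT hs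
  have hpT : p ∉ T := fun h => (hT p h).2.2.1 rfl
  obtain ⟨M, i1, i2, i3, h2, D, θ, hθ⟩ := exists_SQ hz1
  have hinf := hθ.unram_inf hz2
  have hram : ∀ P : Ideal (𝓞 M), Ram F P → P.comap (algebraMap (𝓞 F) (𝓞 M)) ∈ T := by
    intro P hP
    refine hz4 _ (Ideal.comap_isPrime (H := hP.1) _ _) ?_
    rw [Ideal.mem_comap, ← hθ.1]
    exact P.mul_mem_left _ (hθ.mem_of_ram hz3 hP)
  have hfin : {P : Ideal (𝓞 M) | Ram F P}.Finite := by
    refine Set.Finite.of_injOn (t := (T : Set (Ideal (𝓞 F)))) (f := Ideal.comap (algebraMap (𝓞 F) (𝓞 M))) (fun P hP => hram P hP) ?_ (Finset.finite_toSet T)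
    intro P hP Q hQ e
    exact Ram.inj hP hQ e
  set R := hfin.toFinset with hRdef
  have hR : ∀ P, P ∈ R ↔ Ram F P := fun P => by rw [hRdef, Set.Finite.mem_toFinset]; rfl
  set R' := R.image (Ideal.comap (algebraMap (𝓞 F) (𝓞 M))) with hR'def
  have hcard : R'.card = R.card := Finset.card_image_of_injOn fun P hP Q hQ e =>
    Ram.inj ((hR P).1 hP) ((hR Q).1 hQ) e
  have hR'T : R' ⊆ T := by
    intro q hq
    obtain ⟨P, hP, rfl⟩ := Finset.mem_image.1 hq
    exact hram P ((hR P).1 hP)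
  have hR'0 : ∀ q ∈ R', q.IsPrime ∧ q ≠ ⊥ := fun q hq => ⟨(hT q (hR'T hq)).1, (hT q (hR'T hq)).2.1⟩
  set KK := KR R' hR'0 with hKK
  have hle : NU F M ≤ KK := by
    intro ε hε q hq
    obtain ⟨P, hP, rfl⟩ := Finset.mem_image.1 hq
    obtain ⟨v, hv⟩ := mem_NU.1 hε
    rw [D.norm_eq_iff] at hv
    exact Ram.Rs_norm D ((hR P).1 hP) hv
  have hNU0 := NU_index_ne D
  have hmul : (NU F M).relIndex KK * KK.index = (NU F M).index := Subgroup.relIndex_mul_index hle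
  have hKK0 : KK.index ≠ 0 := fun h => hNU0 (by rw [← hmul, h, mul_zero])
  have hT' : ∀ q ∈ T, q.IsPrime ∧ q ≠ ⊥ ∧ q ≠ p := fun q hq => ⟨(hT q hq).1, (hT q hq).2.1, (hT q hq).2.2.1⟩
  have hreal : ∀ A ⊆ R', ∃ (w : (𝓞 F)ˣ) (j : ℕ), ∀ q ∈ R', Rs q ((w : 𝓞 F) * π ^ j) ↔ q ∉ A := by
    intro A hA
    obtain ⟨w, j, h⟩ := realize hp hT' hs hm (hA.trans hR'T)
    exact ⟨w, j, fun q hq => h q (hR'T hq)⟩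
  have hπq : ∀ q ∈ R', ∀ j, π ^ j ∉ q := fun q hq j h => by
    have := upi_notMem hp (hR'0 q hq).1 (hT' q (hR'T hq)).2.2 1 j
    rw [Units.val_one, one_mul] at this
    exact this h
  have hup : 2 ^ R'.card ≤ 2 * KK.index := by
    refine KR_idx hKK0 (x := π) fun A hA => ?_
    obtain ⟨w, j, h⟩ := hreal A hA
    refine ⟨w, decide (Odd j), fun q hq => ?_⟩
    rw [← h q hq]
    have h1 := (hR'0 q hq).1
    have h3 := hT' q (hR'T hq)
    refine Rs_eqv h1 h3.2.1 ?_ (upi_notMem hp h1 h3.2.2 _ _) (upi_notMem hp h1 h3.2.2 _ _)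
    obtain ⟨i, hi⟩ : Even ((decide (Odd j)).toNat + j) := by
      by_cases ho : Odd j
      · simp only [ho, decide_true, Bool.toNat_true]; exact odd_one.add_odd ho
      · simp only [ho, decide_false, Bool.toNat_false, zero_add]; exact Nat.not_odd_iff_even.1 ho
    have e : (w : 𝓞 F) * π ^ (decide (Odd j)).toNat * ((w : 𝓞 F) * π ^ j) = ((w : 𝓞 F) * π ^ i) * ((w : 𝓞 F) * π ^ i) := by
      rw [mul_mul_mul_comm, ← pow_add, hi, pow_add]; ring
    rw [e]; exact Rs_sq _ _
  have hG := (G_core D hodd h2 hinf R (fun P hP => (hR P).2 hP)).1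
  rw [← hcard] at hG
  have hidx : (NU F M).index = KK.index := by
    apply le_antisymm
    · omega
    · exact Nat.le_of_dvd (Nat.pos_of_ne_zero hNU0) ⟨_, by rw [← hmul, mul_comm]⟩
  have hNUeq : KK ≤ NU F M := by
    rw [← Subgroup.relIndex_eq_one]
    rw [hidx] at hmul
    exact Nat.eq_of_mul_eq_mul_right (Nat.pos_of_ne_zero hKK0) (by rw [hmul, one_mul])
  have hAmb : AmbPr D := G_B D hodd h2 hinf R (fun P hP => (hR P).2 hP) (by rw [← hcard, hidx]; exact hup)
  obtain ⟨Q, hQ, hQ0, hQc⟩ := exists_over (K := M) hp.prime hp.ne_bot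
  have h2p : (2 : 𝓞 F) ∉ p := two_notMem hp.prime hp.ne_bot hp.odd
  have hspl := (hθ.split hQ hQ0 (fun h => h2p (by rw [← hQc, Ideal.mem_comap, map_ofNat]; exact h)) (by
    rw [hQc]; exact fun h => hpT (hz4 p hp.prime h)) (by rwa [hQc])).1
  rw [hQc] at hspl
  have hQle : ∀ P ∈ R, ∀ N : ℕ, ¬ Q ^ N * D.s (Q ^ N) ≤ P := by
    intro P hP N hle
    have hPr := (hR P).1 hP
    haveI := hPr.1
    rw [D.s_pow, ← mul_pow, ← hspl] at hle
    have h3 : ext M p ≤ P := Ideal.IsPrime.le_of_pow_le hle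
    have h4 : p ≤ P.comap (algebraMap (𝓞 F) (𝓞 M)) := Ideal.map_le_iff_le_comap.1 h3
    have h5 := (hp.prime.isMaximal hp.ne_bot).eq_of_le (Ideal.comap_isPrime (H := hPr.1) _ _).ne_top h4
    exact hpT (h5 ▸ hram P hPr)
  have hstep : ∀ N : ℕ, Pr ((Q ^ N) ^ 2) → Pr ((Q ^ N) ^ classNumber F) := by
    intro N hN
    obtain ⟨β, n, ε, e1, e2, e3⟩ := two_tors D hodd (pow_ne_zero N hQ0) hN
    have hε : ε ∈ KK := by
      intro q hq
      obtain ⟨P, hP, rfl⟩ := Finset.mem_image.1 hq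
      have hPr := (hR P).1 hP
      have hnP : n ∉ P.comap (algebraMap (𝓞 F) (𝓞 M)) := by
        intro h
        apply hQle P hP N
        rw [e2, Ideal.span_singleton_le_iff_mem]; exact h
      have h3 := Ram.Rs_norm D hPr (y := β) (n := n * n * ε) (by rw [e3, map_mul, map_mul, _root_.sq])
      exact Rs_of_mul (hR'0 _ hq).1 (hR'0 _ hq).2 h3 (Rs_sq _ _) (fun h => hnP (or_self_iff.1 ((hR'0 _ hq).1.mem_or_mem h)))
    obtain ⟨η, hη⟩ := mem_NU.1 (hNUeq hε)
    rw [D.norm_eq_iff] at hη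
    exact AMB D hAmb (pow_ne_zero N hQ0) e1 e2 η (by rw [e3, hη])
  have hord : ∃ m, Odd m ∧ Pr (Q ^ m) := by
    obtain ⟨s, m, hm, hs⟩ := Nat.exists_eq_two_pow_mul_odd (classNumber_ne_zero' M)
    have h := Pr.class M hQ0
    rw [hs] at h
    clear hs
    induction s generalizing m with
    | zero => exact ⟨m, hm, by simpa using h⟩
    | succ s ih =>
      refine ih (m * classNumber F) (hm.mul hodd) ?_
      rw [← mul_assoc, pow_mul]
      refine hstep _ ?_
      rwa [← pow_mul, mul_right_comm, ← pow_succ]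
  obtain ⟨m, hm1, γ, hγ, hm2⟩ := hord
  set n := RingOfIntegers.norm F γ with hn
  have hnγ : γ * D.σ γ = algebraMap (𝓞 F) (𝓞 M) n := (D.norm γ).symm
  have hnres : ∀ q ∈ R', Rs q n := by
    intro q hq
    obtain ⟨P, hP, rfl⟩ := Finset.mem_image.1 hq
    exact Ram.Rs_norm D ((hR P).1 hP) hnγ
  have hsp : (Ideal.span {n ^ classNumber F} : Ideal (𝓞 F)) = Ideal.span {π ^ m} := by
    apply span_desc D
    have h3 : (Ideal.span {algebraMap (𝓞 F) (𝓞 M) n} : Ideal (𝓞 M)) = ext M p ^ m := by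
      rw [← hnγ, ← Ideal.span_singleton_mul_span_singleton, ← D.s_span, ← hm2, hspl, D.s_pow, mul_pow]
    rw [map_pow, ← Ideal.span_singleton_pow, h3, ← pow_mul, mul_comm, pow_mul, ← ext_pow, hp.gen, ext_span, Ideal.span_singleton_pow, map_pow]
  obtain ⟨v, hv⟩ := span_eq_span hsp
  have hfin2 : 2 ^ R'.card ≤ KK.index := by
    refine KR_idx' hKK0 fun A hA => ?_
    obtain ⟨w, j, h⟩ := hreal A hA
    rcases Nat.even_or_odd j with ho | ho
    · obtain ⟨i, hi⟩ := ho
      refine ⟨w, fun q hq => ?_⟩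
      rw [← h q hq, hi, pow_add, mul_comm (w : 𝓞 F)]
      refine (Rs_mul_iff (hR'0 q hq).1 (hR'0 q hq).2 (Rs_sq _ _) ?_).symm
      rw [← pow_add]; exact hπq q hq _
    · obtain ⟨i, hi⟩ := ho.add_odd hm1
      refine ⟨w * v, fun q hq => ?_⟩
      rw [← h q hq]
      have h3 := hT' q (hR'T hq)
      refine Rs_eqv h3.1 h3.2.1 ?_ (unit_notMem h3.1 _) (upi_notMem hp h3.1 h3.2.2 _ _)
      have e : n ^ classNumber F * (((w * v : (𝓞 F)ˣ) : 𝓞 F) * ((w : 𝓞 F) * π ^ j)) = ((w : 𝓞 F) * π ^ i) * ((w : 𝓞 F) * π ^ i) := by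
        have : ((w : 𝓞 F) * π ^ i) * ((w : 𝓞 F) * π ^ i) = w * w * π ^ (j + m) := by rw [hi, pow_add]; ring
        rw [this, pow_add, ← hv, Units.val_mul]; ring
      refine Rs_of_mul h3.1 h3.2.1 (x := n ^ classNumber F) (by rw [e]; exact Rs_sq _ _) ((hnres q hq).pow _) ?_
      intro h4
      apply hπq q hq m
      rw [← hv]; exact q.mul_mem_right _ h4
  omega

end S18

section S19
universe u v
variable {F : Type u} {K : Type v} [Field F] [NumberField F] [Field K] [NumberField K] [Algebra F K]
variable {D : QC F K} {p1 p2 : Ideal (𝓞 F)} {π1 π2 : 𝓞 F} {P1 P2 : Ideal (𝓞 K)}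

theorem odd_of_two {q : Ideal (𝓞 F)} (hq : q.IsPrime) (h0 : q ≠ ⊥) (h : (2 : 𝓞 F) ∉ q) : Odd (Ideal.absNorm q) := by
  haveI := hq.isMaximal h0
  letI := Ideal.Quotient.field q
  haveI : Finite (𝓞 F ⧸ q) := Ideal.finiteQuotientOfFreeOfNeBot _ h0
  haveI := Fintype.ofFinite (𝓞 F ⧸ q)
  have h1 : Ideal.absNorm q = Fintype.card (𝓞 F ⧸ q) := by
    rw [← Nat.card_eq_fintype_card]; rfl
  rw [h1, Nat.odd_iff]
  refine FiniteField.odd_card_of_char_ne_two fun h2 => h ?_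
  rw [← Ideal.Quotient.eq_zero_iff_mem, map_ofNat]
  have := ringChar.Nat.cast_ringChar (R := 𝓞 F ⧸ q)
  rw [h2] at this
  exact_mod_cast this

theorem KD.exists_B (H : KD D p1 p2 π1 π2 P1 P2) : ∃ (B : Ideal (𝓞 K)) (q : 𝓞 F), B * D.s B = Ideal.span {algebraMap (𝓞 F) (𝓞 K) q} ∧
    q ∉ p1 ∧ q ∉ p2 ∧ ¬ Rs p1 q := by
  by_contra hcon
  push Not at hcon
  let Qs : Set (Ideal (𝓞 F)) := {q | q.IsPrime ∧ q ≠ ⊥ ∧ q ≠ p1 ∧ Odd (Ideal.absNorm q) ∧ ∀ g : 𝓞 F, q ^ classNumber F = Ideal.span {g} → Rs p1 g}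
  have hsep : ∀ (w : (𝓞 F)ˣ) (j : ℕ), ¬ IsSquare ((w : 𝓞 F) * π1 ^ j) → ∃ q ∈ Qs, ¬ Rs q ((w : 𝓞 F) * π1 ^ j) := by
    intro w j hy
    set y := (w : 𝓞 F) * π1 ^ j with hydef
    have hy2 : y ∉ p2 := upi_notMem H.hp1 H.hp2.prime H.hne.symm w j
    have h2p : (2 : 𝓞 F) ∉ p2 := two_notMem H.hp2.prime H.hp2.ne_bot H.hp2.odd
    clear_value y
    have hyK : ¬ IsSquare (algebraMap (𝓞 F) (𝓞 K) y) := by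
      rintro ⟨z, hz⟩
      have hS := SQ.of D hz.symm hy
      have h1 := H.hP2.act D z
      rw [hS.2, show -z - z = -(2 * z) by ring, neg_mem_iff] at h1
      rcases H.hP2.1.mem_or_mem h1 with h | h
      · apply h2p; rw [← H.c2, Ideal.mem_comap, map_ofNat]; exact h
      · apply hy2; rw [← H.c2, Ideal.mem_comap, hz]; exact P2.mul_mem_left _ h
    obtain ⟨Q, hQ, hQ0, hQS, hQ2, hQy, hQr⟩ := nonres hyK {P1, P2}
    have hQP : Q ≠ P1 ∧ Q ≠ P2 := by simpa using hQS
    set q := Q.comap (algebraMap (𝓞 F) (𝓞 K)) with hq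
    have hqp : q.IsPrime := Ideal.comap_isPrime (H := hQ) _ _
    have hq0 : q ≠ ⊥ := QC.ne_bot_comap hQ0
    have hqo : Odd (Ideal.absNorm q) := odd_of_two hqp hq0 (fun h => hQ2 (by
      rw [hq, Ideal.mem_comap, map_ofNat] at h; exact h))
    have hnr : ¬ Rs q y := by
      rintro ⟨b, hb⟩
      refine hQr ⟨algebraMap (𝓞 F) (𝓞 K) b, ?_⟩
      rw [hq, Ideal.mem_comap, map_sub, map_mul _ b b] at hb; exact hb
    have hext : ext K q = Q * D.s Q := by
      rcases D.dich hQ hQ0 with h | h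
      · exact absurd (inert_Rs D hQ hQ0 hqo h.1 h.2 (η := algebraMap (𝓞 F) (𝓞 K) y) (ε := y * y) (by rw [D.fix, map_mul]) (Rs_sq _ _)) hQr
      · exact h.1
    have hneq : ∀ P : Ideal (𝓞 K), Ram F P → Q ≠ P → q ≠ P.comap (algebraMap (𝓞 F) (𝓞 K)) := by
      intro P hP hne e
      have h1 : P ^ 2 = Q * D.s Q := by rw [← hext, e, hP.2.2]
      have h2 : Q ∣ P := (Ideal.prime_of_isPrime hQ0 hQ).dvd_of_dvd_pow (n := 2) (by rw [h1]; exact dvd_mul_right _ _)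
      exact hne ((hP.1.isMaximal hP.2.1).eq_of_le hQ.ne_top (Ideal.dvd_iff_le.1 h2)).symm
    have hqp1 : q ≠ p1 := by rw [← H.c1]; exact hneq P1 H.hP1 hQP.1
    have hqp2 : q ≠ p2 := by rw [← H.c2]; exact hneq P2 H.hP2 hQP.2
    refine ⟨q, ⟨hqp, hq0, hqp1, hqo, fun g hg => ?_⟩, hnr⟩
    have hgn : ∀ r : Ideal (𝓞 F), r.IsPrime → q ≠ r → g ∉ r := by
      intro r hr hne h
      rw [← Ideal.span_singleton_le_iff_mem, ← hg] at h
      haveI := hr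
      exact hne ((hqp.isMaximal hq0).eq_of_le hr.ne_top (Ideal.IsPrime.le_of_pow_le h))
    refine hcon (Q ^ classNumber F) g ?_ (hgn _ H.hp1.prime hqp1) (hgn _ H.hp2.prime hqp2)
    rw [D.s_pow, ← mul_pow, ← hext, ← ext_pow, hg, ext_span]
  obtain ⟨T, hT, hs, hm⟩ := exists_T H.hp1 (Qs := Qs) (fun q hq => ⟨hq.1, hq.2.1, hq.2.2.1⟩) hsep
  exact noT H.hp1 H.hodd (fun q hq => hT q hq) hs hm

end S19

section S20
universe u v w x
variable {F : Type u} [Field F] [NumberField F] {K : Type v} [Field K] [NumberField K] [Algebra F K]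
variable {K1 : Type w} [Field K1] [NumberField K1] [Algebra F K1]
variable {K2 : Type x} [Field K2] [NumberField K2] [Algebra F K2]
variable {D : QC F K} {D1 : QC F K1} {D2 : QC F K2} {p1 p2 : Ideal (𝓞 F)} {π1 π2 : 𝓞 F} {P1 P2 : Ideal (𝓞 K)} {θ1 : 𝓞 K1} {θ2 : 𝓞 K2}

theorem odd_above {p : Ideal (𝓞 F)} {π : 𝓞 F} (hp : PD p π) {Q : Ideal (𝓞 K)} (hQ : Q.IsPrime) (h0 : Q ≠ ⊥)
    (c : Q.comap (algebraMap (𝓞 F) (𝓞 K)) = p) : (2 : 𝓞 K) ∉ Q ∧ Odd (Ideal.absNorm Q) := by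
  have h : (2 : 𝓞 K) ∉ Q := fun h => two_notMem hp.prime hp.ne_bot hp.odd (by
    rw [← c, Ideal.mem_comap, map_ofNat]; exact h)
  exact ⟨h, odd_of_two hQ h0 h⟩

theorem sign {p : Ideal (𝓞 F)} (hp : p.IsPrime) (h2 : (2 : 𝓞 F) ∉ p) {ε : (𝓞 F)ˣ} {a b : 𝓞 F} (hb : b ^ 2 - 4 * (ε : 𝓞 F) ∈ p) :
    ∃ b' : 𝓞 F, (b' = b ∨ b' = -b) ∧ a + b' ∉ p := by
  by_contra hcon
  push Not at hcon
  have h3 := hcon b (Or.inl rfl)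
  have h4 := hcon (-b) (Or.inr rfl)
  have h5 : 2 * b ∈ p := by convert p.sub_mem h3 h4 using 1; ring
  have h6 : b ∈ p := (hp.mem_or_mem h5).resolve_left h2
  have h7 : 2 * (2 * (ε : 𝓞 F)) ∈ p := by
    convert p.sub_mem (p.mul_mem_left b h6) hb using 1; ring
  exact unit_notMem hp ε ((hp.mem_or_mem ((hp.mem_or_mem h7).resolve_left h2)).resolve_left h2)

theorem KD.datum (H : KD D p1 p2 π1 π2 P1 P2) (hd2 : Module.finrank F K2 = 2) (h1 : SQ D1 π1 θ1) (h2 : SQ D2 π2 θ2)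
    {Q : Ideal (𝓞 K1)} (hQ : Q.IsPrime) (h0 : Q ≠ ⊥) (c : Q.comap (algebraMap (𝓞 F) (𝓞 K1)) = p2) (hr : Rs p2 π1)
    {ε : (𝓞 F)ˣ} {η1 : 𝓞 K1} {η2 : 𝓞 K2} (e1 : η1 * D1.σ η1 = algebraMap (𝓞 F) (𝓞 K1) ε) (e2 : η2 * D2.σ η2 = algebraMap (𝓞 F) (𝓞 K2) ε) :
    ∃ (a : Ideal (𝓞 K)) (d : 𝓞 K) (c : 𝓞 F), a ^ 2 = Ideal.span {d} ∧ a * D.s a = Ideal.span {algebraMap (𝓞 F) (𝓞 K) c} ∧ c ∉ p2 ∧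
      d * D.σ d = algebraMap (𝓞 F) (𝓞 K) c ^ 2 * algebraMap (𝓞 F) (𝓞 K) ε ∧ (Rs Q η1 ↔ Rs p2 c) := by
  obtain ⟨R, hR, cR, -⟩ := kj H.hp2 H.hodd hd2 h2
  obtain ⟨t1, ht1⟩ := D1.trace η1
  obtain ⟨t2, ht2⟩ := D2.trace η2
  have T1 := h1.TD H.hp1.ne_zero e1 ht1.symm
  have T2 := h2.TD H.hp2.ne_zero e2 ht2.symm
  have m2 := tr_mem hR e2 ht2.symm
  rw [cR] at m2
  have h2p : (2 : 𝓞 F) ∉ p2 := two_notMem H.hp2.prime H.hp2.ne_bot H.hp2.odd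
  obtain ⟨t, ht, hc⟩ := sign H.hp2.prime h2p (a := t1) m2
  have T : TD π2 ε t := by
    rcases ht with rfl | rfl
    · exact T2
    · exact T2.neg
  have m : t ^ 2 - 4 * (ε : 𝓞 F) ∈ p2 := by
    rcases ht with rfl | rfl
    · exact m2
    · rwa [neg_sq]
  obtain ⟨θ, hθ, -⟩ := ident (D := D) H.hp1 H.hp2 H.hne H.hodd H.h2 H.hinf H.hP1 H.hP2 H.c1 H.c2 H.hR
  obtain ⟨a, d, -, g1, g2, g3⟩ := M9 H.hp1 H.hp2 H.hne H.hodd H.h2 hθ T1 T (fun h => hc (by rw [h]; exact p2.zero_mem))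
  refine ⟨a, d, t1 + t, g1, g2, hc, g3, ?_⟩
  have ho := odd_above H.hp2 hQ h0 c
  subst c
  have hs := h1.split hQ h0 ho.1 (H.hp1.notMem H.hp2.prime H.hne.symm) hr
  exact cSym hQ h0 hs.2.2.1 e1 ht1.symm m ho.1 hc

theorem KD.X_imp (H : KD D p1 p2 π1 π2 P1 P2) (hd1 : Module.finrank F K1 = 2) (hd2 : Module.finrank F K2 = 2) (h1 : SQ D1 π1 θ1) (h2 : SQ D2 π2 θ2)
    {Q : Ideal (𝓞 K1)} (hQ : Q.IsPrime) (h0 : Q ≠ ⊥) (c : Q.comap (algebraMap (𝓞 F) (𝓞 K1)) = p2) (hr : Rs p2 π1)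
    {Q' : Ideal (𝓞 K2)} (hQ' : Q'.IsPrime) (h0' : Q' ≠ ⊥) (c' : Q'.comap (algebraMap (𝓞 F) (𝓞 K2)) = p1) (hr' : Rs p1 π2)
    {ε : (𝓞 F)ˣ} {η1 : 𝓞 K1} {η2 : 𝓞 K2} (e1 : η1 * D1.σ η1 = algebraMap (𝓞 F) (𝓞 K1) ε) (e2 : η2 * D2.σ η2 = algebraMap (𝓞 F) (𝓞 K2) ε)
    (h : Rs Q' η2) : Rs Q η1 := by
  obtain ⟨a, d, n, g1, g2, g3, g4, g5⟩ := H.datum hd2 h1 h2 hQ h0 c hr e1 e2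
  obtain ⟨a', d', n', g1', g2', g3', g4', g5'⟩ := H.symm.datum hd1 h2 h1 hQ' h0' c' hr' e2 e1
  by_contra hcon
  obtain ⟨B, q, b1, b2, b3, b4⟩ := H.exists_B
  have hε : ε ∉ NU F K := fun hε => hcon (g5.2 (H.last hr g1 g2 g3 g4 hε))
  exact H.bad hε g1 g2 g3 g4 (fun h => hcon (g5.2 h)) g1' g2' g3' g4' (g5'.1 h) b1 b2 b3 b4

theorem inert_triv {p1 p2 : Ideal (𝓞 F)} {π1 π2 : 𝓞 F} (hp2 : PD p2 π2) (h1 : SQ D1 π1 θ1)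
    {Q : Ideal (𝓞 K1)} (hQ : Q.IsPrime) (h0 : Q ≠ ⊥) (c : Q.comap (algebraMap (𝓞 F) (𝓞 K1)) = p2) (hr : ¬ Rs p2 π1)
    {ε : (𝓞 F)ˣ} {η1 : 𝓞 K1} (e1 : η1 * D1.σ η1 = algebraMap (𝓞 F) (𝓞 K1) ε) : Rs Q η1 := by
  subst c
  have := h1.inert hQ h0 hr
  exact inert_Rs D1 hQ h0 hp2.odd this.1 this.2 e1 (hp2.us ε)

theorem KD.eqX (H : KD D p1 p2 π1 π2 P1 P2) (hd1 : Module.finrank F K1 = 2) (hd2 : Module.finrank F K2 = 2) (h1 : SQ D1 π1 θ1) (h2 : SQ D2 π2 θ2)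
    {Q : Ideal (𝓞 K1)} (hQ : Q.IsPrime) (h0 : Q ≠ ⊥) (c : Q.comap (algebraMap (𝓞 F) (𝓞 K1)) = p2)
    {Q' : Ideal (𝓞 K2)} (hQ' : Q'.IsPrime) (h0' : Q' ≠ ⊥) (c' : Q'.comap (algebraMap (𝓞 F) (𝓞 K2)) = p1)
    {ε : (𝓞 F)ˣ} {η1 : 𝓞 K1} {η2 : 𝓞 K2} (e1 : η1 * D1.σ η1 = algebraMap (𝓞 F) (𝓞 K1) ε) (e2 : η2 * D2.σ η2 = algebraMap (𝓞 F) (𝓞 K2) ε) :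
    (Rs Q η1 ↔ Rs Q' η2) ∧ (ε ∈ NU F K → Rs Q η1) := by
  by_cases hr : Rs p2 π1
  · have hr' : Rs p1 π2 := recip H.hp1 H.hp2 H.hne H.hodd hd1 h1 hr
    refine ⟨⟨H.symm.X_imp hd2 hd1 h2 h1 hQ' h0' c' hr' hQ h0 c hr e2 e1, H.X_imp hd1 hd2 h1 h2 hQ h0 c hr hQ' h0' c' hr' e1 e2⟩, fun hε => ?_⟩
    obtain ⟨a, d, n, g1, g2, g3, g4, g5⟩ := H.datum hd2 h1 h2 hQ h0 c hr e1 e2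
    exact g5.2 (H.last hr g1 g2 g3 g4 hε)
  · have hr' : ¬ Rs p1 π2 := fun h => hr (recip H.hp2 H.hp1 H.hne.symm H.hodd hd2 h2 h)
    have k1 := inert_triv (p1 := p1) H.hp2 h1 hQ h0 c hr e1
    exact ⟨⟨fun _ => inert_triv (p1 := p2) H.hp1 h2 hQ' h0' c' hr' e2, fun _ => k1⟩, fun _ => k1⟩

theorem KD.mk' (hp1 : PD p1 π1) (hp2 : PD p2 π2) (hne : p1 ≠ p2) (hodd : Odd (classNumber F)) (D : QC F K)
    (h2 : Module.finrank F K = 2) (hinf : UnramifiedAtInfinitePlaces F K)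
    (hram : ∀ p : Ideal (𝓞 F), p.IsPrime → p ≠ ⊥ → (IsRamifiedIn F K p ↔ p = p1 ∨ p = p2)) :
    ∃ P1 P2 : Ideal (𝓞 K), KD D p1 p2 π1 π2 P1 P2 := by
  obtain ⟨P1, hP1, c1⟩ := (isRamifiedIn_iff D hp1.prime hp1.ne_bot).1 ((hram p1 hp1.prime hp1.ne_bot).2 (Or.inl rfl))
  obtain ⟨P2, hP2, c2⟩ := (isRamifiedIn_iff D hp2.prime hp2.ne_bot).1 ((hram p2 hp2.prime hp2.ne_bot).2 (Or.inr rfl))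
  refine ⟨P1, P2, hp1, hp2, hne, hodd, h2, hinf, hP1, hP2, c1, c2, fun P hP => ?_⟩
  have hpp := hP.1.comap (algebraMap (𝓞 F) (𝓞 K))
  have hp0 := QC.ne_bot_comap (F := F) hP.2.1
  rcases (hram _ hpp hp0).1 ((isRamifiedIn_iff D hpp hp0).2 ⟨P, hP, rfl⟩) with h | h
  · exact Or.inl (hP.inj hP1 (h.trans c1.symm))
  · exact Or.inr (hP.inj hP2 (h.trans c2.symm))

theorem PD.mk' {p : Ideal (𝓞 F)} {π : 𝓞 F} (hp : p.IsPrime) (hN : Odd (Ideal.absNorm p)) (hprim : IsPrimaryIdeal F p)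
    (hπ : IsPrimaryElem F π) (hgen : p ^ classNumber F = Ideal.span {π}) : PD p π := by
  have h0 : p ≠ ⊥ := by
    rintro rfl
    rw [Ideal.absNorm_bot] at hN
    exact absurd hN (by decide)
  exact ⟨hp, h0, hN, US_of hp h0 hN hprim, hπ.1, hπ.2, hgen⟩

theorem PD.sqrt {p : Ideal (𝓞 F)} {π : 𝓞 F} (hp : PD p π) (hodd : Odd (classNumber F)) (D : QC F K) {β : K}
    (hβ : β ^ 2 = algebraMap F K (algebraMap (𝓞 F) F π)) : ∃ θ, SQ D π θ := by
  obtain ⟨w, -, hw⟩ := int_sqrt β (algebraMap (𝓞 F) (𝓞 K) π) (by rw [← _root_.sq, hβ]; rfl)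
  exact ⟨w, SQ.of D hw (hp.not_sq hodd)⟩

theorem sym_congr {L M : Type*} [Field L] [NumberField L] [Field M] [NumberField M] {P : Ideal (𝓞 L)} {Q : Ideal (𝓞 M)} (hP : P.IsPrime) (h0 : P ≠ ⊥) (ho : Odd (Ideal.absNorm P))
    (hQ : Q.IsPrime) (h0' : Q ≠ ⊥) (ho' : Odd (Ideal.absNorm Q)) (η : (𝓞 L)ˣ) (η' : (𝓞 M)ˣ) (h : Rs P (η : 𝓞 L) ↔ Rs Q (η' : 𝓞 M)) :
    quadResSym L P (η : 𝓞 L) = quadResSym M Q (η' : 𝓞 M) := by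
  have a := sym_eq_one hP h0 ho (unit_notMem hP η)
  have b := sym_eq_one hQ h0' ho' (unit_notMem hQ η')
  have i : quadResSym L P (η : 𝓞 L) = 1 ↔ quadResSym M Q (η' : 𝓞 M) = 1 := a.trans (h.trans b.symm)
  rcases sym_val P (η : 𝓞 L) with h1 | h1 <;> rcases sym_val Q (η' : 𝓞 M) with h2 | h2 <;> rw [h1, h2] at i ⊢ <;> norm_num at i

end S20

/-- The characters `X₁(ε) = [η₁/𝔓₂]` (where `N_{k₁/F} η₁ = ε`) and
`X₂(ε) = [η₂/𝔓₁]` (where `N_{k₂/F} η₂ = ε`) on `E_F` are well defined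
(every unit of `F` is such a norm and the symbol only depends on the norm),
multiplicative, equal to each other, and trivial on `N_{k/F} E_k`. -/
theorem scholz_characters
    (F : Type*) [Field F] [NumberField F]
    (hoddF : Odd (NumberField.classNumber F))
    (k : Type*) [Field k] [NumberField k] [Algebra F k]
    (hdeg : Module.finrank F k = 2)
    (𝔭₁ 𝔭₂ : Ideal (𝓞 F)) (hp1 : 𝔭₁.IsPrime) (hp2 : 𝔭₂.IsPrime) (hne : 𝔭₁ ≠ 𝔭₂)
    (hN1 : Odd (Ideal.absNorm 𝔭₁)) (hN2 : Odd (Ideal.absNorm 𝔭₂))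
    (hram : ∀ 𝔭 : Ideal (𝓞 F), 𝔭.IsPrime → 𝔭 ≠ ⊥ →
      (IsRamifiedIn F k 𝔭 ↔ 𝔭 = 𝔭₁ ∨ 𝔭 = 𝔭₂))
    (hinf : UnramifiedAtInfinitePlaces F k)
    (hprim1 : IsPrimaryIdeal F 𝔭₁) (hprim2 : IsPrimaryIdeal F 𝔭₂)
    (π₁ π₂ : 𝓞 F) (hπ₁ : IsPrimaryElem F π₁) (hπ₂ : IsPrimaryElem F π₂)
    (hgen1 : 𝔭₁ ^ NumberField.classNumber F = Ideal.span {π₁})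
    (hgen2 : 𝔭₂ ^ NumberField.classNumber F = Ideal.span {π₂})
    (k₁ : Type*) [Field k₁] [NumberField k₁] [Algebra F k₁]
    (hdeg1 : Module.finrank F k₁ = 2)
    (β₁ : k₁) (hβ₁ : β₁ ^ 2 = algebraMap F k₁ (algebraMap (𝓞 F) F π₁))  -- `k₁ = F(√π₁)`
    (k₂ : Type*) [Field k₂] [NumberField k₂] [Algebra F k₂]
    (hdeg2 : Module.finrank F k₂ = 2)
    (β₂ : k₂) (hβ₂ : β₂ ^ 2 = algebraMap F k₂ (algebraMap (𝓞 F) F π₂))  -- `k₂ = F(√π₂)`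
    (𝔓₂ : Ideal (𝓞 k₁)) (hP2 : 𝔓₂.IsPrime) (hP2ne : 𝔓₂ ≠ ⊥)
    (hP2above : Ideal.map (algebraMap (𝓞 F) (𝓞 k₁)) 𝔭₂ ≤ 𝔓₂)  -- `𝔓₂` lies above `𝔭₂`
    (𝔓₁ : Ideal (𝓞 k₂)) (hP1 : 𝔓₁.IsPrime) (hP1ne : 𝔓₁ ≠ ⊥)
    (hP1above : Ideal.map (algebraMap (𝓞 F) (𝓞 k₂)) 𝔭₁ ≤ 𝔓₁)  -- `𝔓₁` lies above `𝔭₁`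
    : -- every unit of `F` is the norm of a unit of `k₁` and of a unit of `k₂`
      (∀ ε : (𝓞 F)ˣ, ∃ η₁ : (𝓞 k₁)ˣ, RingOfIntegers.norm F (η₁ : 𝓞 k₁) = (ε : 𝓞 F)) ∧
      (∀ ε : (𝓞 F)ˣ, ∃ η₂ : (𝓞 k₂)ˣ, RingOfIntegers.norm F (η₂ : 𝓞 k₂) = (ε : 𝓞 F)) ∧
      -- `X₁` and `X₂` are well defined: the symbols only depend on the norm
      (∀ η η' : (𝓞 k₁)ˣ,
        RingOfIntegers.norm F (η : 𝓞 k₁) = RingOfIntegers.norm F (η' : 𝓞 k₁) →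
        quadResSym k₁ 𝔓₂ (η : 𝓞 k₁) = quadResSym k₁ 𝔓₂ (η' : 𝓞 k₁)) ∧
      (∀ η η' : (𝓞 k₂)ˣ,
        RingOfIntegers.norm F (η : 𝓞 k₂) = RingOfIntegers.norm F (η' : 𝓞 k₂) →
        quadResSym k₂ 𝔓₁ (η : 𝓞 k₂) = quadResSym k₂ 𝔓₁ (η' : 𝓞 k₂)) ∧
      -- `X₁` and `X₂` are characters: they are multiplicative
      (∀ η η' : (𝓞 k₁)ˣ, quadResSym k₁ 𝔓₂ ((η * η' : (𝓞 k₁)ˣ) : 𝓞 k₁) =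
        quadResSym k₁ 𝔓₂ (η : 𝓞 k₁) * quadResSym k₁ 𝔓₂ (η' : 𝓞 k₁)) ∧
      (∀ η η' : (𝓞 k₂)ˣ, quadResSym k₂ 𝔓₁ ((η * η' : (𝓞 k₂)ˣ) : 𝓞 k₂) =
        quadResSym k₂ 𝔓₁ (η : 𝓞 k₂) * quadResSym k₂ 𝔓₁ (η' : 𝓞 k₂)) ∧
      -- `X₁ = X₂`
      (∀ (ε : (𝓞 F)ˣ) (η₁ : (𝓞 k₁)ˣ) (η₂ : (𝓞 k₂)ˣ),
        RingOfIntegers.norm F (η₁ : 𝓞 k₁) = (ε : 𝓞 F) →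
        RingOfIntegers.norm F (η₂ : 𝓞 k₂) = (ε : 𝓞 F) →
        quadResSym k₁ 𝔓₂ (η₁ : 𝓞 k₁) = quadResSym k₂ 𝔓₁ (η₂ : 𝓞 k₂)) ∧
      -- `X₁(ε) = 1` whenever `ε` is the norm of a unit of `k`
      (∀ ε : (𝓞 F)ˣ, (∃ u : (𝓞 k)ˣ, RingOfIntegers.norm F (u : 𝓞 k) = (ε : 𝓞 F)) →
        ∀ η₁ : (𝓞 k₁)ˣ, RingOfIntegers.norm F (η₁ : 𝓞 k₁) = (ε : 𝓞 F) →
        quadResSym k₁ 𝔓₂ (η₁ : 𝓞 k₁) = 1) := by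
  have q1 := PD.mk' hp1 hN1 hprim1 hπ₁ hgen1
  have q2 := PD.mk' hp2 hN2 hprim2 hπ₂ hgen2
  obtain ⟨D, -⟩ := QC.exists hdeg
  obtain ⟨D1, -⟩ := QC.exists hdeg1
  obtain ⟨D2, -⟩ := QC.exists hdeg2
  obtain ⟨θ1, s1⟩ := q1.sqrt hoddF D1 hβ₁
  obtain ⟨θ2, s2⟩ := q2.sqrt hoddF D2 hβ₂
  obtain ⟨R1, R2, H⟩ := KD.mk' q1 q2 hne hoddF D hdeg hinf hram
  have c2 : 𝔓₂.comap (algebraMap (𝓞 F) (𝓞 k₁)) = 𝔭₂ := comap_eq_of_le hp2 q2.ne_bot hP2 hP2above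
  have c1 : 𝔓₁.comap (algebraMap (𝓞 F) (𝓞 k₂)) = 𝔭₁ := comap_eq_of_le hp1 q1.ne_bot hP1 hP1above
  have o2 := (odd_above q2 hP2 hP2ne c2).2
  have o1 := (odd_above q1 hP1 hP1ne c1).2
  have n1 : NU F k₁ = ⊤ := by obtain ⟨_, -, -, -, h, -⟩ := kj q1 hoddF hdeg1 s1; exact h
  have n2 : NU F k₂ = ⊤ := by obtain ⟨_, -, -, -, h, -⟩ := kj q2 hoddF hdeg2 s2; exact h
  have N1 : ∀ ε : (𝓞 F)ˣ, ∃ η₁ : (𝓞 k₁)ˣ, RingOfIntegers.norm F (η₁ : 𝓞 k₁) = (ε : 𝓞 F) :=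
    fun ε => mem_NU.1 (n1 ▸ Subgroup.mem_top ε)
  have N2 : ∀ ε : (𝓞 F)ˣ, ∃ η₂ : (𝓞 k₂)ˣ, RingOfIntegers.norm F (η₂ : 𝓞 k₂) = (ε : 𝓞 F) :=
    fun ε => mem_NU.1 (n2 ▸ Subgroup.mem_top ε)
  refine ⟨N1, N2, ?_, ?_, ?_, ?_, ?_, ?_⟩
  · intro η η' e
    have e' := ((D1.norm_eq_iff _ _).1 e).trans ((D1.norm_eq_iff _ _).1 rfl).symm
    have hU : US (𝔓₂.comap (algebraMap (𝓞 F) (𝓞 k₁))) := by rw [c2]; exact q2.us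
    exact sym_congr hP2 hP2ne o2 hP2 hP2ne o2 η η' ⟨wd q1 hoddF hdeg1 s1 hP2 hP2ne hU e', wd q1 hoddF hdeg1 s1 hP2 hP2ne hU e'.symm⟩
  · intro η η' e
    have e' := ((D2.norm_eq_iff _ _).1 e).trans ((D2.norm_eq_iff _ _).1 rfl).symm
    have hU : US (𝔓₁.comap (algebraMap (𝓞 F) (𝓞 k₂))) := by rw [c1]; exact q1.us
    exact sym_congr hP1 hP1ne o1 hP1 hP1ne o1 η η' ⟨wd q2 hoddF hdeg2 s2 hP1 hP1ne hU e', wd q2 hoddF hdeg2 s2 hP1 hP1ne hU e'.symm⟩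
  · intro η η'
    rw [Units.val_mul]
    exact sym_mul hP2 hP2ne o2 (unit_notMem hP2 η) (unit_notMem hP2 η')
  · intro η η'
    rw [Units.val_mul]
    exact sym_mul hP1 hP1ne o1 (unit_notMem hP1 η) (unit_notMem hP1 η')
  · intro ε η₁ η₂ h1 h2
    exact sym_congr hP2 hP2ne o2 hP1 hP1ne o1 η₁ η₂ (H.eqX hdeg1 hdeg2 s1 s2 hP2 hP2ne c2 hP1 hP1ne c1
      ((D1.norm_eq_iff _ _).1 h1) ((D2.norm_eq_iff _ _).1 h2)).1
  · intro ε hε η₁ h1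
    obtain ⟨η₂, h2⟩ := N2 ε
    exact (sym_eq_one hP2 hP2ne o2 (unit_notMem hP2 η₁)).2 ((H.eqX hdeg1 hdeg2 s1 s2 hP2 hP2ne c2 hP1 hP1ne c1
      ((D1.norm_eq_iff _ _).1 h1) ((D2.norm_eq_iff _ _).1 h2)).2 (mem_NU.2 hε))
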